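/- arXiv:1308.1387 — 5 statements merged into one kernel-verified Lean document; each statement's English description precedes it below -/
import Mathlib

section
/- Let n ≥ 2 and let Q : ℝ^n × ℝ^n → ℝ^n be a bilinear map with coordinates Q_{ijk}, and for u ∈ ℝ^n let Q_u(x,y) := Q(x,y) + (u_1 x_1 y_1, …, u_n x_n y_n). Then the set of u ∈ ℝ^n for which T_{Q_u} has nonvanishing rotational curvature (for every λ ∈ ℝ^n \ {0}, the n×n matrix with (j,k) entry Σ_{i=1}^n λ_i (Q_u)_{ijk} is invertible) is NOT dense in ℝ^n. -/
/-- The perturbed bilinear map `Q_u(x,y) = Q(x,y) + (u₁x₁y₁, …, uₙxₙyₙ)` (as a function). -/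
def Qufun {n : ℕ} (Q : (Fin n → ℝ) →ₗ[ℝ] (Fin n → ℝ) →ₗ[ℝ] (Fin n → ℝ))
    (u x y : Fin n → ℝ) : Fin n → ℝ :=
  Q x y + fun i => u i * x i * y i

/-- The rotational-curvature matrix of `Q_u` at `λ`: its `(j,k)` entry is
`Σ_i λ_i (Q_u)_{ijk}`, where `(Q_u)_{ijk}` are the coordinates of `Q_u`. -/
def rotMat {n : ℕ} (Q : (Fin n → ℝ) →ₗ[ℝ] (Fin n → ℝ) →ₗ[ℝ] (Fin n → ℝ))
    (u l : Fin n → ℝ) : Matrix (Fin n) (Fin n) ℝ :=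
  Matrix.of fun j k => ∑ i, l i * Qufun Q u (Pi.single j 1) (Pi.single k 1) i

/-- The rotational-curvature matrix in the rescaled coordinates `m i = l i * u i`, `v i = (u i)⁻¹`. -/
def rescaledRotMat {n : ℕ} (Q : (Fin n → ℝ) →ₗ[ℝ] (Fin n → ℝ) →ₗ[ℝ] (Fin n → ℝ))
    (v m : Fin n → ℝ) : Matrix (Fin n) (Fin n) ℝ :=
  Matrix.diagonal m +
    Matrix.of fun j k => ∑ i, m i * v i * Q (Pi.single j 1) (Pi.single k 1) i

theorem continuous_det_rescaledRotMat {n : ℕ}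
    (Q : (Fin n → ℝ) →ₗ[ℝ] (Fin n → ℝ) →ₗ[ℝ] (Fin n → ℝ)) :
    Continuous fun p : (Fin n → ℝ) × (Fin n → ℝ) => (rescaledRotMat Q p.1 p.2).det := by
  refine Continuous.matrix_det (Continuous.add (Continuous.matrix_diagonal continuous_snd) ?_)
  refine continuous_matrix fun j k => ?_
  simp only [Matrix.of_apply]
  fun_prop

theorem det_rescaledRotMat_zero {n : ℕ}
    (Q : (Fin n → ℝ) →ₗ[ℝ] (Fin n → ℝ) →ₗ[ℝ] (Fin n → ℝ)) (m : Fin n → ℝ) :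
    (rescaledRotMat Q 0 m).det = ∏ i, m i := by
  have h : rescaledRotMat Q 0 m = Matrix.diagonal m := by
    ext j k
    simp [rescaledRotMat]
  rw [h, Matrix.det_diagonal]

theorem rotMat_mul_inv {n : ℕ} (Q : (Fin n → ℝ) →ₗ[ℝ] (Fin n → ℝ) →ₗ[ℝ] (Fin n → ℝ))
    {u : Fin n → ℝ} (hu : ∀ i, u i ≠ 0) (m : Fin n → ℝ) :
    rotMat Q u (m * u⁻¹) = rescaledRotMat Q u⁻¹ m := by
  ext j k
  have h (i : Fin n) : m i * (u i)⁻¹ * (u i * (Pi.single j 1 : Fin n → ℝ) i *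
      (Pi.single k 1 : Fin n → ℝ) i) =
      (Pi.single j 1 : Fin n → ℝ) i * (m i * (Pi.single k 1 : Fin n → ℝ) i) := by
    field_simp [hu i]
  simp only [rotMat, Qufun, rescaledRotMat, Matrix.of_apply, Matrix.add_apply, Pi.add_apply,
    Pi.mul_apply, Pi.inv_apply, mul_add, Finset.sum_add_distrib, h]
  rw [add_comm]
  congr 1
  rcases eq_or_ne j k with rfl | hjk
  · simp [Pi.single_apply]
  · simp [hjk, hjk.symm, Pi.single_apply]

/-- for `n ≥ 2`, the set of `u` for which `T_{Q_u}` has nonvanishing rotational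
curvature is not dense in `ℝⁿ`. -/
theorem rotational_curvature_set_not_dense (n : ℕ) (hn : 2 ≤ n)
    (Q : (Fin n → ℝ) →ₗ[ℝ] (Fin n → ℝ) →ₗ[ℝ] (Fin n → ℝ)) :
    ¬ Dense {u : Fin n → ℝ | ∀ l : Fin n → ℝ, l ≠ 0 → IsUnit (rotMat Q u l)} := by
  let z : Fin n := ⟨0, by lia⟩
  let o : Fin n := ⟨1, by lia⟩
  have hoz : o ≠ z := by simp [o, z]
  let m : ℝ → Fin n → ℝ := Function.update (1 : Fin n → ℝ) z
  have hm : Continuous m := continuous_const.update z continuous_id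
  have hprod (t : ℝ) : ∏ i, m t i = t := by
    simp [m, Finset.prod_update_of_mem]
  have hF := continuous_det_rescaledRotMat Q
  have hev (t : ℝ) : Filter.Tendsto (fun v => (rescaledRotMat Q v (m t)).det) (nhds 0)
      (nhds t) := by
    have h : Continuous fun v => (rescaledRotMat Q v (m t)).det :=
      hF.comp (continuous_id.prodMk continuous_const)
    simpa only [det_rescaledRotMat_zero, hprod] using h.tendsto 0
  obtain ⟨ε, hε, hball⟩ := Metric.eventually_nhds_iff.1
    (((hev 1).eventually_const_lt one_pos).and
      ((hev (-1)).eventually_lt_const neg_one_lt_zero))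
  intro hdense
  have hopen : IsOpen (Set.pi Set.univ fun _ : Fin n => Set.Ioi ε⁻¹) :=
    isOpen_set_pi Set.finite_univ fun _ _ => isOpen_Ioi
  obtain ⟨u, hu, huQ⟩ := hdense.inter_open_nonempty _ hopen
    ⟨fun _ => ε⁻¹ + 1, fun _ _ => lt_add_one ε⁻¹⟩
  have hlt (i : Fin n) : ε⁻¹ < u i := hu i trivial
  have hpos (i : Fin n) : 0 < u i := (inv_pos.2 hε).trans (hlt i)
  have hdist : dist u⁻¹ 0 < ε := by
    refine (dist_pi_lt_iff hε).2 fun i => ?_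
    rw [Pi.inv_apply, Pi.zero_apply, Real.dist_0_eq_abs, abs_of_pos (inv_pos.2 (hpos i))]
    exact inv_lt_of_inv_lt₀ hε (hlt i)
  obtain ⟨h1, h2⟩ := hball hdist
  have hcont : Continuous fun t => (rescaledRotMat Q u⁻¹ (m t)).det :=
    hF.comp (continuous_const.prodMk hm)
  obtain ⟨t, ht⟩ := mem_range_of_exists_le_of_exists_ge hcont ⟨-1, h2.le⟩ ⟨1, h1.le⟩
  have hl : m t * u⁻¹ ≠ 0 := by
    intro h
    have := congrFun h o
    simp [m, Function.update_of_ne hoz, (hpos o).ne'] at this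
  have hunit := huQ _ hl
  rw [rotMat_mul_inv Q (fun i => (hpos i).ne'), Matrix.isUnit_iff_isUnit_det] at hunit
  exact hunit.ne_zero ht
end

section
/- Let n ≥ 1 with n ∉ {1, 2, 4, 8}. Then for EVERY bilinear map Q : ℝ^n × ℝ^n → ℝ^n with coordinates Q_{ijk}, there exists λ ∈ ℝ^n \ {0} such that the n×n matrix with (j,k) entry Σ_{i=1}^n λ_i Q_{ijk} is singular; in other words, no operator T_Q in this family can have nonvanishing rotational curvature unless n = 1, 2, 4, or 8. -/
namespace FockIndex

open MeasureTheory Filter Topology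
open scoped ComplexConjugate ENNReal NNReal InnerProductSpace

set_option linter.unusedSectionVars false

/-! ### Gaussian moments on `ℂ` -/

section

/-- The standard Gaussian probability measure `π⁻¹ exp (-|z|²) dz` on `ℂ`. -/
noncomputable def gauss : Measure ℂ :=
  volume.withDensity fun z => ENNReal.ofReal (Real.pi⁻¹ * Real.exp (-‖z‖ ^ 2))

lemma measurable_gauss_density :
    Measurable fun z : ℂ => ENNReal.ofReal (Real.pi⁻¹ * Real.exp (-‖z‖ ^ 2)) := by
  fun_prop

lemma integral_gauss (F : ℂ → ℂ) :
    ∫ z, F z ∂gauss = ∫ z : ℂ, (Real.pi⁻¹ * Real.exp (-‖z‖ ^ 2)) • F z := by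
  rw [gauss, integral_withDensity_eq_integral_toReal_smul measurable_gauss_density
    (Filter.Eventually.of_forall fun _ => ENNReal.ofReal_lt_top)]
  congr 1 with z
  rw [ENNReal.toReal_ofReal (by positivity)]

lemma integrable_gauss_iff (F : ℂ → ℂ) :
    Integrable F gauss ↔
      Integrable fun z : ℂ => (Real.pi⁻¹ * Real.exp (-‖z‖ ^ 2)) • F z := by
  rw [gauss, integrable_withDensity_iff_integrable_smul' measurable_gauss_density
    (Filter.Eventually.of_forall fun _ => ENNReal.ofReal_lt_top)]
  have : ∀ z : ℂ, (ENNReal.ofReal (Real.pi⁻¹ * Real.exp (-‖z‖ ^ 2))).toReal =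
    Real.pi⁻¹ * Real.exp (-‖z‖ ^ 2) := fun z => ENNReal.toReal_ofReal (by positivity)
  simp only [this]

lemma integral_norm_pow_mul_exp (k : ℕ) :
    ∫ z : ℂ, ‖z‖ ^ k * Real.exp (-‖z‖ ^ 2) = Real.pi * Real.Gamma ((k + 2) / 2) := by
  have := Complex.integral_rpow_mul_exp_neg_rpow (p := 2) (q := k) (by norm_num)
    (by have : (0 : ℝ) ≤ k := k.cast_nonneg
        linarith)
  simp only [Real.rpow_natCast, Real.rpow_ofNat] at this
  rw [this]
  ring

lemma integrable_norm_pow_mul_exp (k : ℕ) :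
    Integrable fun z : ℂ => ‖z‖ ^ k * Real.exp (-‖z‖ ^ 2) := by
  by_contra h
  have h1 := integral_norm_pow_mul_exp k
  rw [integral_undef h] at h1
  have : 0 < Real.pi * Real.Gamma ((k + 2) / 2) :=
    mul_pos Real.pi_pos (Real.Gamma_pos_of_pos (by positivity))
  linarith

lemma integrable_gauss_monomial (a b : ℕ) :
    Integrable (fun z : ℂ => conj z ^ a * z ^ b) gauss := by
  rw [integrable_gauss_iff]
  refine ((integrable_norm_pow_mul_exp (a + b)).const_mul Real.pi⁻¹).mono'
    (Continuous.aestronglyMeasurable (by fun_prop)) (Filter.Eventually.of_forall fun z => ?_)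
  rw [norm_smul, Real.norm_of_nonneg (by positivity)]
  simp only [norm_mul, norm_pow, RCLike.norm_conj]
  apply le_of_eq
  ring

lemma integral_gauss_monomial (a b : ℕ) :
    ∫ z, conj z ^ a * z ^ b ∂gauss = if a = b then (a.factorial : ℂ) else 0 := by
  rw [integral_gauss]
  split_ifs with h
  · subst h
    have h1 : ∀ z : ℂ, (Real.pi⁻¹ * Real.exp (-‖z‖ ^ 2)) • (conj z ^ a * z ^ a) =
        ((Real.pi⁻¹ * (‖z‖ ^ (2 * a) * Real.exp (-‖z‖ ^ 2)) : ℝ) : ℂ) := by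
      intro z
      rw [← mul_pow, mul_comm (conj z), Complex.mul_conj', Complex.real_smul]
      push_cast
      ring
    simp only [h1]
    rw [integral_complex_ofReal, integral_const_mul, integral_norm_pow_mul_exp,
      ← mul_assoc, inv_mul_cancel₀ Real.pi_ne_zero, one_mul]
    have : (((2 * a : ℕ) : ℝ) + 2) / 2 = a + 1 := by push_cast; ring
    rw [this, Real.Gamma_nat_eq_factorial]
    simp
  · have hd : ((b : ℝ) - a) ≠ 0 := sub_ne_zero.2 fun hab => h (by exact_mod_cast hab.symm)
    set t : ℝ := Real.pi / (b - a)
    set c : Circle := Circle.exp t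
    have hc : conj (c : ℂ) ^ a * (c : ℂ) ^ b = -1 := by
      have : (c : ℂ) = Complex.exp (t * Complex.I) := Circle.coe_exp t
      rw [this, ← Complex.exp_conj, ← Complex.exp_nat_mul, ← Complex.exp_nat_mul,
        ← Complex.exp_add, ← Complex.exp_pi_mul_I]
      congr 1
      have h2 : ((b : ℂ) - a) * t = Real.pi := by
        have : ((b : ℝ) - a) * t = Real.pi := by simp only [t]; field_simp
        exact_mod_cast this
      simp only [map_mul, Complex.conj_ofReal, Complex.conj_I]
      rw [← h2]
      ring
    have hr := (rotation c).measurePreserving.integral_comp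
      (rotation c).toHomeomorph.measurableEmbedding
      (fun z : ℂ => (Real.pi⁻¹ * Real.exp (-‖z‖ ^ 2)) • (conj z ^ a * z ^ b))
    have h3 : ∀ z : ℂ, (Real.pi⁻¹ * Real.exp (-‖rotation c z‖ ^ 2)) •
        (conj (rotation c z) ^ a * (rotation c z) ^ b) =
        -((Real.pi⁻¹ * Real.exp (-‖z‖ ^ 2)) • (conj z ^ a * z ^ b)) := by
      intro z
      rw [LinearIsometryEquiv.norm_map, rotation_apply, map_mul, mul_pow, mul_pow, ← smul_neg]
      congr 1
      calc _ = (conj (c : ℂ) ^ a * (c : ℂ) ^ b) * (conj z ^ a * z ^ b) := by ring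
        _ = _ := by rw [hc]; ring
    simp only [h3, integral_neg] at hr
    exact self_eq_neg.1 hr.symm

instance : IsProbabilityMeasure gauss := by
  have h0 := integral_gauss_monomial 0 0
  have hi := integrable_gauss_monomial 0 0
  simp only [pow_zero, mul_one, if_true, Nat.factorial_zero, Nat.cast_one] at h0 hi
  have hf : IsFiniteMeasure gauss := by
    rcases (integrable_const_iff (μ := gauss) (c := (1 : ℂ))).1 hi with h | h
    · exact absurd h one_ne_zero
    · exact h
  constructor
  rw [integral_const, Complex.real_smul, mul_one] at h0
  have h1 : gauss.real Set.univ = 1 := by exact_mod_cast h0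
  rw [Measure.real] at h1
  rw [← ENNReal.ofReal_toReal (measure_ne_top gauss Set.univ), h1, ENNReal.ofReal_one]

end

/-! ### Creation and annihilation operators on Fock sequences -/

section

variable {m : ℕ} {E : Type*} [NormedAddCommGroup E] [InnerProductSpace ℂ E]

/-- Total degree of a multi-index. -/
def deg (α : Fin m → ℕ) : ℕ := ∑ j, α j

/-- Increase the `j`-th entry by one. -/
def up (j : Fin m) (α : Fin m → ℕ) : Fin m → ℕ := α + Pi.single j 1

/-- Decrease the `j`-th entry by one (truncated). -/
def down (j : Fin m) (α : Fin m → ℕ) : Fin m → ℕ := α - Pi.single j 1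

@[simp] lemma down_up (j : Fin m) (α : Fin m → ℕ) : down j (up j α) = α := by
  simp [down, up]

@[simp] lemma up_same (j : Fin m) (α : Fin m → ℕ) : up j α j = α j + 1 := by simp [up]

lemma up_ne {i j : Fin m} (h : i ≠ j) (α : Fin m → ℕ) : up j α i = α i := by simp [up, h]

lemma up_down {j : Fin m} {α : Fin m → ℕ} (h : α j ≠ 0) : up j (down j α) = α := by
  ext i
  by_cases hi : i = j
  · subst hi; simp [up, down]; omega
  · simp [up, down, hi]

@[simp] lemma deg_up (j : Fin m) (α : Fin m → ℕ) : deg (up j α) = deg α + 1 := by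
  simp [deg, up, Finset.sum_add_distrib]

lemma up_comm (i j : Fin m) (α : Fin m → ℕ) : up i (up j α) = up j (up i α) := by
  simp only [up]; abel

lemma up_injective (j : Fin m) : Function.Injective (up j) :=
  Function.LeftInverse.injective (down_up j)

lemma eq_up_of_ne_zero {j : Fin m} {α : Fin m → ℕ} (h : α j ≠ 0) : ∃ β, α = up j β :=
  ⟨down j α, (up_down h).symm⟩

lemma tsum_eq_tsum_up {X : Type*} [AddCommMonoid X] [TopologicalSpace X]
    (j : Fin m) (F : (Fin m → ℕ) → X) (hF : ∀ α, α j = 0 → F α = 0) :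
    ∑' α, F α = ∑' β, F (up j β) := by
  refine ((up_injective j).tsum_eq fun α hα => ?_).symm
  obtain ⟨β, rfl⟩ := eq_up_of_ne_zero fun h => hα (hF α h)
  exact ⟨β, rfl⟩

/-- The annihilation operator `a_j` on formal sequences of Hermite coefficients. -/
noncomputable def lower (j : Fin m) : ((Fin m → ℕ) → E) →ₗ[ℂ] ((Fin m → ℕ) → E) where
  toFun v α := ((√((α j : ℝ) + 1) : ℝ) : ℂ) • v (up j α)
  map_add' u v := by ext α; simp
  map_smul' c v := by ext α; simp [smul_comm c]

/-- The creation operator `a_j†` on formal sequences of Hermite coefficients. -/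
noncomputable def raise (j : Fin m) : ((Fin m → ℕ) → E) →ₗ[ℂ] ((Fin m → ℕ) → E) where
  toFun v α := ((√(α j : ℝ) : ℝ) : ℂ) • v (down j α)
  map_add' u v := by ext α; simp
  map_smul' c v := by ext α; simp [smul_comm c]

/-- A constant endomorphism acting entrywise. -/
def mat (M : E →L[ℂ] E) : ((Fin m → ℕ) → E) →ₗ[ℂ] ((Fin m → ℕ) → E) where
  toFun v α := M (v α)
  map_add' u v := by ext α; simp
  map_smul' c v := by ext α; simp

/-- Multiplication by a function of the degree. -/
def mulDeg (g : ℕ → ℂ) : ((Fin m → ℕ) → E) →ₗ[ℂ] ((Fin m → ℕ) → E) where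
  toFun v α := g (deg α) • v α
  map_add' u v := by ext α; simp
  map_smul' c v := by ext α; simp [smul_comm c]

lemma lower_apply (j : Fin m) (v : (Fin m → ℕ) → E) (α : Fin m → ℕ) :
    lower j v α = ((√((α j : ℝ) + 1) : ℝ) : ℂ) • v (up j α) := rfl

lemma raise_apply (j : Fin m) (v : (Fin m → ℕ) → E) (α : Fin m → ℕ) :
    raise j v α = ((√(α j : ℝ) : ℝ) : ℂ) • v (down j α) := rfl

lemma raise_zero {j : Fin m} (v : (Fin m → ℕ) → E) {α : Fin m → ℕ} (h : α j = 0) :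
    raise j v α = 0 := by simp [raise_apply, h]

lemma raise_up (j : Fin m) (v : (Fin m → ℕ) → E) (α : Fin m → ℕ) :
    raise j v (up j α) = ((√((α j : ℝ) + 1) : ℝ) : ℂ) • v α := by simp [raise_apply]

lemma mat_apply (M : E →L[ℂ] E) (v : (Fin m → ℕ) → E) (α : Fin m → ℕ) :
    mat M v α = M (v α) := rfl

lemma mulDeg_apply (g : ℕ → ℂ) (v : (Fin m → ℕ) → E) (α : Fin m → ℕ) :
    mulDeg g v α = g (deg α) • v α := rfl

lemma finite_lower {u : (Fin m → ℕ) → E} (hu : u.support.Finite) (j : Fin m) :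
    (lower j u).support.Finite := by
  refine (hu.preimage (f := up j) (up_injective j).injOn).subset fun α hα => ?_
  simp only [Set.mem_preimage, Function.mem_support] at *
  exact fun h => hα (by simp [lower_apply, h])

lemma finite_raise {u : (Fin m → ℕ) → E} (hu : u.support.Finite) (j : Fin m) :
    (raise j u).support.Finite := by
  refine (hu.image (up j)).subset fun α hα => ?_
  have h0 : α j ≠ 0 := fun h => hα (raise_zero u h)
  obtain ⟨β, rfl⟩ := eq_up_of_ne_zero h0
  exact ⟨β, fun h => hα (by simp [raise_up, h]), rfl⟩

lemma finite_mat {u : (Fin m → ℕ) → E} (hu : u.support.Finite) (M : E →L[ℂ] E) :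
    (mat M u).support.Finite :=
  hu.subset fun α hα h => hα (by simp [mat_apply, h])

lemma finite_mulDeg {u : (Fin m → ℕ) → E} (hu : u.support.Finite) (g : ℕ → ℂ) :
    (mulDeg g u).support.Finite :=
  hu.subset fun α hα h => hα (by simp [mulDeg_apply, h])

lemma finite_add {u v : (Fin m → ℕ) → E} (hu : u.support.Finite) (hv : v.support.Finite) :
    (u + v).support.Finite :=
  (hu.union hv).subset (Function.support_add u v)

lemma finite_sum {ι : Type*} (s : Finset ι) {u : ι → (Fin m → ℕ) → E}
    (hu : ∀ i ∈ s, (u i).support.Finite) : (∑ i ∈ s, u i).support.Finite := by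
  classical
  induction s using Finset.induction_on with
  | empty => simp
  | insert i s hi ih =>
    rw [Finset.sum_insert hi]
    exact finite_add (hu i (by simp)) (ih fun k hk => hu k (by simp [hk]))

/-- The `ℓ²` pairing. -/
noncomputable def pair (u v : (Fin m → ℕ) → E) : ℂ := ∑' α, ⟪u α, v α⟫_ℂ

/-- The squared `ℓ²` norm. -/
noncomputable def nsq (u : (Fin m → ℕ) → E) : ℝ := ∑' α, ‖u α‖ ^ 2

lemma pair_lower (j : Fin m) (u v : (Fin m → ℕ) → E) :
    pair (lower j u) v = pair u (raise j v) := by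
  rw [pair, pair, tsum_eq_tsum_up j (fun α => ⟪u α, raise j v α⟫_ℂ)
    (fun α h => by simp [raise_zero v h])]
  refine tsum_congr fun α => ?_
  rw [raise_up, lower_apply, inner_smul_left, inner_smul_right, Complex.conj_ofReal]

lemma pair_symm (u v : (Fin m → ℕ) → E) : conj (pair u v) = pair v u := by
  rw [pair, pair, Complex.conj_tsum]
  simp only [inner_conj_symm]

lemma pair_raise (j : Fin m) (u v : (Fin m → ℕ) → E) :
    pair (raise j u) v = pair u (lower j v) := by
  rw [← pair_symm, ← pair_lower, pair_symm]

lemma pair_mat [CompleteSpace E] (M : E →L[ℂ] E) (u v : (Fin m → ℕ) → E) :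
    pair (mat M u) v = pair u (mat (ContinuousLinearMap.adjoint M) v) := by
  simp only [pair, mat_apply, ContinuousLinearMap.adjoint_inner_right]

lemma pair_self (u : (Fin m → ℕ) → E) : pair u u = nsq u := by
  rw [pair, nsq, Complex.ofReal_tsum]
  refine tsum_congr fun α => ?_
  rw [inner_self_eq_norm_sq_to_K]
  simp

lemma summable_pair {u : (Fin m → ℕ) → E} (hu : u.support.Finite) (v : (Fin m → ℕ) → E) :
    Summable fun α => ⟪u α, v α⟫_ℂ :=
  summable_of_hasFiniteSupport (hu.subset fun α hα h => hα (by simp [h]))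

lemma summable_nsq {u : (Fin m → ℕ) → E} (hu : u.support.Finite) :
    Summable fun α => ‖u α‖ ^ 2 :=
  summable_of_hasFiniteSupport (hu.subset fun α hα h => hα (by simp [h]))

lemma pair_add_right {u : (Fin m → ℕ) → E} (hu : u.support.Finite) (v w : (Fin m → ℕ) → E) :
    pair u (v + w) = pair u v + pair u w := by
  simp only [pair, Pi.add_apply, inner_add_right]
  exact (summable_pair hu v).tsum_add (summable_pair hu w)

lemma pair_add_left {u v : (Fin m → ℕ) → E} (hu : u.support.Finite) (hv : v.support.Finite)
    (w : (Fin m → ℕ) → E) : pair (u + v) w = pair u w + pair v w := by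
  simp only [pair, Pi.add_apply, inner_add_left]
  exact (summable_pair hu w).tsum_add (summable_pair hv w)

lemma pair_sum_right {ι : Type*} (s : Finset ι) {u : (Fin m → ℕ) → E} (hu : u.support.Finite)
    (v : ι → (Fin m → ℕ) → E) : pair u (∑ i ∈ s, v i) = ∑ i ∈ s, pair u (v i) := by
  classical
  induction s using Finset.induction_on with
  | empty => simp [pair]
  | insert i s hi ih => rw [Finset.sum_insert hi, Finset.sum_insert hi, pair_add_right hu, ih]

lemma pair_sum_left {ι : Type*} (s : Finset ι) {u : ι → (Fin m → ℕ) → E}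
    (hu : ∀ i, (u i).support.Finite) (v : (Fin m → ℕ) → E) :
    pair (∑ i ∈ s, u i) v = ∑ i ∈ s, pair (u i) v := by
  classical
  induction s using Finset.induction_on with
  | empty => simp [pair]
  | insert i s hi ih =>
    rw [Finset.sum_insert hi, Finset.sum_insert hi,
      pair_add_left (hu i) (finite_sum _ fun k _ => hu k), ih]

lemma nsq_raise {u : (Fin m → ℕ) → E} (hu : u.support.Finite) (j : Fin m) :
    nsq (raise j u) = nsq (lower j u) + nsq u := by
  have h1 : nsq (raise j u) = ∑' α, ((α j : ℝ) + 1) * ‖u α‖ ^ 2 := by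
    rw [nsq, tsum_eq_tsum_up j _ fun α h => by simp [raise_zero u h]]
    refine tsum_congr fun α => ?_
    rw [raise_up, norm_smul, mul_pow, Complex.norm_real, Real.norm_of_nonneg (Real.sqrt_nonneg _),
      Real.sq_sqrt (by positivity)]
  have h2 : nsq (lower j u) = ∑' α, (α j : ℝ) * ‖u α‖ ^ 2 := by
    rw [tsum_eq_tsum_up j (fun α : Fin m → ℕ => (α j : ℝ) * ‖u α‖ ^ 2)
      fun α h => by simp [h], nsq]
    refine tsum_congr fun α => ?_
    rw [lower_apply, norm_smul, mul_pow, Complex.norm_real,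
      Real.norm_of_nonneg (Real.sqrt_nonneg _), Real.sq_sqrt (by positivity)]
    simp
  rw [h1, h2, nsq, ← Summable.tsum_add _ (summable_nsq hu)]
  · exact tsum_congr fun α => by ring
  · exact summable_of_hasFiniteSupport (hu.subset fun α hα h => hα (by simp [h]))

/-- The standard Gaussian measure on `ℂ^m`. -/
noncomputable def gaussPi (m : ℕ) : Measure (Fin m → ℂ) := Measure.pi fun _ => gauss

/-- The normalised monomials, orthonormal for `gaussPi`. -/
noncomputable def mono (α : Fin m → ℕ) (z : Fin m → ℂ) : ℂ :=
  ∏ j, ((√((α j).factorial : ℝ) : ℝ) : ℂ)⁻¹ * z j ^ α j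

lemma mono_up (j : Fin m) (α : Fin m → ℕ) (z : Fin m → ℂ) :
    ((√((α j : ℝ) + 1) : ℝ) : ℂ) * mono (up j α) z = z j * mono α z := by
  have h1 : ((√((α j : ℝ) + 1) : ℝ) : ℂ) ≠ 0 := by
    rw [Complex.ofReal_ne_zero, Real.sqrt_ne_zero']; positivity
  have h2 : ((√((α j).factorial : ℝ) : ℝ) : ℂ) ≠ 0 := by
    rw [Complex.ofReal_ne_zero, Real.sqrt_ne_zero']; positivity
  have h3 : ∏ i ∈ Finset.univ.erase j,
        ((√((up j α i).factorial : ℝ) : ℝ) : ℂ)⁻¹ * z i ^ up j α i =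
      ∏ i ∈ Finset.univ.erase j, ((√((α i).factorial : ℝ) : ℝ) : ℂ)⁻¹ * z i ^ α i :=
    Finset.prod_congr rfl fun i hi => by rw [up_ne (Finset.ne_of_mem_erase hi)]
  rw [mono, mono, ← Finset.mul_prod_erase _ _ (Finset.mem_univ j),
    ← Finset.mul_prod_erase _ _ (Finset.mem_univ j), h3, up_same, Nat.factorial_succ,
    Nat.cast_mul, Nat.cast_succ, Real.sqrt_mul (by positivity), Complex.ofReal_mul]
  field_simp
  ring

lemma mono_conj_mul (α β : Fin m → ℕ) (z : Fin m → ℂ) :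
    conj (mono α z) * mono β z = ∏ j, (((√((α j).factorial : ℝ) : ℝ) : ℂ)⁻¹ *
      ((√((β j).factorial : ℝ) : ℝ) : ℂ)⁻¹) * (conj (z j) ^ α j * z j ^ β j) := by
  rw [mono, mono, map_prod, ← Finset.prod_mul_distrib]
  refine Finset.prod_congr rfl fun j _ => ?_
  rw [map_mul, map_inv₀, Complex.conj_ofReal, map_pow]
  ring

lemma integrable_conj_mono_mul_mono (α β : Fin m → ℕ) :
    Integrable (fun z => conj (mono α z) * mono β z) (gaussPi m) := by
  simp only [mono_conj_mul]
  exact Integrable.fintype_prod (f := fun j (w : ℂ) =>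
    (((√((α j).factorial : ℝ) : ℝ) : ℂ)⁻¹ * ((√((β j).factorial : ℝ) : ℝ) : ℂ)⁻¹) *
      (conj w ^ α j * w ^ β j)) fun j => (integrable_gauss_monomial _ _).const_mul _

lemma integral_conj_mono_mul_mono (α β : Fin m → ℕ) :
    ∫ z, conj (mono α z) * mono β z ∂gaussPi m = if α = β then 1 else 0 := by
  simp only [mono_conj_mul]
  rw [gaussPi, integral_fintype_prod_eq_prod (fun j (w : ℂ) =>
    (((√((α j).factorial : ℝ) : ℝ) : ℂ)⁻¹ * ((√((β j).factorial : ℝ) : ℝ) : ℂ)⁻¹) *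
      (conj w ^ α j * w ^ β j))]
  simp only [integral_const_mul, integral_gauss_monomial]
  split_ifs with h
  · subst h
    refine Finset.prod_eq_one fun j _ => ?_
    have h2 : ((√((α j).factorial : ℝ) : ℝ) : ℂ) ≠ 0 := by
      rw [Complex.ofReal_ne_zero, Real.sqrt_ne_zero']; positivity
    have h3 : ((√((α j).factorial : ℝ) : ℝ) : ℂ) * ((√((α j).factorial : ℝ) : ℝ) : ℂ) =
        ((α j).factorial : ℂ) := by
      rw [← Complex.ofReal_mul, Real.mul_self_sqrt (by positivity)]; simp
    rw [if_pos rfl, ← h3]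
    field_simp
  · obtain ⟨j, hj⟩ := Function.ne_iff.1 h
    exact Finset.prod_eq_zero (Finset.mem_univ j) (by simp [hj])

/-- The Bargmann transform of a sequence of coefficients. -/
noncomputable def barg (u : (Fin m → ℕ) → E) (z : Fin m → ℂ) : E := ∑' α, mono α z • u α

lemma summable_barg {u : (Fin m → ℕ) → E} (hu : u.support.Finite) (z : Fin m → ℂ) :
    Summable fun α => mono α z • u α :=
  summable_of_hasFiniteSupport (hu.subset fun α hα h => hα (by simp [h]))

lemma barg_add {u v : (Fin m → ℕ) → E} (hu : u.support.Finite) (hv : v.support.Finite)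
    (z : Fin m → ℂ) : barg (u + v) z = barg u z + barg v z := by
  simp only [barg, Pi.add_apply, smul_add]
  exact (summable_barg hu z).tsum_add (summable_barg hv z)

lemma barg_sum {ι : Type*} (s : Finset ι) {u : ι → (Fin m → ℕ) → E}
    (hu : ∀ i, (u i).support.Finite) (z : Fin m → ℂ) :
    barg (∑ i ∈ s, u i) z = ∑ i ∈ s, barg (u i) z := by
  classical
  induction s using Finset.induction_on with
  | empty => simp [barg]
  | insert i s hi ih =>
    rw [Finset.sum_insert hi, Finset.sum_insert hi,
      barg_add (hu i) (finite_sum _ fun k _ => hu k), ih]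

lemma barg_mat {u : (Fin m → ℕ) → E} (hu : u.support.Finite) (M : E →L[ℂ] E)
    (z : Fin m → ℂ) : barg (mat M u) z = M (barg u z) := by
  rw [barg, barg, M.map_tsum (summable_barg hu z)]
  simp [mat_apply]

lemma barg_raise (j : Fin m) {u : (Fin m → ℕ) → E} (hu : u.support.Finite) (z : Fin m → ℂ) :
    barg (raise j u) z = z j • barg u z := by
  rw [barg, barg, tsum_eq_tsum_up j _ fun α h => by simp [raise_zero u h],
    ← (summable_barg hu z).tsum_const_smul]
  refine tsum_congr fun α => ?_
  rw [raise_up, smul_smul, smul_smul, mul_comm, mono_up]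

lemma inner_barg {u v : (Fin m → ℕ) → E} (hu : u.support.Finite) (hv : v.support.Finite)
    (z : Fin m → ℂ) : ⟪barg u z, barg v z⟫_ℂ = ∑ α ∈ hu.toFinset, ∑ β ∈ hv.toFinset,
      (conj (mono α z) * mono β z) * ⟪u α, v β⟫_ℂ := by
  rw [barg, barg, tsum_eq_sum (s := hu.toFinset), tsum_eq_sum (s := hv.toFinset), sum_inner]
  · refine Finset.sum_congr rfl fun α _ => ?_
    rw [inner_sum]
    refine Finset.sum_congr rfl fun β _ => ?_
    rw [inner_smul_left, inner_smul_right, mul_assoc]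
  · intro β hβ
    simp only [Set.Finite.mem_toFinset, Function.mem_support, not_not] at hβ
    simp [hβ]
  · intro β hβ
    simp only [Set.Finite.mem_toFinset, Function.mem_support, not_not] at hβ
    simp [hβ]

lemma integrable_inner_barg {u v : (Fin m → ℕ) → E} (hu : u.support.Finite)
    (hv : v.support.Finite) : Integrable (fun z => ⟪barg u z, barg v z⟫_ℂ) (gaussPi m) := by
  simp only [inner_barg hu hv]
  exact integrable_finsetSum _ fun α _ => integrable_finsetSum _ fun β _ =>
    (integrable_conj_mono_mul_mono α β).mul_const _

lemma integral_inner_barg {u v : (Fin m → ℕ) → E} (hu : u.support.Finite)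
    (hv : v.support.Finite) : ∫ z, ⟪barg u z, barg v z⟫_ℂ ∂gaussPi m = pair u v := by
  classical
  simp only [inner_barg hu hv]
  rw [integral_finsetSum _ fun α _ => integrable_finsetSum _ fun β _ =>
    (integrable_conj_mono_mul_mono α β).mul_const _, pair, tsum_eq_sum (s := hu.toFinset)]
  · refine Finset.sum_congr rfl fun α _ => ?_
    rw [integral_finsetSum _ fun β _ => (integrable_conj_mono_mul_mono α β).mul_const _]
    simp only [integral_mul_const, integral_conj_mono_mul_mono, ite_mul, one_mul, zero_mul]
    rw [Finset.sum_ite_eq]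
    split_ifs with h
    · rfl
    · simp only [Set.Finite.mem_toFinset, Function.mem_support, not_not] at h
      simp [h]
  · intro β hβ
    simp only [Set.Finite.mem_toFinset, Function.mem_support, not_not] at hβ
    simp [hβ]

lemma integrable_norm_sq_barg {u : (Fin m → ℕ) → E} (hu : u.support.Finite) :
    Integrable (fun z => ‖barg u z‖ ^ 2) (gaussPi m) := by
  have := (integrable_inner_barg hu hu).re
  simpa only [← norm_sq_eq_re_inner] using this

lemma integral_norm_sq_barg {u : (Fin m → ℕ) → E} (hu : u.support.Finite) :
    ∫ z, ‖barg u z‖ ^ 2 ∂gaussPi m = nsq u := by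
  have h := integral_inner_barg hu hu
  simp only [pair_self, inner_self_eq_norm_sq_to_K] at h
  have h2 : ∀ z : Fin m → ℂ, ((‖barg u z‖ : ℂ)) ^ 2 = ((‖barg u z‖ ^ 2 : ℝ) : ℂ) := by
    intro z; push_cast; rfl
  simp only [Complex.coe_algebraMap, h2] at h
  rw [integral_complex_ofReal] at h
  exact_mod_cast h

end

/-! ### The first order operator -/

section

variable {m : ℕ} {E : Type*} [NormedAddCommGroup E] [InnerProductSpace ℂ E] [CompleteSpace E]

/-- The first order operator `∑ C_j a_j + C_j† a_j†`. -/
noncomputable def dirac (C : Fin m → E →L[ℂ] E) : ((Fin m → ℕ) → E) →ₗ[ℂ] ((Fin m → ℕ) → E) :=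
  ∑ j, (mat (C j) ∘ₗ lower j + mat (ContinuousLinearMap.adjoint (C j)) ∘ₗ raise j)

lemma dirac_apply (C : Fin m → E →L[ℂ] E) (v : (Fin m → ℕ) → E) :
    dirac C v = ∑ j, (mat (C j) (lower j v) +
      mat (ContinuousLinearMap.adjoint (C j)) (raise j v)) := by
  simp [dirac]

/-- The symbol `∑ \bar z_j C_j + z_j C_j†` is bounded below by a multiple of `|z|`. -/
def Elliptic (C : Fin m → E →L[ℂ] E) (c : ℝ) : Prop :=
  ∀ (z : Fin m → ℂ) (v : E), c * (∑ j, ‖z j‖ ^ 2) * ‖v‖ ^ 2 ≤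
    ‖∑ j, (conj (z j) • C j v + z j • ContinuousLinearMap.adjoint (C j) v)‖ ^ 2

lemma finite_dirac {u : (Fin m → ℕ) → E} (hu : u.support.Finite) (C : Fin m → E →L[ℂ] E) :
    (dirac C u).support.Finite := by
  rw [dirac_apply]
  exact finite_sum _ fun j _ => finite_add (finite_mat (finite_lower hu j) _)
    (finite_mat (finite_raise hu j) _)

lemma barg_dirac (C : Fin m → E →L[ℂ] E) {u : (Fin m → ℕ) → E} (hu : u.support.Finite)
    (z : Fin m → ℂ) : barg (dirac C u) z = ∑ j, (C j (barg (lower j u) z) +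
      z j • ContinuousLinearMap.adjoint (C j) (barg u z)) := by
  rw [dirac_apply, barg_sum _ fun j => finite_add (finite_mat (finite_lower hu j) _)
    (finite_mat (finite_raise hu j) _)]
  refine Finset.sum_congr rfl fun j _ => ?_
  rw [barg_add (finite_mat (finite_lower hu j) _) (finite_mat (finite_raise hu j) _),
    barg_mat (finite_lower hu j), barg_mat (finite_raise hu j), barg_raise j hu, map_smul]

/-- The part of `\bar z_j u` orthogonal to holomorphic functions. -/
lemma norm_sq_defect (j : Fin m) {u : (Fin m → ℕ) → E} (hu : u.support.Finite)
    (z : Fin m → ℂ) : ‖conj (z j) • barg u z - barg (lower j u) z‖ ^ 2 =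
      ‖barg (raise j u) z‖ ^ 2 - 2 * (⟪barg u z, barg (raise j (lower j u)) z⟫_ℂ).re +
        ‖barg (lower j u) z‖ ^ 2 := by
  rw [@norm_sub_sq ℂ, barg_raise j hu, barg_raise j (finite_lower hu j), inner_smul_left,
    inner_smul_right, norm_smul, norm_smul, RCLike.norm_conj, Complex.conj_conj]
  rfl

lemma integrable_norm_sq_defect (j : Fin m) {u : (Fin m → ℕ) → E} (hu : u.support.Finite) :
    Integrable (fun z => ‖conj (z j) • barg u z - barg (lower j u) z‖ ^ 2) (gaussPi m) := by
  simp only [norm_sq_defect j hu]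
  exact ((integrable_norm_sq_barg (finite_raise hu j)).sub
    ((integrable_inner_barg hu (finite_raise (finite_lower hu j) j)).re.const_mul 2)).add
      (integrable_norm_sq_barg (finite_lower hu j))

lemma integral_norm_sq_defect (j : Fin m) {u : (Fin m → ℕ) → E} (hu : u.support.Finite) :
    ∫ z, ‖conj (z j) • barg u z - barg (lower j u) z‖ ^ 2 ∂gaussPi m = nsq u := by
  have h1 := integrable_norm_sq_barg (finite_raise hu j)
  have h2 : Integrable (fun z => 2 * (⟪barg u z, barg (raise j (lower j u)) z⟫_ℂ).re)
      (gaussPi m) :=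
    (integrable_inner_barg hu (finite_raise (finite_lower hu j) j)).re.const_mul 2
  have h3 := integrable_norm_sq_barg (finite_lower hu j)
  have h12 : Integrable (fun z => ‖barg (raise j u) z‖ ^ 2 -
      2 * (⟪barg u z, barg (raise j (lower j u)) z⟫_ℂ).re) (gaussPi m) := h1.sub h2
  have h4 : ∫ z, (⟪barg u z, barg (raise j (lower j u)) z⟫_ℂ).re ∂gaussPi m =
      nsq (lower j u) := by
    have := integral_re (integrable_inner_barg hu (finite_raise (finite_lower hu j) j))
    rw [integral_inner_barg hu (finite_raise (finite_lower hu j) j), ← pair_lower,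
      pair_self] at this
    simpa using this
  simp only [norm_sq_defect j hu]
  rw [integral_add h12 h3, integral_sub h1 h2, integral_norm_sq_barg (finite_raise hu j),
    integral_norm_sq_barg (finite_lower hu j), integral_const_mul, h4, nsq_raise hu j]
  ring

/-- Gårding inequality for finitely supported sequences. -/
lemma garding {C : Fin m → E →L[ℂ] E} {c : ℝ} (hC : Elliptic C c) :
    ∃ K : ℝ, 0 ≤ K ∧ ∀ u : (Fin m → ℕ) → E, u.support.Finite →
      c * ∑ j, nsq (raise j u) ≤ 2 * nsq (dirac C u) + K * nsq u := by
  refine ⟨2 * m * ∑ j, ‖C j‖ ^ 2, by positivity, fun u hu => ?_⟩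
  have key : ∀ z : Fin m → ℂ, c * ∑ j, ‖barg (raise j u) z‖ ^ 2 ≤
      2 * ‖barg (dirac C u) z‖ ^ 2 + 2 * m * ∑ j, ‖C j‖ ^ 2 *
        ‖conj (z j) • barg u z - barg (lower j u) z‖ ^ 2 := by
    intro z
    have h1 := hC z (barg u z)
    have h2 : ∑ j, (conj (z j) • C j (barg u z) +
          z j • ContinuousLinearMap.adjoint (C j) (barg u z)) = barg (dirac C u) z +
        ∑ j, C j (conj (z j) • barg u z - barg (lower j u) z) := by
      rw [barg_dirac C hu, ← Finset.sum_add_distrib]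
      refine Finset.sum_congr rfl fun j _ => ?_
      rw [map_sub, map_smul]
      abel
    rw [h2] at h1
    have h3 : c * ∑ j, ‖barg (raise j u) z‖ ^ 2 = c * (∑ j, ‖z j‖ ^ 2) * ‖barg u z‖ ^ 2 := by
      simp only [barg_raise _ hu, norm_smul, mul_pow]
      rw [← Finset.sum_mul]
      ring
    rw [h3]
    refine h1.trans ?_
    set X := barg (dirac C u) z
    set Y := ∑ j, C j (conj (z j) • barg u z - barg (lower j u) z)
    have h4 : ‖X + Y‖ ^ 2 ≤ 2 * ‖X‖ ^ 2 + 2 * ‖Y‖ ^ 2 := by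
      nlinarith [norm_add_le X Y, norm_nonneg (X + Y), norm_nonneg X, norm_nonneg Y,
        sq_nonneg (‖X‖ - ‖Y‖)]
    have h5 : ‖Y‖ ^ 2 ≤ m * ∑ j, ‖C j‖ ^ 2 *
        ‖conj (z j) • barg u z - barg (lower j u) z‖ ^ 2 := by
      have : ‖Y‖ ≤ ∑ j, ‖C j‖ * ‖conj (z j) • barg u z - barg (lower j u) z‖ :=
        (norm_sum_le _ _).trans (Finset.sum_le_sum fun j _ => (C j).le_opNorm _)
      refine (pow_le_pow_left₀ (norm_nonneg _) this 2).trans ?_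
      refine (sq_sum_le_card_mul_sum_sq).trans_eq ?_
      simp [mul_pow]
    linarith
  have hl : Integrable (fun z => c * ∑ j, ‖barg (raise j u) z‖ ^ 2) (gaussPi m) :=
    (integrable_finsetSum _ fun j _ => integrable_norm_sq_barg (finite_raise hu j)).const_mul c
  have hd : Integrable (fun z => 2 * m * ∑ j, ‖C j‖ ^ 2 *
      ‖conj (z j) • barg u z - barg (lower j u) z‖ ^ 2) (gaussPi m) :=
    (integrable_finsetSum _ fun j _ =>
      (integrable_norm_sq_defect j hu).const_mul (‖C j‖ ^ 2)).const_mul _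
  have hD := (integrable_norm_sq_barg (finite_dirac hu C)).const_mul 2
  have hs : Integrable (fun z => 2 * ‖barg (dirac C u) z‖ ^ 2 + 2 * m * ∑ j, ‖C j‖ ^ 2 *
      ‖conj (z j) • barg u z - barg (lower j u) z‖ ^ 2) (gaussPi m) := hD.add hd
  have := integral_mono hl hs key
  rw [integral_add hD hd, integral_const_mul, integral_const_mul, integral_const_mul,
    integral_finsetSum _ fun j _ => integrable_norm_sq_barg (finite_raise hu j),
    integral_finsetSum _ fun j _ => (integrable_norm_sq_defect j hu).const_mul (‖C j‖ ^ 2),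
    integral_norm_sq_barg (finite_dirac hu C)] at this
  simp only [integral_norm_sq_barg (finite_raise hu _), integral_const_mul,
    integral_norm_sq_defect _ hu] at this
  rw [← Finset.sum_mul, ← mul_assoc] at this
  exact this

end

/-! ### The low degree perturbation -/

section

variable {m : ℕ} {E : Type*} [NormedAddCommGroup E] [InnerProductSpace ℂ E] [CompleteSpace E]

/-- Projection onto degrees at most `L`. -/
noncomputable def cut (L : ℕ) : ((Fin m → ℕ) → E) →ₗ[ℂ] ((Fin m → ℕ) → E) :=
  mulDeg fun k => if k ≤ L then 1 else 0

lemma cut_apply (L : ℕ) (v : (Fin m → ℕ) → E) (α : Fin m → ℕ) :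
    cut L v α = if deg α ≤ L then v α else 0 := by
  rw [cut, mulDeg_apply]; split_ifs <;> simp

/-- The perturbed operator `𝒟 + s Π_L`. -/
noncomputable def pert (C : Fin m → E →L[ℂ] E) (L : ℕ) (s : ℂ) :
    ((Fin m → ℕ) → E) →ₗ[ℂ] ((Fin m → ℕ) → E) := dirac C + s • cut L

lemma pert_apply (C : Fin m → E →L[ℂ] E) (L : ℕ) (s : ℂ) (v : (Fin m → ℕ) → E) :
    pert C L s v = dirac C v + s • cut L v := rfl

lemma finite_smul {u : (Fin m → ℕ) → E} (hu : u.support.Finite) (s : ℂ) :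
    (s • u).support.Finite :=
  hu.subset fun α hα h => hα (by simp [h])

lemma finite_cut {u : (Fin m → ℕ) → E} (hu : u.support.Finite) (L : ℕ) :
    (cut L u).support.Finite := finite_mulDeg hu _

lemma finite_pert {u : (Fin m → ℕ) → E} (hu : u.support.Finite) (C : Fin m → E →L[ℂ] E) (L : ℕ)
    (s : ℂ) : (pert C L s u).support.Finite :=
  finite_add (finite_dirac hu C) (finite_smul (finite_cut hu _) s)

lemma pair_smul_right (s : ℂ) (u v : (Fin m → ℕ) → E) : pair u (s • v) = s * pair u v := by
  simp only [pair, Pi.smul_apply, inner_smul_right, tsum_mul_left]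

lemma pair_smul_left (s : ℂ) (u v : (Fin m → ℕ) → E) : pair (s • u) v = conj s * pair u v := by
  simp only [pair, Pi.smul_apply, inner_smul_left, tsum_mul_left]

lemma lower_mat (M : E →L[ℂ] E) (j : Fin m) (v : (Fin m → ℕ) → E) :
    lower j (mat M v) = mat M (lower j v) := by
  ext α
  simp [lower_apply, mat_apply]

lemma raise_mat (M : E →L[ℂ] E) (j : Fin m) (v : (Fin m → ℕ) → E) :
    raise j (mat M v) = mat M (raise j v) := by
  ext α
  simp [raise_apply, mat_apply]

lemma pair_dirac {u : (Fin m → ℕ) → E} (hu : u.support.Finite) (C : Fin m → E →L[ℂ] E)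
    (v : (Fin m → ℕ) → E) : pair (dirac C u) v = pair u (dirac C v) := by
  have h1 j := finite_mat (finite_lower hu j) (C j)
  have h2 j := finite_mat (finite_raise hu j) (ContinuousLinearMap.adjoint (C j))
  rw [dirac_apply, dirac_apply, pair_sum_left _ (fun j => finite_add (h1 j) (h2 j)),
    pair_sum_right _ hu]
  refine Finset.sum_congr rfl fun j _ => ?_
  rw [pair_add_left (h1 j) (h2 j), pair_add_right hu, pair_mat, pair_mat, pair_lower, pair_raise,
    ContinuousLinearMap.adjoint_adjoint, lower_mat, raise_mat, add_comm]

lemma pair_cut (L : ℕ) (u v : (Fin m → ℕ) → E) : pair (cut L u) v = pair u (cut L v) := by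
  simp only [pair, cut_apply]
  refine tsum_congr fun α => ?_
  split_ifs <;> simp

lemma pair_pert {u : (Fin m → ℕ) → E} (hu : u.support.Finite) (C : Fin m → E →L[ℂ] E) (L : ℕ)
    (s : ℂ) (v : (Fin m → ℕ) → E) : pair (pert C L (conj s) u) v = pair u (pert C L s v) := by
  rw [pert_apply, pert_apply, pair_add_left (finite_dirac hu C)
    (finite_smul (finite_cut hu _) _), pair_add_right hu, pair_dirac hu, pair_smul_left,
    pair_smul_right, pair_cut, Complex.conj_conj]

lemma pair_cut_self (L : ℕ) (u : (Fin m → ℕ) → E) : pair u (cut L u) = nsq (cut L u) := by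
  rw [← pair_self, pair_cut]
  congr 1
  ext α
  simp only [cut_apply]
  split_ifs <;> rfl

lemma im_pair_dirac {u : (Fin m → ℕ) → E} (hu : u.support.Finite) (C : Fin m → E →L[ℂ] E) :
    (pair u (dirac C u)).im = 0 := by
  rw [← Complex.conj_eq_iff_im, pair_symm, pair_dirac hu]

lemma nsq_nonneg (u : (Fin m → ℕ) → E) : 0 ≤ nsq u := tsum_nonneg fun _ => by positivity

lemma norm_pair_le {u w : (Fin m → ℕ) → E} (hu : u.support.Finite) (hw : w.support.Finite)
    {δ : ℝ} (hδ : 0 < δ) : ‖pair u w‖ ≤ δ * nsq u + δ⁻¹ * nsq w := by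
  have h1 : Summable fun α => δ * ‖u α‖ ^ 2 := (summable_nsq hu).mul_left δ
  have h2 : Summable fun α => δ⁻¹ * ‖w α‖ ^ 2 := (summable_nsq hw).mul_left δ⁻¹
  rw [nsq, nsq, ← tsum_mul_left, ← tsum_mul_left, ← h1.tsum_add h2]
  refine tsum_of_norm_bounded (h1.add h2).hasSum fun α => ?_
  refine (norm_inner_le_norm _ _).trans ?_
  have h3 := sq_nonneg (δ * ‖u α‖ - ‖w α‖)
  have h4 : δ * ‖u α‖ ^ 2 + δ⁻¹ * ‖w α‖ ^ 2 - ‖u α‖ * ‖w α‖ =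
      δ⁻¹ * ((δ * ‖u α‖ - ‖w α‖) ^ 2 + δ * (‖u α‖ * ‖w α‖)) := by
    field_simp; ring
  have h5 : 0 ≤ δ⁻¹ * ((δ * ‖u α‖ - ‖w α‖) ^ 2 + δ * (‖u α‖ * ‖w α‖)) := by positivity
  linarith

lemma nsq_add_le {u w : (Fin m → ℕ) → E} (hu : u.support.Finite) (hw : w.support.Finite) :
    nsq (u + w) ≤ 2 * nsq u + 2 * nsq w := by
  have h1 : Summable fun α => 2 * ‖u α‖ ^ 2 := (summable_nsq hu).mul_left 2
  have h2 : Summable fun α => 2 * ‖w α‖ ^ 2 := (summable_nsq hw).mul_left 2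
  rw [nsq, nsq, nsq, ← tsum_mul_left, ← tsum_mul_left, ← h1.tsum_add h2]
  refine (summable_nsq (finite_add hu hw)).tsum_le_tsum (fun α => ?_) (h1.add h2)
  rw [Pi.add_apply]
  nlinarith [norm_add_le (u α) (w α), norm_nonneg (u α + w α), norm_nonneg (u α),
    norm_nonneg (w α), sq_nonneg (‖u α‖ - ‖w α‖)]

lemma sum_nsq_raise {u : (Fin m → ℕ) → E} (hu : u.support.Finite) :
    ∑ j, nsq (raise j u) = ∑' α, ((deg α : ℝ) + m) * ‖u α‖ ^ 2 := by
  have h1 : ∀ j, nsq (raise j u) = ∑' α, ((α j : ℝ) + 1) * ‖u α‖ ^ 2 := by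
    intro j
    rw [nsq, tsum_eq_tsum_up j _ fun α h => by simp [raise_zero u h]]
    refine tsum_congr fun α => ?_
    rw [raise_up, norm_smul, mul_pow, Complex.norm_real, Real.norm_of_nonneg (Real.sqrt_nonneg _),
      Real.sq_sqrt (by positivity)]
  simp only [h1]
  rw [← Summable.tsum_finsetSum]
  · refine tsum_congr fun α => ?_
    rw [← Finset.sum_mul, Finset.sum_add_distrib]
    simp [deg]
  · exact fun j _ => summable_of_hasFiniteSupport (hu.subset fun α hα h => hα (by simp [h]))

lemma nsq_le_cut_add {u : (Fin m → ℕ) → E} (hu : u.support.Finite) (L : ℕ) :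
    (L + 1) * nsq u ≤ (L + 1) * nsq (cut L u) + ∑ j, nsq (raise j u) := by
  have h1 : Summable fun α => ((L : ℝ) + 1) * ‖cut L u α‖ ^ 2 :=
    (summable_nsq (finite_mulDeg hu _)).mul_left _
  have h2 : Summable fun α => ((deg α : ℝ) + m) * ‖u α‖ ^ 2 :=
    summable_of_hasFiniteSupport (hu.subset fun α hα h => hα (by simp [h]))
  rw [sum_nsq_raise hu, nsq, nsq, ← tsum_mul_left, ← tsum_mul_left, ← h1.tsum_add h2]
  refine ((summable_nsq hu).mul_left _).tsum_le_tsum (fun α => ?_) (h1.add h2)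
  rw [cut_apply]
  split_ifs with h
  · have : 0 ≤ ((deg α : ℝ) + m) * ‖u α‖ ^ 2 := by positivity
    linarith
  · have : (L : ℝ) + 1 ≤ deg α := by exact_mod_cast Nat.lt_of_not_le h
    have h3 : (0 : ℝ) ≤ m := by positivity
    simp only [norm_zero]
    nlinarith [sq_nonneg ‖u α‖]

lemma nsq_le_sum_raise {u : (Fin m → ℕ) → E} (hu : u.support.Finite) (hm : 1 ≤ m) :
    nsq u ≤ ∑ j, nsq (raise j u) := by
  rw [sum_nsq_raise hu, nsq]
  refine (summable_nsq hu).tsum_le_tsum (fun α => ?_)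
    (summable_of_hasFiniteSupport (hu.subset fun α hα h => hα (by simp [h])))
  have h3 : (1 : ℝ) ≤ m := by exact_mod_cast hm
  have h4 : (0 : ℝ) ≤ deg α := by positivity
  nlinarith [sq_nonneg ‖u α‖]

/-- A priori estimate for finitely supported sequences. -/
lemma apriori {C : Fin m → E →L[ℂ] E} {c : ℝ} (hc : 0 < c) (hC : Elliptic C c) (hm : 1 ≤ m) :
    ∃ L : ℕ, ∃ B : ℝ, 0 ≤ B ∧ ∀ s : ℂ, (s = Complex.I ∨ s = -Complex.I) →
      ∀ u : (Fin m → ℕ) → E, u.support.Finite →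
        ∑ j, nsq (raise j u) ≤ B * nsq (pert C L s u) := by
  obtain ⟨K, hK, hG⟩ := garding hC
  obtain ⟨L, hL⟩ := exists_nat_ge (4 * K / c)
  rw [div_le_iff₀ hc] at hL
  set δ := c / 4 / (4 + K) with hδdef
  have hδ : 0 < δ := by positivity
  refine ⟨L, (2 / c) * (4 + (4 + K) * δ⁻¹), by positivity, fun s hs u hu => ?_⟩
  have hw := finite_pert hu C L s
  set w := pert C L s u with hwdef
  have hcut := finite_cut hu L
  have hP : nsq (cut L u) ≤ δ * nsq u + δ⁻¹ * nsq w := by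
    refine le_trans ?_ (norm_pair_le hu hw hδ)
    refine le_trans ?_ (Complex.abs_im_le_norm _)
    have : (pair u w).im = s.im * nsq (cut L u) := by
      rw [hwdef, pert_apply, pair_add_right hu, pair_smul_right, pair_cut_self, Complex.add_im,
        im_pair_dirac hu]
      simp
    rw [this]
    rcases hs with rfl | rfl <;> simp [le_abs_self]
  have hD : nsq (dirac C u) ≤ 2 * nsq w + 2 * nsq (cut L u) := by
    have h1 : dirac C u = w + (-s) • cut L u := by
      rw [hwdef, pert_apply]; module
    have h2 : nsq ((-s) • cut L u) = nsq (cut L u) := by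
      have : ‖s‖ = 1 := by rcases hs with rfl | rfl <;> simp
      simp [nsq, norm_smul, this]
    rw [← h2, h1]
    exact nsq_add_le hw (finite_smul hcut _)
  have hg := hG u hu
  have hU := nsq_le_cut_add hu L
  have hU2 := nsq_le_sum_raise hu hm
  have hP0 := nsq_nonneg (cut L u)
  have hw0 := nsq_nonneg w
  have hu0 := nsq_nonneg u
  set T := ∑ j, nsq (raise j u)
  set P := nsq (cut L u)
  set U := nsq u
  set W := nsq w
  have hKU : K * U ≤ K * P + c / 4 * T := by
    have hL1 : (0 : ℝ) < L + 1 := by positivity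
    have h1 : U - P ≤ T / (L + 1) := by
      rw [le_div_iff₀ hL1]; linarith
    have h2 : K * (T / (L + 1)) ≤ c / 4 * T := by
      rw [← mul_div_assoc, div_le_iff₀ hL1]
      have hT : 0 ≤ T := hu0.trans hU2
      nlinarith
    nlinarith
  have h3 : (4 + K) * P ≤ c / 4 * T + (4 + K) * δ⁻¹ * W := by
    have h4 : (4 + K) * δ = c / 4 := by rw [hδdef]; field_simp
    have h5 : (4 + K) * P ≤ (4 + K) * (δ * U + δ⁻¹ * W) := by gcongr
    have h6 : c / 4 * U ≤ c / 4 * T := by gcongr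
    calc (4 + K) * P ≤ (4 + K) * δ * U + (4 + K) * δ⁻¹ * W := by linarith
      _ ≤ _ := by rw [h4]; linarith
  have h7 : c / 2 * T ≤ (4 + (4 + K) * δ⁻¹) * W := by linarith
  calc T = 2 / c * (c / 2 * T) := by field_simp
    _ ≤ 2 / c * ((4 + (4 + K) * δ⁻¹) * W) := by gcongr
    _ = _ := by ring

end

/-! ### Weighted norms -/

section

variable {m : ℕ} {E : Type*} [NormedAddCommGroup E] [InnerProductSpace ℂ E] [CompleteSpace E]

/-- The square of the weighted norm of order `p`. -/
noncomputable def nu (p : ℕ) (v : (Fin m → ℕ) → E) : ℝ≥0∞ :=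
  ∑' α, (1 + deg α : ℝ≥0∞) ^ p * ‖v α‖ₑ ^ 2

lemma nu_mono {p q : ℕ} (h : p ≤ q) (v : (Fin m → ℕ) → E) : nu p v ≤ nu q v :=
  ENNReal.tsum_le_tsum fun α => by gcongr; simp

lemma nu_zero (p : ℕ) : nu p (0 : (Fin m → ℕ) → E) = 0 := by simp [nu]

lemma enorm_add_sq_le (x y : E) : ‖x + y‖ₑ ^ 2 ≤ 2 * ‖x‖ₑ ^ 2 + 2 * ‖y‖ₑ ^ 2 := by
  have h : (‖x + y‖₊ : ℝ≥0) ^ 2 ≤ 2 * ‖x‖₊ ^ 2 + 2 * ‖y‖₊ ^ 2 := by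
    rw [← NNReal.coe_le_coe]
    push_cast
    nlinarith [norm_add_le x y, norm_nonneg (x + y), norm_nonneg x, norm_nonneg y,
      sq_nonneg (‖x‖ - ‖y‖)]
  simp only [enorm_eq_nnnorm]
  exact_mod_cast h

lemma nu_add_le (p : ℕ) (u v : (Fin m → ℕ) → E) : nu p (u + v) ≤ 2 * nu p u + 2 * nu p v := by
  rw [nu, nu, nu, ← ENNReal.tsum_mul_left, ← ENNReal.tsum_mul_left, ← ENNReal.tsum_add]
  refine ENNReal.tsum_le_tsum fun α => ?_
  calc (1 + deg α : ℝ≥0∞) ^ p * ‖(u + v) α‖ₑ ^ 2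
      ≤ (1 + deg α : ℝ≥0∞) ^ p * (2 * ‖u α‖ₑ ^ 2 + 2 * ‖v α‖ₑ ^ 2) := by
        gcongr; exact enorm_add_sq_le _ _
    _ = _ := by ring

lemma nu_smul (p : ℕ) (s : ℂ) (v : (Fin m → ℕ) → E) : nu p (s • v) = ‖s‖ₑ ^ 2 * nu p v := by
  rw [nu, nu, ← ENNReal.tsum_mul_left]
  refine tsum_congr fun α => ?_
  rw [Pi.smul_apply, enorm_smul]
  ring

lemma nu_mat_le (p : ℕ) (M : E →L[ℂ] E) (v : (Fin m → ℕ) → E) :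
    nu p (mat M v) ≤ ‖M‖ₑ ^ 2 * nu p v := by
  rw [nu, nu, ← ENNReal.tsum_mul_left]
  refine ENNReal.tsum_le_tsum fun α => ?_
  calc (1 + deg α : ℝ≥0∞) ^ p * ‖mat M v α‖ₑ ^ 2
      ≤ (1 + deg α : ℝ≥0∞) ^ p * (‖M‖ₑ * ‖v α‖ₑ) ^ 2 := by
        gcongr; exact M.le_opENorm _
    _ = _ := by ring

lemma enorm_sqrt_sq (k : ℕ) : ‖((√((k : ℝ) + 1) : ℝ) : ℂ)‖ₑ ^ 2 = 1 + k := by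
  have h : ‖((√((k : ℝ) + 1) : ℝ) : ℂ)‖₊ ^ 2 = 1 + (k : ℝ≥0) := by
    rw [← NNReal.coe_inj]
    push_cast
    rw [Complex.norm_real, Real.norm_of_nonneg (Real.sqrt_nonneg _),
      Real.sq_sqrt (by positivity), add_comm]
  rw [enorm_eq_nnnorm]
  exact_mod_cast h

lemma nu_raise (p : ℕ) (j : Fin m) (v : (Fin m → ℕ) → E) :
    nu p (raise j v) = ∑' α, (2 + deg α : ℝ≥0∞) ^ p * ((1 + α j) * ‖v α‖ₑ ^ 2) := by
  rw [nu, tsum_eq_tsum_up j _ fun α h => by simp [raise_zero v h]]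
  refine tsum_congr fun α => ?_
  rw [raise_up, enorm_smul, mul_pow, enorm_sqrt_sq, deg_up]
  push_cast
  congr 2
  ring

lemma le_deg (α : Fin m → ℕ) (j : Fin m) : α j ≤ deg α :=
  Finset.single_le_sum (f := α) (fun _ _ => Nat.zero_le _) (Finset.mem_univ j)

lemma nu_raise_le (p : ℕ) (j : Fin m) (v : (Fin m → ℕ) → E) :
    nu p (raise j v) ≤ 2 ^ p * nu (p + 1) v := by
  rw [nu_raise, nu, ← ENNReal.tsum_mul_left]
  refine ENNReal.tsum_le_tsum fun α => ?_
  have h1 : (α j : ℝ≥0∞) ≤ deg α := by exact_mod_cast le_deg α j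
  have h2 : (2 + deg α : ℝ≥0∞) ≤ 2 * (1 + deg α) := by
    rw [mul_add, mul_one, two_mul (deg α : ℝ≥0∞)]
    gcongr
    exact le_self_add
  calc (2 + deg α : ℝ≥0∞) ^ p * ((1 + α j) * ‖v α‖ₑ ^ 2)
      ≤ (2 * (1 + deg α)) ^ p * ((1 + deg α) * ‖v α‖ₑ ^ 2) := by gcongr
    _ = _ := by rw [mul_pow]; ring

lemma nu_lower_le (p : ℕ) (j : Fin m) (v : (Fin m → ℕ) → E) :
    nu p (lower j v) ≤ nu (p + 1) v := by
  have : nu p (lower j v) ≤ ∑' β, (1 + deg (up j β) : ℝ≥0∞) ^ (p + 1) * ‖v (up j β)‖ₑ ^ 2 := by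
    refine ENNReal.tsum_le_tsum fun α => ?_
    rw [lower_apply, enorm_smul, mul_pow, enorm_sqrt_sq, deg_up]
    rw [pow_succ (1 + _ : ℝ≥0∞) p, mul_assoc]
    gcongr
    · exact Nat.le_succ _
    · exact (le_deg α j).trans (Nat.le_succ _)
  exact this.trans (ENNReal.tsum_comp_le_tsum_of_injective (up_injective j)
    (fun α => (1 + deg α : ℝ≥0∞) ^ (p + 1) * ‖v α‖ₑ ^ 2))

lemma nu_mulDeg_le {p q : ℕ} {g : ℕ → ℂ} {c : ℝ≥0∞}
    (h : ∀ k : ℕ, (1 + k : ℝ≥0∞) ^ q * ‖g k‖ₑ ^ 2 ≤ c * (1 + k) ^ p) (v : (Fin m → ℕ) → E) :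
    nu q (mulDeg g v) ≤ c * nu p v := by
  rw [nu, nu, ← ENNReal.tsum_mul_left]
  refine ENNReal.tsum_le_tsum fun α => ?_
  rw [mulDeg_apply, enorm_smul, mul_pow, ← mul_assoc, ← mul_assoc]
  exact mul_le_mul_left (h _) _

lemma nu_succ_le (p : ℕ) (hm : 1 ≤ m) (v : (Fin m → ℕ) → E) :
    nu (p + 1) v ≤ ∑ j, nu p (raise j v) := by
  simp only [nu_raise]
  rw [← Summable.tsum_finsetSum fun _ _ => ENNReal.summable]
  refine ENNReal.tsum_le_tsum fun α => ?_
  rw [← Finset.mul_sum, ← Finset.sum_mul, pow_succ, mul_assoc]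
  have h1 : (1 + deg α : ℝ≥0∞) ≤ ∑ j, (1 + α j : ℝ≥0∞) := by
    have : 1 + deg α ≤ ∑ j, (1 + α j) := by
      rw [Finset.sum_add_distrib]; simp [deg, hm]
    exact_mod_cast this
  gcongr
  exact one_le_two

/-- `f` in weighted norm `q` is dominated by `g` in weighted norm `p`. -/
def Dom {ι : Type*} (q : ℕ) (f : ι → (Fin m → ℕ) → E) (p : ℕ) (g : ι → (Fin m → ℕ) → E) : Prop :=
  ∃ c : ℝ≥0, ∀ i, nu q (f i) ≤ c * nu p (g i)

namespace Dom

variable {ι κ : Type*} {p q r : ℕ} {f f' g h : ι → (Fin m → ℕ) → E}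

lemma refl (p : ℕ) (f : ι → (Fin m → ℕ) → E) : Dom p f p f := ⟨1, fun i => by simp⟩

lemma trans (h1 : Dom r f q g) (h2 : Dom q g p h) : Dom r f p h := by
  obtain ⟨a, ha⟩ := h1
  obtain ⟨b, hb⟩ := h2
  refine ⟨a * b, fun i => (ha i).trans ?_⟩
  rw [ENNReal.coe_mul, mul_assoc]
  gcongr
  exact hb i

lemma comp (h1 : Dom q f p g) (e : κ → ι) : Dom q (fun i => f (e i)) p (fun i => g (e i)) := by
  obtain ⟨a, ha⟩ := h1
  exact ⟨a, fun i => ha _⟩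

lemma add (h1 : Dom q f p g) (h2 : Dom q f' p g) : Dom q (fun i => f i + f' i) p g := by
  obtain ⟨a, ha⟩ := h1
  obtain ⟨b, hb⟩ := h2
  refine ⟨2 * a + 2 * b, fun i => (nu_add_le _ _ _).trans ?_⟩
  push_cast
  rw [add_mul, mul_assoc, mul_assoc]
  gcongr
  · exact ha i
  · exact hb i

lemma zero : Dom q (fun _ : ι => (0 : (Fin m → ℕ) → E)) p g := ⟨0, fun i => by simp [nu_zero]⟩

lemma sum {σ : Type*} (s : Finset σ) {f : σ → ι → (Fin m → ℕ) → E}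
    (h : ∀ k ∈ s, Dom q (f k) p g) : Dom q (fun i => ∑ k ∈ s, f k i) p g := by
  classical
  induction s using Finset.induction_on with
  | empty => simpa using zero
  | insert k s hk ih =>
    simp only [Finset.sum_insert hk]
    exact (h k (by simp)).add (ih fun l hl => h l (by simp [hl]))

lemma smul (s : ℂ) (h1 : Dom q f p g) : Dom q (fun i => s • f i) p g := by
  obtain ⟨a, ha⟩ := h1
  refine ⟨‖s‖₊ ^ 2 * a, fun i => ?_⟩
  rw [nu_smul]
  push_cast
  rw [mul_assoc, enorm_eq_nnnorm]
  gcongr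
  exact ha i

lemma mono_left {q' : ℕ} (hq : q ≤ q') (h1 : Dom q' f p g) : Dom q f p g := by
  obtain ⟨a, ha⟩ := h1
  exact ⟨a, fun i => (nu_mono hq _).trans (ha i)⟩

lemma mono_right {p' : ℕ} (hp : p ≤ p') (h1 : Dom q f p g) : Dom q f p' g := by
  obtain ⟨a, ha⟩ := h1
  exact ⟨a, fun i => (ha i).trans (by gcongr; exact nu_mono hp _)⟩

lemma mat (M : E →L[ℂ] E) (p : ℕ) (f : ι → (Fin m → ℕ) → E) :
    Dom p (fun i => FockIndex.mat M (f i)) p f :=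
  ⟨‖M‖₊ ^ 2, fun i => by simpa [enorm_eq_nnnorm] using nu_mat_le p M (f i)⟩

lemma lower (j : Fin m) (p : ℕ) (f : ι → (Fin m → ℕ) → E) :
    Dom p (fun i => FockIndex.lower j (f i)) (p + 1) f :=
  ⟨1, fun i => by simpa using nu_lower_le p j (f i)⟩

lemma raise (j : Fin m) (p : ℕ) (f : ι → (Fin m → ℕ) → E) :
    Dom p (fun i => FockIndex.raise j (f i)) (p + 1) f :=
  ⟨2 ^ p, fun i => by simpa using nu_raise_le p j (f i)⟩

lemma cut (L : ℕ) (p r : ℕ) (f : ι → (Fin m → ℕ) → E) :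
    Dom (p + r) (fun i => FockIndex.cut L (f i)) p f := by
  refine ⟨(1 + L) ^ r, fun i => nu_mulDeg_le (fun k => ?_) _⟩
  split_ifs with h
  · have : (k : ℝ≥0∞) ≤ L := by exact_mod_cast h
    simp only [enorm_one, one_pow, mul_one, pow_add]
    push_cast
    rw [mul_comm]
    gcongr
  · simp

end Dom

end

/-! ### A priori estimates -/

section

variable {m : ℕ} {E : Type*} [NormedAddCommGroup E] [InnerProductSpace ℂ E] [CompleteSpace E]

lemma nu_zero_eq {u : (Fin m → ℕ) → E} (hu : u.support.Finite) :
    nu 0 u = ENNReal.ofReal (nsq u) := by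
  rw [nu, nsq, ENNReal.ofReal_tsum_of_nonneg (fun _ => by positivity) (summable_nsq hu)]
  refine tsum_congr fun α => ?_
  rw [ENNReal.ofReal_pow (norm_nonneg _), ofReal_norm]
  simp

/-- A priori estimate for the weighted norms. -/
def Apriori (C : Fin m → E →L[ℂ] E) (L : ℕ) (s : ℂ) : Prop :=
  Dom 1 (fun u : {u : (Fin m → ℕ) → E // u.support.Finite} => (u : (Fin m → ℕ) → E)) 0
    (fun u => pert C L s u)

lemma exists_apriori {C : Fin m → E →L[ℂ] E} {c : ℝ} (hc : 0 < c) (hC : Elliptic C c)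
    (hm : 1 ≤ m) :
    ∃ L : ℕ, ∀ s : ℂ, (s = Complex.I ∨ s = -Complex.I) → Apriori C L s := by
  obtain ⟨L, B, hB, h⟩ := apriori hc hC hm
  refine ⟨L, fun s hs => ⟨B.toNNReal, fun ⟨u, hu⟩ => ?_⟩⟩
  refine (nu_succ_le 0 hm u).trans ?_
  simp only [nu_zero_eq (finite_raise hu _), nu_zero_eq (finite_pert hu _ _ _)]
  rw [← ENNReal.ofReal_sum_of_nonneg fun _ _ => nsq_nonneg _, ← ENNReal.ofReal,
    ← ENNReal.ofReal_mul hB]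
  exact ENNReal.ofReal_le_ofReal (h s hs u hu)

lemma finite_deg_le (d : ℕ) : {α : Fin m → ℕ | deg α ≤ d}.Finite :=
  (Set.finite_Iic fun _ => d).subset fun α hα j => (le_deg α j).trans hα

/-- Piecewise linear cutoff in the degree. -/
noncomputable def ramp (d k : ℕ) : ℂ := ((((d - k : ℕ) : ℝ) / d : ℝ) : ℂ)

/-- The size of the increments of `ramp`. -/
noncomputable def step (d k : ℕ) : ℂ := if k ≤ d then (((d : ℝ)⁻¹ : ℝ) : ℂ) else 0

lemma norm_ramp_sub_succ (d k : ℕ) : ‖ramp d k - ramp d (k + 1)‖ ≤ ‖step d k‖ := by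
  rw [ramp, ramp, step, ← Complex.ofReal_sub, Complex.norm_real]
  split_ifs with h
  · rw [Complex.norm_real, ← sub_div, Real.norm_eq_abs, Real.norm_eq_abs, abs_div, ← one_div,
      abs_div, abs_one]
    gcongr
    rcases h.lt_or_eq with h | rfl
    · have : d - k = (d - (k + 1)) + 1 := by omega
      rw [this]; simp
    · simp
  · have h1 : d - k = 0 := by omega
    have h2 : d - (k + 1) = 0 := by omega
    simp [h1, h2]

lemma norm_ramp_sub_pred (d k : ℕ) : ‖ramp d k - ramp d (k - 1)‖ ≤ ‖step d k‖ := by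
  cases k with
  | zero => simp
  | succ k =>
    by_cases h : k + 1 ≤ d
    · have h1 := norm_ramp_sub_succ d k
      rw [norm_sub_rev]
      simpa [step, h, (Nat.le_succ k).trans h] using h1
    · have h1 : d - k = 0 := by omega
      have h2 : d - (k + 1) = 0 := by omega
      simp [ramp, h1, h2]

lemma nu_mulDeg_mono (p : ℕ) {g e : ℕ → ℂ} (h : ∀ k, ‖g k‖ ≤ ‖e k‖) (v : (Fin m → ℕ) → E) :
    nu p (mulDeg g v) ≤ nu p (mulDeg e v) := by
  refine ENNReal.tsum_le_tsum fun α => ?_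
  rw [mulDeg_apply, mulDeg_apply, enorm_smul, enorm_smul]
  have : ‖g (deg α)‖ₑ ≤ ‖e (deg α)‖ₑ := enorm_le_iff_norm_le.2 (h _)
  gcongr

lemma nu_mulDeg_step {d : ℕ} (hd : 1 ≤ d) (v : (Fin m → ℕ) → E) :
    nu 1 (mulDeg (step d) v) ≤ (2 / d) * nu 0 v := by
  refine nu_mulDeg_le (fun k => ?_) v
  rw [step]
  split_ifs with h
  · have h1 : ‖(((d : ℝ)⁻¹ : ℝ) : ℂ)‖ₑ = (d : ℝ≥0∞)⁻¹ := by
      rw [← ofReal_norm, Complex.norm_real, Real.norm_of_nonneg (by positivity),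
        ENNReal.ofReal_inv_of_pos (by positivity), ENNReal.ofReal_natCast]
    have h2 : (1 + k : ℝ≥0∞) ≤ 2 * d := by
      have : 1 + k ≤ 2 * d := by omega
      exact_mod_cast this
    have h3 : (d : ℝ≥0∞) * (d : ℝ≥0∞)⁻¹ = 1 :=
      ENNReal.mul_inv_cancel (by positivity) (ENNReal.natCast_ne_top d)
    rw [h1, pow_one, pow_zero, mul_one]
    calc (1 + k : ℝ≥0∞) * (d : ℝ≥0∞)⁻¹ ^ 2 ≤ 2 * d * (d : ℝ≥0∞)⁻¹ ^ 2 := by gcongr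
      _ = 2 * (d : ℝ≥0∞)⁻¹ * (d * (d : ℝ≥0∞)⁻¹) := by ring
      _ = 2 / d := by rw [h3, mul_one, ENNReal.div_eq_inv_mul, mul_comm]
  · simp

lemma lower_mulDeg (g : ℕ → ℂ) (j : Fin m) (v : (Fin m → ℕ) → E) :
    lower j (mulDeg g v) = mulDeg (fun k => g (k + 1)) (lower j v) := by
  ext α
  rw [lower_apply, mulDeg_apply, mulDeg_apply, lower_apply, deg_up, smul_comm]

lemma mulDeg_sub (g h : ℕ → ℂ) (v : (Fin m → ℕ) → E) :
    mulDeg (fun k => g k - h k) v = mulDeg g v - mulDeg h v := by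
  ext α; simp [mulDeg_apply, sub_smul]

lemma mulDeg_mulDeg_comm (g h : ℕ → ℂ) (v : (Fin m → ℕ) → E) :
    mulDeg g (mulDeg h v) = mulDeg h (mulDeg g v) := by
  ext α; simp only [mulDeg_apply]; rw [smul_comm]

lemma mulDeg_mat (g : ℕ → ℂ) (M : E →L[ℂ] E) (v : (Fin m → ℕ) → E) :
    mulDeg g (mat M v) = mat M (mulDeg g v) := by
  ext α; simp [mulDeg_apply, mat_apply]

lemma pert_mulDeg (C : Fin m → E →L[ℂ] E) (L : ℕ) (s : ℂ) (g : ℕ → ℂ) (v : (Fin m → ℕ) → E) :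
    pert C L s (mulDeg g v) = mulDeg g (pert C L s v) +
      ∑ j, (mat (C j) (lower j (mulDeg (fun k => g k - g (k - 1)) v)) +
        mat (ContinuousLinearMap.adjoint (C j))
          (raise j (mulDeg (fun k => g k - g (k + 1)) v))) := by
  have h1 : ∀ j : Fin m, lower j (mulDeg (fun k => g (k - 1)) v) = mulDeg g (lower j v) := by
    intro j; rw [lower_mulDeg]; simp
  have h2 : ∀ j : Fin m, raise j (mulDeg (fun k => g (k + 1)) v) = mulDeg g (raise j v) := by
    intro j
    ext α
    by_cases h : α j = 0
    · rw [raise_zero _ h, mulDeg_apply, raise_zero _ h, smul_zero]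
    · obtain ⟨β, rfl⟩ := eq_up_of_ne_zero h
      rw [raise_up, mulDeg_apply, mulDeg_apply, raise_up, deg_up, smul_comm]
  simp only [mulDeg_sub, map_sub, h1, h2, pert_apply, dirac_apply, map_add, map_sum, map_smul,
    mulDeg_mat, cut, mulDeg_mulDeg_comm _ g]
  rw [add_right_comm, ← Finset.sum_add_distrib]
  congr 1
  exact Finset.sum_congr rfl fun j _ => by abel

/-- Base regularity: a square summable sequence is controlled by its image. -/
lemma regularity_zero {C : Fin m → E →L[ℂ] E} {L : ℕ} {s : ℂ} (h : Apriori C L s) :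
    Dom 1 (fun v : {v : (Fin m → ℕ) → E // nu 0 v ≠ ⊤} => (v : (Fin m → ℕ) → E)) 0
      (fun v => pert C L s v) := by
  obtain ⟨B, hB⟩ := h
  have hcomm : Dom 0 (fun i : ℕ × ((Fin m → ℕ) → E) =>
      ∑ j, (mat (C j) (lower j (mulDeg (fun k => ramp i.1 k - ramp i.1 (k - 1)) i.2)) +
        mat (ContinuousLinearMap.adjoint (C j))
          (raise j (mulDeg (fun k => ramp i.1 k - ramp i.1 (k + 1)) i.2)))) 1
      (fun i => mulDeg (step i.1) i.2) := by
    refine Dom.sum _ fun j _ => ((Dom.mat _ _ _).trans ((Dom.lower j 0 _).trans ?_)).add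
      ((Dom.mat _ _ _).trans ((Dom.raise j 0 _).trans ?_))
    · exact ⟨1, fun i => by simpa using nu_mulDeg_mono 1 (norm_ramp_sub_pred i.1) i.2⟩
    · exact ⟨1, fun i => by simpa using nu_mulDeg_mono 1 (norm_ramp_sub_succ i.1) i.2⟩
  obtain ⟨A, hA⟩ := hcomm
  refine ⟨4 * B * 2, fun ⟨v, hv⟩ => ?_⟩
  have hramp : ∀ d : ℕ, 1 ≤ d → nu 1 (mulDeg (ramp d) v) ≤
      B * (2 * nu 0 (pert C L s v) + 2 * (A * (2 / d * nu 0 v))) := by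
    intro d hd
    have hfin : (mulDeg (ramp d) v).support.Finite := by
      refine (finite_deg_le d).subset fun α hα => ?_
      by_contra hlt
      have : d - deg α = 0 := Nat.sub_eq_zero_of_le (Nat.le_of_lt (not_le.1 hlt))
      exact hα (by simp [mulDeg_apply, ramp, this])
    refine (hB ⟨_, hfin⟩).trans ?_
    gcongr
    dsimp only
    rw [pert_mulDeg]
    refine (nu_add_le _ _ _).trans ?_
    gcongr
    · have := nu_mulDeg_le (p := 0) (q := 0) (g := ramp d) (c := 1) (fun k => ?_) (pert C L s v)
      · simpa using this
      · have h1 : ‖ramp d k‖ ≤ 1 := by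
          rw [ramp, Complex.norm_real, Real.norm_of_nonneg (by positivity)]
          exact div_le_one_of_le₀ (by exact_mod_cast Nat.sub_le _ _) (by positivity)
        have h2 : ‖ramp d k‖ₑ ≤ 1 := by
          rw [← enorm_one (G := ℂ)]; exact enorm_le_iff_norm_le.2 (by simpa using h1)
        simpa using pow_le_one' h2 2
    · refine (hA (d, v)).trans ?_
      gcongr
      exact nu_mulDeg_step hd v
  have hlim : Tendsto (fun d : ℕ => 4 * (B * (2 * nu 0 (pert C L s v) +
      2 * (A * (2 / d * nu 0 v))))) atTop (𝓝 (4 * (B * (2 * nu 0 (pert C L s v) +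
      2 * (A * (0 * nu 0 v)))))) := by
    have h0 : Tendsto (fun d : ℕ => (2 : ℝ≥0∞) / d) atTop (𝓝 0) := by
      have := ENNReal.Tendsto.const_mul (a := 2) ENNReal.tendsto_inv_nat_nhds_zero
        (Or.inr ENNReal.ofNat_ne_top)
      rw [mul_zero] at this
      exact this
    have h1 := ENNReal.Tendsto.mul_const (b := nu 0 v) h0 (Or.inr hv)
    have h2 := ENNReal.Tendsto.const_mul (a := (A : ℝ≥0∞)) h1 (Or.inr ENNReal.coe_ne_top)
    have h3 := ENNReal.Tendsto.const_mul (a := 2) h2 (Or.inr ENNReal.ofNat_ne_top)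
    have h4 := h3.const_add (2 * nu 0 (pert C L s v))
    have h5 := ENNReal.Tendsto.const_mul (a := (B : ℝ≥0∞)) h4 (Or.inr ENNReal.coe_ne_top)
    exact ENNReal.Tendsto.const_mul (a := 4) h5 (Or.inr ENNReal.ofNat_ne_top)
  rw [zero_mul, mul_zero, mul_zero, add_zero] at hlim
  rw [show nu 1 v = _ from ENNReal.tsum_eq_iSup_sum]
  refine iSup_le fun S => ?_
  have hgoal : ((4 * B * 2 : ℝ≥0) : ℝ≥0∞) * nu 0 (pert C L s v) =
      4 * (B * (2 * nu 0 (pert C L s v))) := by push_cast; ring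
  rw [hgoal]
  refine ge_of_tendsto hlim ?_
  filter_upwards [eventually_ge_atTop (2 * ∑ α ∈ S, deg α + 1)] with d hd
  refine le_trans ?_ (mul_le_mul_right (hramp d (by omega)) 4)
  refine le_trans ?_ (mul_le_mul_right (ENNReal.sum_le_tsum S) 4)
  rw [Finset.mul_sum]
  refine Finset.sum_le_sum fun α hα => ?_
  have h1 : deg α ≤ ∑ α ∈ S, deg α :=
    Finset.single_le_sum (f := fun α : Fin m → ℕ => deg α) (fun _ _ => Nat.zero_le _) hα
  have h2 : (1 : ℝ) ≤ 2 * ‖ramp d (deg α)‖ := by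
    have hd0 : (0 : ℝ) < d := by exact_mod_cast (by omega : 0 < d)
    rw [ramp, Complex.norm_real, Real.norm_of_nonneg (by positivity), ← mul_div_assoc,
      le_div_iff₀ hd0, one_mul]
    exact_mod_cast (by omega : d ≤ 2 * (d - deg α))
  have h3 : ‖v α‖ₑ ≤ 2 * ‖mulDeg (ramp d) v α‖ₑ := by
    rw [mulDeg_apply, enorm_smul, ← mul_assoc]
    have : (1 : ℝ≥0∞) ≤ 2 * ‖ramp d (deg α)‖ₑ := by
      rw [← ENNReal.ofReal_one, ← ofReal_norm]
      refine (ENNReal.ofReal_le_ofReal h2).trans_eq ?_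
      rw [ENNReal.ofReal_mul (by norm_num), ENNReal.ofReal_ofNat]
    calc ‖v α‖ₑ = 1 * ‖v α‖ₑ := (one_mul _).symm
      _ ≤ _ := by gcongr
  calc (1 + deg α : ℝ≥0∞) ^ 1 * ‖v α‖ₑ ^ 2
      ≤ (1 + deg α : ℝ≥0∞) ^ 1 * (2 * ‖mulDeg (ramp d) v α‖ₑ) ^ 2 := by gcongr
    _ = _ := by ring

lemma down_ne {i j : Fin m} (h : i ≠ j) (α : Fin m → ℕ) : down j α i = α i := by
  simp [down, h]

lemma down_up_comm {i j : Fin m} (h : i ≠ j) (α : Fin m → ℕ) :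
    down j (up i α) = up i (down j α) := by
  ext k
  by_cases hj : k = j
  · subst hj; simp [down, up, h.symm]
  · simp [down, up, hj]

lemma raise_raise (i j : Fin m) (v : (Fin m → ℕ) → E) :
    raise i (raise j v) = raise j (raise i v) := by
  ext α
  by_cases h : i = j
  · subst h; rfl
  · have : down j (down i α) = down i (down j α) := by
      ext k; simp only [down, Pi.sub_apply]; omega
    rw [raise_apply, raise_apply, raise_apply, raise_apply, down_ne h, down_ne (Ne.symm h), this,
      smul_comm]

lemma lower_raise (i j : Fin m) (v : (Fin m → ℕ) → E) :
    lower i (raise j v) = raise j (lower i v) + if i = j then v else 0 := by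
  ext α
  by_cases h : i = j
  · subst h
    have hs : ∀ k : ℕ, ((√((k : ℝ) + 1) : ℝ) : ℂ) * ((√((k : ℝ) + 1) : ℝ) : ℂ) = k + 1 := by
      intro k
      rw [← Complex.ofReal_mul, Real.mul_self_sqrt (by positivity)]
      simp
    rw [if_pos rfl, lower_apply, raise_up, Pi.add_apply, smul_smul, hs]
    by_cases h0 : α i = 0
    · rw [raise_zero _ h0, h0]; simp
    · obtain ⟨β, rfl⟩ := eq_up_of_ne_zero h0
      rw [raise_up, lower_apply, smul_smul, hs, up_same]
      push_cast
      rw [add_smul _ (1 : ℂ), one_smul]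
  · rw [if_neg h, add_zero, lower_apply, raise_apply, raise_apply, lower_apply,
      up_ne (Ne.symm h), down_ne h, down_up_comm h, smul_comm]

lemma pert_raise (C : Fin m → E →L[ℂ] E) (L : ℕ) (s : ℂ) (j : Fin m) (v : (Fin m → ℕ) → E) :
    pert C L s (raise j v) = raise j (pert C L s v) + (mat (C j) v +
      (s • cut L (raise j v) + (-s) • raise j (cut L v))) := by
  have h : dirac C (raise j v) = raise j (dirac C v) + mat (C j) v := by
    have h3 : mat (C j) v = ∑ i, mat (C i) (if i = j then v else 0) := by
      rw [Finset.sum_eq_single j (fun i _ hi => by rw [if_neg hi, map_zero]) (by simp), if_pos rfl]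
    rw [h3, dirac_apply, dirac_apply, map_sum, ← Finset.sum_add_distrib]
    refine Finset.sum_congr rfl fun i _ => ?_
    rw [lower_raise, raise_raise i j, map_add, map_add, raise_mat, raise_mat]
    abel
  rw [pert_apply, pert_apply, h, map_add, map_smul]
  module

lemma regularity_raise {C : Fin m → E →L[ℂ] E} {L : ℕ} {s : ℂ} {p : ℕ}
    (ih : Dom (p + 1) (fun v : {v : (Fin m → ℕ) → E // nu 0 v ≠ ⊤} => (v : (Fin m → ℕ) → E)) p
      (fun v => pert C L s v)) (j : Fin m) :
    Dom (p + 1) (fun v : {v : (Fin m → ℕ) → E // nu 1 v ≠ ⊤} =>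
        raise j (v : (Fin m → ℕ) → E)) (p + 1) (fun v => pert C L s v) := by
  have e1 (v : {v : (Fin m → ℕ) → E // nu 1 v ≠ ⊤}) : nu 0 (raise j v.1) ≠ ⊤ :=
    ne_top_of_le_ne_top v.2 (by simpa using nu_raise_le 0 j v.1)
  have e2 (v : {v : (Fin m → ℕ) → E // nu 1 v ≠ ⊤}) : nu 0 v.1 ≠ ⊤ :=
    ne_top_of_le_ne_top v.2 (nu_mono zero_le_one _)
  have h1 := ih.comp fun v => ⟨_, e1 v⟩
  have h2 := (ih.comp fun v => ⟨_, e2 v⟩).mono_right (Nat.le_succ p)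
  refine h1.trans ?_
  simp only [pert_raise]
  have h3 := ((Dom.mat (C j) (p + 1) _).trans h2).mono_left (Nat.le_succ p)
  have h4 := ((Dom.cut L p 0 _).trans (Dom.raise j p _)).trans h2
  have h5 := (Dom.raise j p _).trans ((Dom.cut L (p + 1) 0 _).trans h2)
  exact (Dom.raise j p _).add (h3.add ((h4.smul s).add (h5.smul (-s))))

lemma regularity_succ {C : Fin m → E →L[ℂ] E} {L : ℕ} {s : ℂ} {p : ℕ} (hm : 1 ≤ m)
    (ih : Dom (p + 1) (fun v : {v : (Fin m → ℕ) → E // nu 0 v ≠ ⊤} => (v : (Fin m → ℕ) → E)) p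
      (fun v => pert C L s v)) :
    Dom (p + 2) (fun v : {v : (Fin m → ℕ) → E // nu 0 v ≠ ⊤} => (v : (Fin m → ℕ) → E)) (p + 1)
      (fun v => pert C L s v) := by
  have hS : Dom (p + 2) (fun v : {v : (Fin m → ℕ) → E // nu 1 v ≠ ⊤} =>
      (v : (Fin m → ℕ) → E)) (p + 1) (fun v => pert C L s v) := by
    choose c hc using regularity_raise ih
    refine ⟨∑ j, c j, fun v => (nu_succ_le (p + 1) hm _).trans ?_⟩
    push_cast
    rw [Finset.sum_mul]
    exact Finset.sum_le_sum fun j _ => hc j v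
  obtain ⟨A, hA⟩ := hS
  obtain ⟨B, hB⟩ := ih
  refine ⟨A + 1, fun v => ?_⟩
  by_cases ht : nu (p + 1) (pert C L s v.1) = ⊤
  · rw [ht, ENNReal.mul_top (by simp)]
    exact le_top
  · have h1 : nu 1 v.1 ≠ ⊤ := by
      refine ne_top_of_le_ne_top (ENNReal.mul_ne_top (ENNReal.coe_ne_top (r := B)) ht)
        ((nu_mono (Nat.le_add_left 1 p) _).trans ((hB v).trans ?_))
      gcongr
      exact nu_mono (Nat.le_succ p) _
    refine (hA ⟨v, h1⟩).trans ?_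
    gcongr
    exact le_self_add

/-- Regularity of every order. -/
lemma regularity {C : Fin m → E →L[ℂ] E} {L : ℕ} {s : ℂ} (h : Apriori C L s) (hm : 1 ≤ m)
    (p : ℕ) :
    Dom (p + 1) (fun v : {v : (Fin m → ℕ) → E // nu 0 v ≠ ⊤} => (v : (Fin m → ℕ) → E)) p
      (fun v => pert C L s v) := by
  induction p with
  | zero => exact regularity_zero h
  | succ p ih => exact regularity_succ hm ih

end

/-! ### Rapidly decreasing sequences and the inverse -/

section

variable {m : ℕ} {E : Type*} [NormedAddCommGroup E] [InnerProductSpace ℂ E] [CompleteSpace E]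

/-- A linear functional bounded by the norm of an operator factors through that operator. -/
lemma exists_dual_comp_eq {D F : Type*} [AddCommGroup D] [Module ℂ D] [NormedAddCommGroup F]
    [NormedSpace ℂ F] (T : D →ₗ[ℂ] F) (φ : D →ₗ[ℂ] ℂ) (B : ℝ) (h : ∀ u, ‖φ u‖ ≤ B * ‖T u‖) :
    ∃ ψ : F →L[ℂ] ℂ, ∀ u, ψ (T u) = φ u := by
  obtain ⟨g, hg⟩ := T.rangeRestrict.exists_rightInverse_of_surjective T.range_rangeRestrict
  have hTg : ∀ y, T (g y) = y := fun y => congrArg Subtype.val (LinearMap.congr_fun hg y)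
  let ψ₀ : LinearMap.range T →L[ℂ] ℂ := (φ ∘ₗ g).mkContinuous B fun y => by
    have := h (g y)
    rwa [hTg] at this
  obtain ⟨ψ, hψ, -⟩ := exists_extension_norm_eq (LinearMap.range T) ψ₀
  refine ⟨ψ, fun u => ?_⟩
  have h1 := hψ ⟨T u, u, rfl⟩
  have h2 := h (g ⟨T u, u, rfl⟩ - u)
  rw [map_sub T, hTg, sub_self, norm_zero, mul_zero, map_sub, norm_le_zero_iff, sub_eq_zero] at h2
  exact h1.trans h2

lemma summable_of_nu_ne_top {v : (Fin m → ℕ) → E} (hv : nu 0 v ≠ ⊤) :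
    Summable fun α => ‖v α‖ ^ 2 := by
  have h := ENNReal.summable_toReal hv
  simpa using h

lemma memlp_of_nu_ne_top {v : (Fin m → ℕ) → E} (hv : nu 0 v ≠ ⊤) : Memℓp v 2 := by
  refine memℓp_gen ?_
  simpa using summable_of_nu_ne_top hv

lemma nu_ne_top_of_summable {v : (Fin m → ℕ) → E} (hv : Summable fun α => ‖v α‖ ^ 2) :
    nu 0 v ≠ ⊤ := by
  have h : nu 0 v = ENNReal.ofReal (∑' α, ‖v α‖ ^ 2) := by
    rw [nu, ENNReal.ofReal_tsum_of_nonneg (fun _ => by positivity) hv]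
    refine tsum_congr fun α => ?_
    rw [ENNReal.ofReal_pow (norm_nonneg _), ofReal_norm]
    simp
  rw [h]
  exact ENNReal.ofReal_ne_top

lemma lp_norm_sq (f : lp (fun _ : Fin m → ℕ => E) 2) : ‖f‖ ^ 2 = nsq (f : (Fin m → ℕ) → E) := by
  have := lp.norm_rpow_eq_tsum (p := 2) (by norm_num) f
  simpa [nsq] using this

variable (m E) in
/-- The finitely supported sequences. -/
def finSupp : Submodule ℂ ((Fin m → ℕ) → E) where
  carrier := {u | u.support.Finite}
  add_mem' hu hv := finite_add hu hv
  zero_mem' := by simp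
  smul_mem' s _ hu := finite_smul hu s

lemma nu_single (α : Fin m → ℕ) (e : E) (p : ℕ) :
    nu p (Pi.single α e) = (1 + deg α : ℝ≥0∞) ^ p * ‖e‖ₑ ^ 2 := by
  rw [nu, tsum_eq_single α fun β hβ => by simp [hβ]]
  simp

lemma finite_single (α : Fin m → ℕ) (e : E) :
    (Pi.single α e : (Fin m → ℕ) → E).support.Finite :=
  (Set.finite_singleton α).subset fun β hβ => by
    by_contra h
    exact hβ (by simp [Set.mem_singleton_iff.not.1 h])

/-- Surjectivity on square summable sequences. -/
lemma exists_preimage {C : Fin m → E →L[ℂ] E} {L : ℕ} {s : ℂ} (h : Apriori C L (conj s))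
    {w : (Fin m → ℕ) → E} (hw : nu 0 w ≠ ⊤) : ∃ v, nu 0 v ≠ ⊤ ∧ pert C L s v = w := by
  obtain ⟨B, hB⟩ := h
  have hmem : ∀ u : (Fin m → ℕ) → E, u.support.Finite → Memℓp u 2 := fun u hu =>
    memlp_of_nu_ne_top (by rw [nu_zero_eq hu]; exact ENNReal.ofReal_ne_top)
  let T : finSupp m E →ₗ[ℂ] lp (fun _ : Fin m → ℕ => E) 2 :=
    { toFun := fun u => ⟨pert C L (conj s) u.1, hmem _ (finite_pert u.2 _ _ _)⟩
      map_add' := fun u v => by ext1; exact map_add _ _ _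
      map_smul' := fun c v => by ext1; exact map_smul _ _ _ }
  let ι : finSupp m E →ₗ[ℂ] lp (fun _ : Fin m → ℕ => E) 2 :=
    { toFun := fun u => ⟨u.1, hmem _ u.2⟩
      map_add' := fun u v => rfl
      map_smul' := fun c v => rfl }
  let w' : lp (fun _ : Fin m → ℕ => E) 2 := ⟨w, memlp_of_nu_ne_top hw⟩
  obtain ⟨ψ, hψ⟩ := exists_dual_comp_eq T ((innerSL ℂ w').toLinearMap ∘ₗ ι) (‖w'‖ * √B) (by
    intro u
    refine (norm_inner_le_norm w' (ι u)).trans ?_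
    rw [mul_assoc]
    refine mul_le_mul_of_nonneg_left ?_ (norm_nonneg _)
    refine (sq_le_sq₀ (norm_nonneg _) (by positivity)).1 ?_
    rw [mul_pow, Real.sq_sqrt B.coe_nonneg, lp_norm_sq, lp_norm_sq]
    have h1 := (nu_mono zero_le_one _).trans (hB ⟨u.1, u.2⟩)
    have h2 : nu 0 (u : (Fin m → ℕ) → E) = ENNReal.ofReal (nsq u.1) := nu_zero_eq u.2
    dsimp only at h1
    rw [h2, nu_zero_eq (finite_pert u.2 _ _ _), ← ENNReal.ofReal_coe_nnreal,
      ← ENNReal.ofReal_mul B.coe_nonneg] at h1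
    exact (ENNReal.ofReal_le_ofReal_iff (mul_nonneg B.coe_nonneg (nsq_nonneg _))).1 h1)
  let v := (InnerProductSpace.toDual ℂ _).symm ψ
  refine ⟨v, nu_ne_top_of_summable ?_, ?_⟩
  · have := (lp.memℓp v).summable (by norm_num)
    simpa using this
  · have h1 : ∀ u : (Fin m → ℕ) → E, u.support.Finite → pair u (pert C L s v) = pair u w := by
      intro u hu
      have h2 := hψ ⟨u, hu⟩
      rw [← InnerProductSpace.toDual_symm_apply, lp.inner_eq_tsum] at h2
      change _ = ⟪w', ι ⟨u, hu⟩⟫_ℂ at h2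
      rw [lp.inner_eq_tsum] at h2
      rw [← pair_pert hu, ← pair_symm, ← pair_symm w u]
      exact congrArg conj h2
    ext1 α
    refine ext_inner_left ℂ fun e => ?_
    have h3 : ∀ x : (Fin m → ℕ) → E, pair (Pi.single α e) x = ⟪e, x α⟫_ℂ := by
      intro x
      rw [pair, tsum_eq_single α fun β hβ => by simp [hβ]]
      simp
    rw [← h3, ← h3]
    exact h1 _ (finite_single α e)

variable (m E) in
/-- Rapidly decreasing sequences. -/
def Sch : Submodule ℂ ((Fin m → ℕ) → E) where
  carrier := {v | ∀ p, nu p v ≠ ⊤}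
  add_mem' hu hv p := ne_top_of_le_ne_top
    (ENNReal.add_ne_top.2 ⟨ENNReal.mul_ne_top ENNReal.ofNat_ne_top (hu p),
      ENNReal.mul_ne_top ENNReal.ofNat_ne_top (hv p)⟩) (nu_add_le p _ _)
  zero_mem' p := by simp [nu_zero]
  smul_mem' s v hv p := by
    rw [nu_smul]
    exact ENNReal.mul_ne_top (by simp) (hv p)

variable (m E) in
/-- The algebra of operators on rapidly decreasing sequences. -/
def Op : Type _ := Module.End ℂ (Sch m E)

noncomputable instance : Ring (Op m E) := inferInstanceAs (Ring (Module.End ℂ (Sch m E)))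

noncomputable instance : Algebra ℂ (Op m E) :=
  inferInstanceAs (Algebra ℂ (Module.End ℂ (Sch m E)))

instance : FunLike (Op m E) (Sch m E) (Sch m E) :=
  inferInstanceAs (FunLike (Sch m E →ₗ[ℂ] Sch m E) (Sch m E) (Sch m E))

instance : LinearMapClass (Op m E) ℂ (Sch m E) (Sch m E) :=
  inferInstanceAs (LinearMapClass (Sch m E →ₗ[ℂ] Sch m E) ℂ (Sch m E) (Sch m E))

lemma op_ext {A B : Op m E} (h : ∀ v α, (A v : (Fin m → ℕ) → E) α = (B v : (Fin m → ℕ) → E) α) :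
    A = B := LinearMap.ext fun v => Subtype.ext (funext (h v))

/-- `W` gains `j` orders in the weighted norms. -/
def Ord (j : ℕ) (W : Op m E) : Prop :=
  ∀ p, Dom (p + j) (fun v => (W v : (Fin m → ℕ) → E)) p (fun v : Sch m E => v.1)

lemma mem_sch_of_dom {f : ((Fin m → ℕ) → E) →ₗ[ℂ] ((Fin m → ℕ) → E)}
    (h : ∀ p, ∃ q, Dom p f q id) (v : (Fin m → ℕ) → E) (hv : v ∈ Sch m E) : f v ∈ Sch m E := by
  intro p
  obtain ⟨q, c, hc⟩ := h p
  exact ne_top_of_le_ne_top (ENNReal.mul_ne_top ENNReal.coe_ne_top (hv q)) (hc v)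

/-- Restriction of an operator of finite order. -/
def onSch (f : ((Fin m → ℕ) → E) →ₗ[ℂ] ((Fin m → ℕ) → E)) (h : ∀ p, ∃ q, Dom p f q id) :
    Op m E := f.restrict (mem_sch_of_dom h)

/-- `a_j` on rapidly decreasing sequences. -/
noncomputable def lo (j : Fin m) : Op m E :=
  onSch (lower j) fun p => ⟨p + 1, Dom.lower j p id⟩

/-- `a_j†` on rapidly decreasing sequences. -/
noncomputable def ra (j : Fin m) : Op m E :=
  onSch (raise j) fun p => ⟨p + 1, Dom.raise j p id⟩

/-- Constant matrices on rapidly decreasing sequences. -/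
noncomputable def ma (M : E →L[ℂ] E) : Op m E :=
  onSch (mat M) fun p => ⟨p, Dom.mat M p id⟩

/-- The projection onto degree at most `L` on rapidly decreasing sequences. -/
noncomputable def cu (L : ℕ) : Op m E :=
  onSch (cut L) fun p => ⟨p, Dom.cut L p 0 id⟩

/-- The first order operator on rapidly decreasing sequences. -/
noncomputable def dir (C : Fin m → E →L[ℂ] E) : Op m E :=
  ∑ j, (ma (C j) * lo j + ma (ContinuousLinearMap.adjoint (C j)) * ra j)

lemma dir_coe (C : Fin m → E →L[ℂ] E) (v : Sch m E) :
    (dir C v : (Fin m → ℕ) → E) = dirac C v := by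
  rw [dirac_apply]
  exact (congrArg Subtype.val (LinearMap.sum_apply _ _ v)).trans (Submodule.coe_sum _ _ _)

lemma pert_coe (C : Fin m → E →L[ℂ] E) (L : ℕ) (s : ℂ) (v : Sch m E) :
    (((dir C + s • cu L : Op m E) v : Sch m E) : (Fin m → ℕ) → E) =
      pert C L s v := by
  change (dir C v : (Fin m → ℕ) → E) + s • cut L v.1 = _
  rw [dir_coe]
  rfl

/-- The perturbed operator is invertible on rapidly decreasing sequences, with inverse gaining
one order. -/
lemma exists_inverse {C : Fin m → E →L[ℂ] E} {L : ℕ} {s : ℂ} (hm : 1 ≤ m) (h : Apriori C L s)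
    (h' : Apriori C L (conj s)) : ∃ Q : Op m E, Ord 1 Q ∧
      (dir C + s • cu L) * Q = 1 ∧ Q * (dir C + s • cu L) = 1 := by
  set G : Op m E := dir C + s • cu L with hG
  have hinj : ∀ v : Sch m E, G v = 0 → v = 0 := by
    intro v hv
    obtain ⟨B, hB⟩ := regularity h hm 0
    have h1 := hB ⟨v.1, v.2 0⟩
    have h2 : pert C L s v.1 = 0 := by rw [← pert_coe, ← hG, hv]; rfl
    dsimp only at h1
    rw [h2, nu_zero, mul_zero, nonpos_iff_eq_zero] at h1
    ext α
    have h3 := ENNReal.tsum_eq_zero.1 h1 α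
    simpa using h3
  have hsurj : ∀ w : Sch m E, ∃ v : Sch m E, G v = w := by
    intro w
    obtain ⟨v, hv, hvw⟩ := exists_preimage h' (w.2 0)
    refine ⟨⟨v, fun p => ?_⟩, Subtype.ext ((pert_coe _ _ _ _).trans hvw)⟩
    obtain ⟨B, hB⟩ := regularity h hm p
    refine ne_top_of_le_ne_top ?_ ((nu_mono (Nat.le_succ p) _).trans (hB ⟨v, hv⟩))
    dsimp only
    rw [hvw]
    exact ENNReal.mul_ne_top ENNReal.coe_ne_top (w.2 p)
  let e : Sch m E ≃ₗ[ℂ] Sch m E := LinearEquiv.ofBijective (G : Module.End ℂ (Sch m E))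
    ⟨(injective_iff_map_eq_zero G).2 hinj, hsurj⟩
  have hr : ∀ v, G (e.symm v) = v := fun v => e.apply_symm_apply v
  refine ⟨e.symm.toLinearMap, fun p => ?_, LinearMap.ext hr,
    LinearMap.ext fun v => e.symm_apply_apply v⟩
  have h1 := (regularity h hm p).comp fun v : Sch m E => ⟨(e.symm v).1, (e.symm v).2 0⟩
  obtain ⟨B, hB⟩ := h1
  refine ⟨B, fun v => ?_⟩
  have h2 := hB v
  dsimp only at h2
  rw [← pert_coe, ← hG, hr] at h2
  exact h2

end

/-! ### Words in the operators -/

section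

variable {m : ℕ} {E : Type*} [NormedAddCommGroup E] [InnerProductSpace ℂ E] [CompleteSpace E]

/-- The annihilation and creation operators. -/
noncomputable def gen : Fin m ⊕ Fin m → Op m E := Sum.elim lo ra

lemma gen_mul_ma (x : Fin m ⊕ Fin m) (M : E →L[ℂ] E) : gen x * ma M = ma M * gen x := by
  refine LinearMap.ext fun v => Subtype.ext ?_
  cases x
  · exact lower_mat M _ v.1
  · exact raise_mat M _ v.1

lemma cu_mul_cu {L L' : ℕ} (h : L ≤ L') : (cu L' * cu L : Op m E) = cu L := by
  refine op_ext fun v α => ?_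
  change cut L' (cut L v.1) α = cut L v.1 α
  rw [cut_apply, cut_apply]
  split_ifs <;> first | rfl | omega

lemma cu_mul_cu' {L L' : ℕ} (h : L ≤ L') : (cu L * cu L' : Op m E) = cu L := by
  refine op_ext fun v α => ?_
  change cut L (cut L' v.1) α = cut L v.1 α
  rw [cut_apply, cut_apply, cut_apply]
  split_ifs <;> first | rfl | omega

lemma lo_mul_cu (j : Fin m) (L : ℕ) :
    (lo j * cu (L + 1) : Op m E) = cu L * lo j := by
  refine LinearMap.ext fun v => Subtype.ext ?_
  refine (lower_mulDeg (fun k => if k ≤ L + 1 then 1 else 0) j v.1).trans ?_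
  simp only [add_le_add_iff_right]
  rfl

lemma ra_mul_cu (j : Fin m) (L : ℕ) :
    (ra j * cu L : Op m E) = cu (L + 1) * ra j := by
  refine op_ext fun v α => ?_
  change raise j (cut L v.1) α = cut (L + 1) (raise j v.1) α
  by_cases h : α j = 0
  · rw [raise_zero _ h, cut_apply, raise_zero _ h, ite_self]
  · obtain ⟨β, rfl⟩ := eq_up_of_ne_zero h
    rw [raise_up, cut_apply, cut_apply, raise_up, deg_up]
    simp only [add_le_add_iff_right]
    split_ifs <;> simp

lemma cu_mul_gen (x : Fin m ⊕ Fin m) (L : ℕ) :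
    (cu L * gen x : Op m E) = cu L * gen x * cu (L + 1) := by
  cases x with
  | inl j =>
    change cu L * lo j = cu L * lo j * cu (L + 1)
    rw [mul_assoc, lo_mul_cu, ← mul_assoc, cu_mul_cu le_rfl]
  | inr j =>
    change cu L * ra j = cu L * ra j * cu (L + 1)
    rw [mul_assoc, ra_mul_cu, ← mul_assoc, cu_mul_cu' (by omega)]

lemma gen_mul_cu (x : Fin m ⊕ Fin m) (L : ℕ) :
    (gen x * cu L : Op m E) = cu (L + 1) * (gen x * cu L) := by
  cases x with
  | inl j =>
    change lo j * cu L = cu (L + 1) * (lo j * cu L)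
    have h : (cu L : Op m E) = cu (L + 1) * cu L := (cu_mul_cu (by omega)).symm
    rw [h, ← mul_assoc (lo j), lo_mul_cu, mul_assoc, ← mul_assoc (cu (L + 1)),
      cu_mul_cu (by omega)]
  | inr j =>
    change ra j * cu L = cu (L + 1) * (ra j * cu L)
    rw [ra_mul_cu, ← mul_assoc, cu_mul_cu le_rfl]

lemma lo_mul_ra (i j : Fin m) :
    (lo i * ra j - ra j * lo i : Op m E) = if i = j then 1 else 0 := by
  refine LinearMap.ext fun v => Subtype.ext ?_
  change lower i (raise j v.1) - raise j (lower i v.1) = _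
  rw [lower_raise, add_sub_cancel_left]
  split_ifs <;> rfl

lemma gen_mul_gen (x y : Fin m ⊕ Fin m) : ∃ c : ℂ,
    (gen x * gen y - gen y * gen x : Op m E) = c • 1 := by
  rcases x with i | i <;> rcases y with j | j
  · refine ⟨0, ?_⟩
    rw [zero_smul, sub_eq_zero]
    refine op_ext fun v α => ?_
    change lower i (lower j v.1) α = lower j (lower i v.1) α
    by_cases h : i = j
    · rw [h]
    · simp only [lower_apply, up_ne h, up_ne (Ne.symm h)]
      rw [smul_comm, up_comm]
  · refine ⟨if i = j then 1 else 0, ?_⟩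
    change lo i * ra j - ra j * lo i = _
    rw [lo_mul_ra]
    split_ifs <;> simp
  · refine ⟨-if j = i then 1 else 0, ?_⟩
    change ra i * lo j - lo j * ra i = _
    rw [← neg_sub, lo_mul_ra]
    split_ifs <;> simp
  · refine ⟨0, ?_⟩
    rw [zero_smul, sub_eq_zero]
    exact LinearMap.ext fun v => Subtype.ext (raise_raise i j v.1)

lemma gen_dom (x : Fin m ⊕ Fin m) {ι : Type*} (p : ℕ) (f : ι → Sch m E) :
    Dom p (fun i => ((gen x (f i) : Sch m E) : (Fin m → ℕ) → E)) (p + 1)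
      (fun i => (f i : (Fin m → ℕ) → E)) := by
  cases x
  · exact Dom.lower _ p _
  · exact Dom.raise _ p _

namespace Ord

variable {A B W : Op m E} {i j : ℕ}

lemma mul (hA : Ord i A) (hB : Ord j B) : Ord (i + j) (A * B) := fun p => by
  have := ((hA (p + j)).comp fun v => B v).trans (hB p)
  rwa [add_right_comm, add_assoc] at this

lemma mono (hij : i ≤ j) (h : Ord j W) : Ord i W := fun p =>
  (h p).mono_left (by omega)

lemma add (hA : Ord j A) (hB : Ord j B) : Ord j (A + B) := fun p => (hA p).add (hB p)

lemma smul (c : ℂ) (hA : Ord j A) : Ord j (c • A) := fun p => (hA p).smul c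

lemma zero : Ord j (0 : Op m E) := fun _ => Dom.zero

lemma one : Ord 0 (1 : Op m E) := fun p => Dom.refl p _

lemma ma (M : E →L[ℂ] E) : Ord 0 (ma M : Op m E) := fun p => Dom.mat M p _

lemma cu (L j : ℕ) : Ord j (cu L : Op m E) := fun p => Dom.cut L p j _

end Ord

/-- Symbol classes, truncated at `k` commutators. -/
def Sym : ℕ → ℕ → Op m E → Prop
  | 0, j, W => Ord j W
  | k + 1, j, W => Ord j W ∧ ∀ x, Sym k (j + 1) (gen x * W - W * gen x)

namespace Sym

variable {A B W : Op m E} {i j k : ℕ}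

lemma zero : Sym k j (0 : Op m E) := by
  induction k generalizing j with
  | zero => exact Ord.zero
  | succ k ih => exact ⟨Ord.zero, fun x => by simpa using ih⟩

lemma mono (hij : i ≤ j) (h : Sym k j W) : Sym k i W := by
  induction k generalizing i j W with
  | zero => exact Ord.mono hij h
  | succ k ih => exact ⟨h.1.mono hij, fun x => ih (Nat.succ_le_succ hij) (h.2 x)⟩

lemma pred (h : Sym (k + 1) j W) : Sym k j W := by
  induction k generalizing j W with
  | zero => exact h.1
  | succ k ih => exact ⟨h.1, fun x => ih (h.2 x)⟩

lemma add (hA : Sym k j A) (hB : Sym k j B) : Sym k j (A + B) := by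
  induction k generalizing j A B with
  | zero => exact Ord.add hA hB
  | succ k ih =>
    refine ⟨hA.1.add hB.1, fun x => ?_⟩
    have := ih (hA.2 x) (hB.2 x)
    rwa [← add_sub_add_comm, ← mul_add, ← add_mul] at this

lemma smul (c : ℂ) (hA : Sym k j A) : Sym k j (c • A) := by
  induction k generalizing j A with
  | zero => exact Ord.smul c hA
  | succ k ih =>
    refine ⟨hA.1.smul c, fun x => ?_⟩
    have := ih (hA.2 x)
    rwa [smul_sub, ← mul_smul_comm, ← smul_mul_assoc] at this

lemma mul (hA : Sym k i A) (hB : Sym k j B) : Sym k (i + j) (A * B) := by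
  induction k generalizing i j A B with
  | zero => exact Ord.mul hA hB
  | succ k ih =>
    refine ⟨hA.1.mul hB.1, fun x => ?_⟩
    have h1 := ih (hA.2 x) hB.pred
    have h2 := ih hA.pred (hB.2 x)
    rw [add_right_comm] at h1
    rw [← add_assoc] at h2
    have := h1.add h2
    convert this using 1
    noncomm_ring

end Sym

/-- Symbol classes: all iterated commutators with the generators gain one order each. -/
def Word (j : ℕ) (W : Op m E) : Prop := ∀ k, Sym k j W

namespace Word

variable {A B W : Op m E} {i j : ℕ}

lemma ord (h : Word j W) : Ord j W := h 0

lemma mono (hij : i ≤ j) (h : Word j W) : Word i W := fun k => (h k).mono hij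

lemma comm (h : Word j W) (x : Fin m ⊕ Fin m) : Word (j + 1) (gen x * W - W * gen x) :=
  fun k => (h (k + 1)).2 x

lemma zero : Word j (0 : Op m E) := fun _ => Sym.zero

lemma add (hA : Word j A) (hB : Word j B) : Word j (A + B) := fun k => (hA k).add (hB k)

lemma smul (c : ℂ) (hA : Word j A) : Word j (c • A) := fun k => (hA k).smul c

lemma mul (hA : Word i A) (hB : Word j B) : Word (i + j) (A * B) := fun k => (hA k).mul (hB k)

lemma sum {σ : Type*} (s : Finset σ) {f : σ → Op m E}
    (h : ∀ a ∈ s, Word j (f a)) : Word j (∑ a ∈ s, f a) :=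
  Finset.sum_induction f _ (fun _ _ => add) zero h

lemma ma (M : E →L[ℂ] E) : Word 0 (ma M : Op m E) := fun k => by
  cases k with
  | zero => exact Ord.ma M
  | succ k =>
    refine ⟨Ord.ma M, fun x => ?_⟩
    rw [gen_mul_ma, sub_self]
    exact Sym.zero

lemma one : Word 0 (1 : Op m E) := fun k => by
  cases k with
  | zero => exact Ord.one
  | succ k =>
    refine ⟨Ord.one, fun x => ?_⟩
    rw [mul_one, one_mul, sub_self]
    exact Sym.zero

end Word

lemma sym_of_finite {L : ℕ} {F : Op m E} (hl : cu L * F = F) (hr : F * cu L = F)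
    (hF : Ord 0 F) (k j : ℕ) : Sym k j F := by
  have key : ∀ {L : ℕ} {F : Op m E} (_ : cu L * F = F) (_ : Ord 0 F) (j : ℕ),
      Ord j F := by
    intro L F hl hF j
    have := (Ord.cu L j).mul hF
    rwa [hl] at this
  induction k generalizing L F j with
  | zero => exact key hl hF j
  | succ k ih =>
    refine ⟨key hl hF j, fun x => ?_⟩
    have h1 : cu (L + 1) * (gen x * F) = gen x * F := by
      rw [← hl, ← mul_assoc (gen x), ← mul_assoc, ← gen_mul_cu]
    have h2 : F * gen x * cu (L + 1) = F * gen x := by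
      rw [← hr, mul_assoc F, cu_mul_gen]
      simp only [mul_assoc, cu_mul_cu le_rfl]
    have h3 : cu (L + 1) * F = F := by
      rw [← hl, ← mul_assoc, cu_mul_cu (by omega)]
    have h4 : F * cu (L + 1) = F := by
      rw [← hr, mul_assoc, cu_mul_cu' (by omega)]
    refine ih (L := L + 1) ?_ ?_ ?_ _
    · rw [mul_sub, h1, ← mul_assoc, h3]
    · rw [sub_mul, h2, mul_assoc, h4]
    · rw [sub_eq_add_neg, ← neg_one_smul ℂ (F * gen x)]
      refine Ord.add (fun p => ?_) (Ord.smul _ fun p => ?_)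
      · exact (gen_dom x p _).trans (key hl hF 1 p)
      · rw [← h2]
        exact ((hF p).comp _).trans ((gen_dom x p _).trans (Ord.cu (L + 1) 1 p))

lemma Word.cu (L j : ℕ) : Word j (cu L : Op m E) := fun k =>
  sym_of_finite (cu_mul_cu le_rfl) (cu_mul_cu le_rfl) (Ord.cu L 0) k j

lemma word_comm_dir (C : Fin m → E →L[ℂ] E) (x : Fin m ⊕ Fin m) :
    Word 0 (dir C * gen x - gen x * dir C) := by
  have key : ∀ (M : E →L[ℂ] E) (y : Fin m ⊕ Fin m),
      Word 0 (ma M * gen y * gen x - gen x * (ma M * gen y)) := by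
    intro M y
    obtain ⟨c, hc⟩ := gen_mul_gen (E := E) y x
    rw [← mul_assoc, gen_mul_ma, mul_assoc, mul_assoc, ← mul_sub, hc]
    exact (Word.ma M).mul (Word.one.smul c)
  rw [dir, Finset.sum_mul, Finset.mul_sum, ← Finset.sum_sub_distrib]
  refine Word.sum _ fun j _ => ?_
  rw [add_mul, mul_add, add_sub_add_comm]
  exact (key _ (Sum.inl j)).add (key _ (Sum.inr j))

/-- The inverse of the perturbed operator has a symbol of order one. -/
lemma word_inverse {C : Fin m → E →L[ℂ] E} {L : ℕ} {s : ℂ} {Q : Op m E}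
    (hQ : Ord 1 Q) (h1 : (dir C + s • cu L) * Q = 1) (h2 : Q * (dir C + s • cu L) = 1) :
    Word 1 Q := by
  intro k
  induction k with
  | zero => exact hQ
  | succ k ih =>
    refine ⟨hQ, fun x => ?_⟩
    have h3 : Word 0 ((dir C + s • cu L) * gen x - gen x * (dir C + s • cu L)) := by
      have h4 := ((Word.cu L 0 (m := m) (E := E)).comm x).mono (Nat.zero_le _)
      have h5 := (word_comm_dir C x).add (h4.smul (-s))
      convert h5 using 1
      rw [add_mul, mul_add, smul_mul_assoc, mul_smul_comm, smul_sub, neg_smul, neg_smul]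
      abel
    have h6 := (ih.mul (h3 k)).mul ih
    convert h6 using 1
    set G := dir C + s • cu L
    calc gen x * Q - Q * gen x = (Q * G) * gen x * Q - Q * gen x * (G * Q) := by
          rw [h1, h2, one_mul, mul_one]
      _ = _ := by noncomm_ring

end

/-! ### Traces -/

section

/-- Products of a summable sequence over the coordinates of a multi-index. -/
lemma summable_tsum_prod {𝕜 : Type*} [RCLike 𝕜] {f : ℕ → 𝕜} (hf : Summable fun k => ‖f k‖)
    (m : ℕ) : (Summable fun α : Fin m → ℕ => ‖∏ i, f (α i)‖) ∧
      ∑' α : Fin m → ℕ, ∏ i, f (α i) = (∑' k, f k) ^ m := by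
  induction m with
  | zero => simpa using (hasSum_fintype (fun _ : Fin 0 → ℕ => (1 : ℝ))).summable
  | succ m ih =>
    let e : ℕ × (Fin m → ℕ) ≃ (Fin (m + 1) → ℕ) := Fin.consEquiv fun _ => ℕ
    have h : ∀ x : ℕ × (Fin m → ℕ), ∏ i, f (e x i) = f x.1 * ∏ i, f (x.2 i) := fun x => by
      rw [Fin.prod_univ_succ]
      rfl
    constructor
    · rw [← e.summable_iff]
      refine (hf.mul_norm ih.1).congr fun x => ?_
      rw [Function.comp_apply, h]
    · rw [← e.tsum_eq, tsum_congr h, ← tsum_mul_tsum_of_summable_norm hf ih.1, ih.2, pow_succ']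

variable {m : ℕ} {E : Type*} [NormedAddCommGroup E] [InnerProductSpace ℂ E] [CompleteSpace E]

lemma one_add_deg_le (α : Fin m → ℕ) : 1 + deg α ≤ ∏ i, (1 + α i) := by
  rw [deg]
  induction (Finset.univ : Finset (Fin m)) using Finset.induction_on with
  | empty => simp
  | insert i s hi ih =>
    rw [Finset.sum_insert hi, Finset.prod_insert hi]
    nlinarith [Nat.zero_le (α i), Nat.zero_le (∑ i ∈ s, α i)]

lemma prod_one_add_le (α : Fin m → ℕ) : ∏ i, (1 + α i) ≤ (1 + deg α) ^ m := by
  refine (Finset.prod_le_pow_card _ _ (1 + deg α) fun i _ => ?_).trans (by simp)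
  exact Nat.add_le_add_left (le_deg α i) 1

lemma summable_geometric_deg {s : ℝ} (hs : 0 < s) (hs1 : s < 1) (q : ℕ) :
    Summable fun α : Fin m → ℕ => s ^ deg α * (1 + deg α : ℝ) ^ q := by
  have h1 : Summable fun k : ℕ => ‖s ^ k * (1 + k : ℝ) ^ q‖ := by
    have h2 := (summable_nat_add_iff 1).2
      (summable_pow_mul_geometric_of_norm_lt_one (R := ℝ) q (r := s)
        (by rwa [Real.norm_of_nonneg hs.le]))
    refine (h2.mul_left s⁻¹).congr fun k => ?_
    rw [Real.norm_of_nonneg (by positivity)]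
    push_cast
    rw [pow_succ]
    field_simp
    ring
  refine .of_nonneg_of_le (fun α => by positivity) (fun α => ?_) (summable_tsum_prod h1 m).1
  rw [Real.norm_of_nonneg (Finset.prod_nonneg fun i _ => by positivity)]
  have h3 : (1 + deg α : ℝ) ≤ ∏ i, (1 + α i : ℝ) := by exact_mod_cast one_add_deg_le α
  calc s ^ deg α * (1 + deg α : ℝ) ^ q ≤ s ^ deg α * (∏ i, (1 + α i : ℝ)) ^ q := by gcongr
    _ = ∏ i, (s ^ α i * (1 + α i : ℝ) ^ q) := by
        rw [Finset.prod_mul_distrib, Finset.prod_pow, Finset.prod_pow_eq_pow_sum, deg]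

lemma summable_inv_deg :
    Summable fun α : Fin m → ℕ => ((1 + deg α : ℝ) ^ (2 * m))⁻¹ := by
  have h1 : Summable fun k : ℕ => ‖((1 + k : ℝ) ^ 2)⁻¹‖ := by
    have h2 := (summable_nat_add_iff 1).2 (Real.summable_nat_pow_inv (p := 2).2 one_lt_two)
    refine h2.congr fun k => ?_
    rw [Real.norm_of_nonneg (by positivity)]
    push_cast
    rw [add_comm]
  refine .of_nonneg_of_le (fun α => by positivity) (fun α => ?_) (summable_tsum_prod h1 m).1
  have h3 : (∏ i, (1 + α i : ℝ)) ≤ (1 + deg α : ℝ) ^ m := by exact_mod_cast prod_one_add_le α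
  have h4 : 0 < ∏ i, (1 + α i : ℝ) := Finset.prod_pos fun i _ => by positivity
  calc ((1 + deg α : ℝ) ^ (2 * m))⁻¹ ≤ ((∏ i, (1 + α i : ℝ)) ^ 2)⁻¹ := by
        rw [mul_comm 2 m, pow_mul]
        gcongr
    _ = ‖∏ i, ((1 + α i : ℝ) ^ 2)⁻¹‖ := by
        rw [Real.norm_of_nonneg (Finset.prod_nonneg fun i _ => by positivity), ← Finset.prod_pow,
          ← Finset.prod_inv_distrib]

/-- The sequence supported at `α`. -/
noncomputable def dl (α : Fin m → ℕ) : E →ₗ[ℂ] Sch m E where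
  toFun e := ⟨Pi.single α e, fun p => by
    rw [nu_single]
    exact ENNReal.mul_ne_top (ENNReal.pow_ne_top (by simp)) (by simp)⟩
  map_add' x y := Subtype.ext (Pi.single_add (f := fun _ : Fin m → ℕ => E) α x y)
  map_smul' c x := Subtype.ext (Pi.single_smul (f := fun _ : Fin m → ℕ => E) α c x)

/-- The matrix entries of an operator. -/
noncomputable def blk (W : Op m E) (α β : Fin m → ℕ) : E →ₗ[ℂ] E where
  toFun e := (W (dl β e) : (Fin m → ℕ) → E) α
  map_add' x y := by rw [map_add, map_add]; rfl
  map_smul' c x := by rw [map_smul, map_smul]; rfl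

/-- The trace of a diagonal entry. -/
noncomputable def tr (W : Op m E) (α : Fin m → ℕ) : ℂ := LinearMap.trace ℂ E (blk W α α)

/-- The Abel regularized supertrace. -/
noncomputable def tau (s : ℝ) (W : Op m E) : ℂ := ∑' α, (-s : ℂ) ^ deg α * tr W α

lemma lo_dl_zero (j : Fin m) {β : Fin m → ℕ} (h : β j = 0) (e : E) : lo j (dl β e) = 0 := by
  refine Subtype.ext (funext fun α => ?_)
  change lower j (Pi.single β e) α = 0
  rw [lower_apply, Pi.single_eq_of_ne, smul_zero]
  rintro rfl
  simp at h

lemma lo_dl_up (j : Fin m) (β : Fin m → ℕ) (e : E) :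
    lo j (dl (up j β) e) = ((√((β j : ℝ) + 1) : ℝ) : ℂ) • dl β e := by
  refine Subtype.ext (funext fun α => ?_)
  change lower j (Pi.single (up j β) e) α = (_ : ℂ) • (Pi.single β e : (Fin m → ℕ) → E) α
  rw [lower_apply]
  by_cases h : α = β
  · subst h; simp
  · rw [Pi.single_eq_of_ne h, Pi.single_eq_of_ne fun h' => h (up_injective j h'), smul_zero,
      smul_zero]

lemma ra_dl (j : Fin m) (β : Fin m → ℕ) (e : E) :
    ra j (dl β e) = ((√((β j : ℝ) + 1) : ℝ) : ℂ) • dl (up j β) e := by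
  refine Subtype.ext (funext fun α => ?_)
  change raise j (Pi.single β e) α = (_ : ℂ) • (Pi.single (up j β) e : (Fin m → ℕ) → E) α
  by_cases h0 : α j = 0
  · rw [raise_zero _ h0, Pi.single_eq_of_ne, smul_zero]
    rintro rfl
    simp at h0
  · obtain ⟨γ, rfl⟩ := eq_up_of_ne_zero h0
    rw [raise_up]
    by_cases h : γ = β
    · subst h; simp
    · rw [Pi.single_eq_of_ne h, Pi.single_eq_of_ne fun h' => h (up_injective j h'), smul_zero,
        smul_zero]

lemma tau_mul_lo (s : ℝ) (W : Op m E) (j : Fin m) : tau s (W * lo j) = -s * tau s (lo j * W) := by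
  have h0 : ∀ α : Fin m → ℕ, α j = 0 → tr (W * lo j) α = 0 := fun α h => by
    have : blk (W * lo j) α α = 0 := LinearMap.ext fun e => by
      change (W (lo j (dl α e)) : (Fin m → ℕ) → E) α = 0
      rw [lo_dl_zero j h, map_zero]
      rfl
    rw [tr, this, map_zero]
  have h1 : ∀ α : Fin m → ℕ, tr (W * lo j) (up j α) = tr (lo j * W) α := fun α => by
    have : blk (W * lo j) (up j α) (up j α) = blk (lo j * W) α α := LinearMap.ext fun e => by
      change (W (lo j (dl (up j α) e)) : (Fin m → ℕ) → E) (up j α) = _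
      rw [lo_dl_up, map_smul]
      rfl
    rw [tr, this, tr]
  rw [tau, tau, tsum_eq_tsum_up j _ fun α h => by rw [h0 α h, mul_zero], ← tsum_mul_left]
  refine tsum_congr fun α => ?_
  rw [h1, deg_up, pow_succ']
  ring

lemma tau_ra_mul (s : ℝ) (W : Op m E) (j : Fin m) : tau s (ra j * W) = -s * tau s (W * ra j) := by
  have h0 : ∀ α : Fin m → ℕ, α j = 0 → tr (ra j * W) α = 0 := fun α h => by
    have : blk (ra j * W) α α = 0 := LinearMap.ext fun e => raise_zero _ h
    rw [tr, this, map_zero]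
  have h1 : ∀ α : Fin m → ℕ, tr (ra j * W) (up j α) = tr (W * ra j) α := fun α => by
    have : blk (ra j * W) (up j α) (up j α) = blk (W * ra j) α α := LinearMap.ext fun e => by
      change raise j (W (dl (up j α) e)).1 (up j α) = (W (ra j (dl α e)) : (Fin m → ℕ) → E) α
      rw [raise_up, ra_dl, map_smul]
      rfl
    rw [tr, this, tr]
  rw [tau, tau, tsum_eq_tsum_up j _ fun α h => by rw [h0 α h, mul_zero], ← tsum_mul_left]
  refine tsum_congr fun α => ?_
  rw [h1, deg_up, pow_succ']
  ring

lemma tau_ma_mul (s : ℝ) (W : Op m E) (M : E →L[ℂ] E) : tau s (ma M * W) = tau s (W * ma M) := by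
  refine tsum_congr fun α => ?_
  have h1 : blk (ma M * W) α α = (M : E →ₗ[ℂ] E) * blk W α α := rfl
  have h2 : blk (W * ma M) α α = blk W α α * (M : E →ₗ[ℂ] E) := LinearMap.ext fun e => by
    change (W (ma M (dl α e)) : (Fin m → ℕ) → E) α = (W (dl α (M e)) : (Fin m → ℕ) → E) α
    suffices h : ma M (dl α e) = dl α (M e) by rw [h]
    refine Subtype.ext (funext fun β => ?_)
    change M ((Pi.single α e : (Fin m → ℕ) → E) β) = (Pi.single α (M e) : (Fin m → ℕ) → E) β
    by_cases h : β = α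
    · subst h; simp
    · simp [h]
  rw [tr, tr, h1, h2, LinearMap.trace_mul_comm]

lemma cu_dl (L : ℕ) (β : Fin m → ℕ) (e : E) :
    cu L (dl β e) = if deg β ≤ L then dl β e else 0 := by
  refine Subtype.ext (funext fun α => ?_)
  have h : (cu L (dl β e) : (Fin m → ℕ) → E) α =
    if deg α ≤ L then (Pi.single β e : (Fin m → ℕ) → E) α else 0 := cut_apply _ _ _
  rw [h]
  by_cases hαβ : α = β
  · subst hαβ
    split_ifs <;> rfl
  · rw [Pi.single_eq_of_ne hαβ, ite_self]
    split_ifs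
    · exact (Pi.single_eq_of_ne (M := fun _ => E) hαβ e).symm
    · rfl

lemma tr_cu_mul (L : ℕ) (W : Op m E) (α : Fin m → ℕ) :
    tr (cu L * W) α = if deg α ≤ L then tr W α else 0 := by
  have h : blk (cu L * W) α α = if deg α ≤ L then blk W α α else 0 := LinearMap.ext fun e => by
    refine (cut_apply L (W (dl α e)).1 α).trans ?_
    split_ifs <;> rfl
  rw [tr, h]
  split_ifs
  · rfl
  · exact map_zero _

lemma tr_mul_cu (L : ℕ) (W : Op m E) (α : Fin m → ℕ) :
    tr (W * cu L) α = if deg α ≤ L then tr W α else 0 := by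
  have h : blk (W * cu L) α α = if deg α ≤ L then blk W α α else 0 := LinearMap.ext fun e => by
    change (W (cu L (dl α e)) : (Fin m → ℕ) → E) α = _
    rw [cu_dl]
    split_ifs
    · rfl
    · rw [map_zero]; rfl
  rw [tr, h]
  split_ifs
  · rfl
  · exact map_zero _

lemma blk_add (A B : Op m E) (α β : Fin m → ℕ) : blk (A + B) α β = blk A α β + blk B α β := rfl

lemma blk_smul (c : ℂ) (A : Op m E) (α β : Fin m → ℕ) : blk (c • A) α β = c • blk A α β := rfl

lemma tr_add (A B : Op m E) (α : Fin m → ℕ) : tr (A + B) α = tr A α + tr B α := by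
  rw [tr, blk_add, map_add, tr, tr]

lemma tr_smul (c : ℂ) (A : Op m E) (α : Fin m → ℕ) : tr (c • A) α = c * tr A α := by
  rw [tr, blk_smul, map_smul, tr, smul_eq_mul]

lemma tau_smul (s : ℝ) (c : ℂ) (A : Op m E) : tau s (c • A) = c * tau s A := by
  rw [tau, tau, ← tsum_mul_left]
  refine tsum_congr fun α => ?_
  rw [tr_smul]
  ring

lemma tr_bound [FiniteDimensional ℂ E] {W : Op m E} {j q : ℕ}
    (h : Dom j (fun v => (W v : (Fin m → ℕ) → E)) q (fun v : Sch m E => v.1)) :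
    ∃ B : ℝ, 0 ≤ B ∧ ∀ α, (1 + deg α : ℝ) ^ j * ‖tr W α‖ ^ 2 ≤ B * (1 + deg α) ^ q := by
  obtain ⟨c, hc⟩ := h
  let b := stdOrthonormalBasis ℂ E
  refine ⟨(Module.finrank ℂ E) ^ 2 * c, by positivity, fun α => ?_⟩
  have h1 : ∀ i, (1 + deg α : ℝ) ^ j * ‖⟪b i, blk W α α (b i)⟫_ℂ‖ ^ 2 ≤ c * (1 + deg α) ^ q := by
    intro i
    have h2 : (1 + deg α : ℝ≥0∞) ^ j * ‖blk W α α (b i)‖ₑ ^ 2 ≤ c * (1 + deg α) ^ q := by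
      have h3 := hc (dl α (b i))
      have h4 : nu q ((dl α (b i) : Sch m E) : (Fin m → ℕ) → E) = (1 + deg α : ℝ≥0∞) ^ q := by
        refine (nu_single α (b i) q).trans ?_
        have : ‖b i‖ₑ = 1 := by rw [← ofReal_norm, b.norm_eq_one, ENNReal.ofReal_one]
        rw [this, one_pow, mul_one]
      rw [← h4]
      exact (ENNReal.le_tsum α).trans h3
    have h5 : (1 + deg α : ℝ) ^ j * ‖blk W α α (b i)‖ ^ 2 ≤ c * (1 + deg α) ^ q := by
      rw [enorm_eq_nnnorm] at h2
      have h6 : (1 + deg α : ℝ≥0) ^ j * ‖blk W α α (b i)‖₊ ^ 2 ≤ c * (1 + deg α) ^ q := by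
        exact_mod_cast h2
      exact_mod_cast h6
    refine le_trans ?_ h5
    have h7 := norm_inner_le_norm (𝕜 := ℂ) (b i) (blk W α α (b i))
    rw [b.norm_eq_one, one_mul] at h7
    gcongr
  have h8 : ‖tr W α‖ ^ 2 ≤
      Module.finrank ℂ E * ∑ i, ‖⟪b i, blk W α α (b i)⟫_ℂ‖ ^ 2 := by
    rw [tr, LinearMap.trace_eq_sum_inner _ b]
    refine (pow_le_pow_left₀ (norm_nonneg _) (norm_sum_le _ _) 2).trans ?_
    refine (sq_sum_le_card_mul_sum_sq).trans ?_
    simp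
  calc (1 + deg α : ℝ) ^ j * ‖tr W α‖ ^ 2
      ≤ (1 + deg α : ℝ) ^ j *
        (Module.finrank ℂ E * ∑ i, ‖⟪b i, blk W α α (b i)⟫_ℂ‖ ^ 2) := by gcongr
    _ = Module.finrank ℂ E * ∑ i, (1 + deg α : ℝ) ^ j * ‖⟪b i, blk W α α (b i)⟫_ℂ‖ ^ 2 := by
        rw [← Finset.mul_sum]; ring
    _ ≤ Module.finrank ℂ E * ∑ _i : Fin (Module.finrank ℂ E), (c * (1 + deg α) ^ q : ℝ) := by
        exact mul_le_mul_of_nonneg_left (Finset.sum_le_sum fun i _ => h1 i) (by positivity)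
    _ = _ := by simp; ring

end

/-! ### The index formula -/

section

variable {m : ℕ} {E : Type*} [NormedAddCommGroup E] [InnerProductSpace ℂ E] [CompleteSpace E]

/-- Operators of finite order. -/
def Tame (W : Op m E) : Prop :=
  ∀ p, ∃ q, Dom p (fun v => (W v : (Fin m → ℕ) → E)) q (fun v : Sch m E => v.1)

namespace Tame

variable {A B W : Op m E} {j : ℕ}

lemma of_ord (h : Ord j W) : Tame W := fun p => ⟨p, (h p).mono_left (by omega)⟩

lemma of_gen (x : Fin m ⊕ Fin m) : Tame (gen x : Op m E) := fun p => ⟨p + 1, gen_dom x p _⟩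

lemma mul (hA : Tame A) (hB : Tame B) : Tame (A * B) := fun p => by
  obtain ⟨q, hq⟩ := hA p
  obtain ⟨r, hr⟩ := hB q
  exact ⟨r, (hq.comp fun v => B v).trans hr⟩

lemma add (hA : Tame A) (hB : Tame B) : Tame (A + B) := fun p => by
  obtain ⟨q, hq⟩ := hA p
  obtain ⟨r, hr⟩ := hB p
  exact ⟨max q r, (hq.mono_right (le_max_left _ _)).add (hr.mono_right (le_max_right _ _))⟩

lemma smul (c : ℂ) (hA : Tame A) : Tame (c • A) := fun p => by
  obtain ⟨q, hq⟩ := hA p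
  exact ⟨q, hq.smul c⟩

lemma sum {σ : Type*} (s : Finset σ) {f : σ → Op m E} (h : ∀ a ∈ s, Tame (f a)) :
    Tame (∑ a ∈ s, f a) :=
  Finset.sum_induction f _ (fun _ _ => add) (of_ord (Ord.zero (j := 0))) h

end Tame

lemma Word.tame {W : Op m E} {j : ℕ} (h : Word j W) : Tame W := .of_ord h.ord

variable [FiniteDimensional ℂ E]

lemma summable_tau {W : Op m E} (hW : Tame W) {s : ℝ} (hs : 0 < s) (hs1 : s < 1) :
    Summable fun α => (-s : ℂ) ^ deg α * tr W α := by
  obtain ⟨q, hq⟩ := hW 0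
  obtain ⟨B, hB, h⟩ := tr_bound hq
  refine .of_norm_bounded ((summable_geometric_deg hs hs1 q).mul_left (1 + B)) fun α => ?_
  have h1 := h α
  have h2 : (1 : ℝ) ≤ (1 + deg α) ^ q := one_le_pow₀ (by simp)
  rw [pow_zero, one_mul] at h1
  have h3 : ‖tr W α‖ ≤ (1 + B) * (1 + deg α) ^ q := by
    nlinarith [sq_nonneg (‖tr W α‖ - 1)]
  rw [norm_mul, norm_pow, norm_neg, Complex.norm_real, Real.norm_of_nonneg hs.le]
  calc s ^ deg α * ‖tr W α‖ ≤ s ^ deg α * ((1 + B) * (1 + deg α) ^ q) := by gcongr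
    _ = _ := by ring

lemma tau_add {A B : Op m E} (hA : Tame A) (hB : Tame B) {s : ℝ} (hs : 0 < s) (hs1 : s < 1) :
    tau s (A + B) = tau s A + tau s B := by
  rw [tau, tau, tau, ← (summable_tau hA hs hs1).tsum_add (summable_tau hB hs hs1)]
  refine tsum_congr fun α => ?_
  rw [tr_add, mul_add]

lemma tau_sub {A B : Op m E} (hA : Tame A) (hB : Tame B) {s : ℝ} (hs : 0 < s) (hs1 : s < 1) :
    tau s (A - B) = tau s A - tau s B := by
  rw [sub_eq_add_neg, ← neg_one_smul ℂ B, tau_add hA (hB.smul _) hs hs1, tau_smul]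
  ring

lemma tau_sum {σ : Type*} (t : Finset σ) {f : σ → Op m E} (h : ∀ a ∈ t, Tame (f a)) {s : ℝ}
    (hs : 0 < s) (hs1 : s < 1) : tau s (∑ a ∈ t, f a) = ∑ a ∈ t, tau s (f a) := by
  classical
  induction t using Finset.induction_on with
  | empty =>
    rw [Finset.sum_empty, Finset.sum_empty, ← zero_smul ℂ (0 : Op m E), tau_smul, zero_mul]
  | insert a t ha ih =>
    rw [Finset.sum_insert ha, Finset.sum_insert ha, tau_add (h a (by simp))
      (Tame.sum _ fun b hb => h b (by simp [hb])) hs hs1, ih fun b hb => h b (by simp [hb])]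

lemma norm_tau_mul_gen_mul_le {A B : Op m E} (hA : Tame A) (hB : Tame B) (x : Fin m ⊕ Fin m)
    {s : ℝ} (hs : 0 < s) (hs1 : s < 1) : ‖tau s (A * gen x * B)‖ ≤
      ‖tau s ((gen x * A - A * gen x) * B)‖ + ‖tau s (A * (gen x * B - B * gen x))‖ := by
  have hx : Tame (gen x : Op m E) := Tame.of_gen x
  have h1 : tau s ((gen x * A - A * gen x) * B) =
      tau s (gen x * (A * B)) - tau s (A * gen x * B) := by
    rw [sub_mul, tau_sub ((hx.mul hA).mul hB) ((hA.mul hx).mul hB) hs hs1, mul_assoc]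
  have h2 : tau s (A * (gen x * B - B * gen x)) =
      tau s (A * gen x * B) - tau s (A * B * gen x) := by
    rw [mul_sub, ← mul_assoc, ← mul_assoc, tau_sub ((hA.mul hx).mul hB) ((hA.mul hB).mul hx)
      hs hs1]
  have key : ∀ (a b t : ℂ), (1 + s) * t = s * a - b ∨ (1 + s) * t = a - s * b →
      ‖t‖ ≤ ‖b‖ + ‖a‖ := by
    intro a b t h
    have h3 : ‖((1 + s : ℝ) : ℂ) * t‖ ≤ ‖b‖ + ‖a‖ := by
      have hs' : ‖(s : ℂ)‖ = s := by rw [Complex.norm_real, Real.norm_of_nonneg hs.le]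
      rw [Complex.ofReal_add, Complex.ofReal_one]
      rcases h with h | h <;> rw [h] <;> refine (norm_sub_le _ _).trans ?_ <;>
        rw [norm_mul, hs'] <;> nlinarith [norm_nonneg a, norm_nonneg b]
    rw [norm_mul, Complex.norm_real, Real.norm_of_nonneg (by linarith)] at h3
    nlinarith [norm_nonneg t]
  refine key _ _ _ ?_
  rw [h1, h2]
  cases x with
  | inl j =>
    right
    have := tau_mul_lo s (A * B) j
    change tau s (A * B * gen (Sum.inl j)) = -s * tau s (gen (Sum.inl j) * (A * B)) at this
    rw [this]
    ring
  | inr j =>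
    left
    have := tau_ra_mul s (A * B) j
    change tau s (gen (Sum.inr j) * (A * B)) = -s * tau s (A * B * gen (Sum.inr j)) at this
    rw [this]
    ring

/-- The regularized supertrace stays bounded. -/
def Bdd (W : Op m E) : Prop := ∃ B : ℝ, ∀ s : ℝ, 0 < s → s < 1 → ‖tau s W‖ ≤ B

lemma Bdd.add {A B : Op m E} (tA : Tame A) (tB : Tame B) (hA : Bdd A) (hB : Bdd B) :
    Bdd (A + B) := by
  obtain ⟨a, ha⟩ := hA
  obtain ⟨b, hb⟩ := hB
  refine ⟨a + b, fun s hs hs1 => ?_⟩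
  rw [tau_add tA tB hs hs1]
  exact (norm_add_le _ _).trans (add_le_add (ha s hs hs1) (hb s hs hs1))

lemma Bdd.smul {A : Op m E} (c : ℂ) (hA : Bdd A) : Bdd (c • A) := by
  obtain ⟨a, ha⟩ := hA
  refine ⟨‖c‖ * a, fun s hs hs1 => ?_⟩
  rw [tau_smul, norm_mul]
  exact mul_le_mul_of_nonneg_left (ha s hs hs1) (norm_nonneg _)

lemma Bdd.sum {σ : Type*} (t : Finset σ) {f : σ → Op m E} (h : ∀ a ∈ t, Tame (f a))
    (hf : ∀ a ∈ t, Bdd (f a)) : Bdd (∑ a ∈ t, f a) := by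
  choose! B hB using hf
  refine ⟨∑ a ∈ t, B a, fun s hs hs1 => ?_⟩
  rw [tau_sum t h hs hs1]
  exact (norm_sum_le _ _).trans (Finset.sum_le_sum fun a ha => hB a ha s hs hs1)

lemma bdd_of_ord {W : Op m E} (hW : Ord (4 * m) W) : Bdd W := by
  obtain ⟨B, hB, h⟩ := tr_bound (hW 0)
  refine ⟨∑' α : Fin m → ℕ, √B * ((1 + deg α : ℝ) ^ (2 * m))⁻¹, fun s hs hs1 => ?_⟩
  refine tsum_of_norm_bounded (summable_inv_deg.mul_left _).hasSum fun α => ?_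
  rw [norm_mul, norm_pow, norm_neg, Complex.norm_real, Real.norm_of_nonneg hs.le]
  have h1 : ‖tr W α‖ ≤ √B * ((1 + deg α : ℝ) ^ (2 * m))⁻¹ := by
    rw [← div_eq_mul_inv, le_div_iff₀ (by positivity)]
    refine Real.le_sqrt_of_sq_le ?_
    have h2 := h α
    rw [pow_zero, mul_one, zero_add] at h2
    refine le_trans (le_of_eq ?_) h2
    ring
  exact (mul_le_of_le_one_left (norm_nonneg _) (pow_le_one₀ hs.le hs1.le)).trans h1

lemma bdd_mul_gen_mul {A B : Op m E} {i j : ℕ} (hA : Word i A) (hB : Word j B)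
    (h : ∀ W : Op m E, Word (i + j + 1) W → Bdd W) (x : Fin m ⊕ Fin m) :
    Bdd (A * gen x * B) := by
  have h1 : Word (i + j + 1) ((gen x * A - A * gen x) * B) := by
    have := (hA.comm x).mul hB
    rwa [add_right_comm] at this
  have h2 : Word (i + j + 1) (A * (gen x * B - B * gen x)) := hA.mul (hB.comm x)
  obtain ⟨a, ha⟩ := h _ h1
  obtain ⟨b, hb⟩ := h _ h2
  exact ⟨a + b, fun s hs hs1 => (norm_tau_mul_gen_mul_le hA.tame hB.tame x hs hs1).trans
    (add_le_add (ha s hs hs1) (hb s hs hs1))⟩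

lemma bdd_word {C : Fin m → E →L[ℂ] E} {L : ℕ} {c : ℂ} {Q : Op m E} (hQ : Word 1 Q)
    (h1 : (dir C + c • cu L) * Q = 1) (d j : ℕ) (hd : 4 * m ≤ j + 2 * d) :
    ∀ W : Op m E, Word j W → Bdd W := by
  induction d generalizing j with
  | zero => exact fun W hW => bdd_of_ord (hW.ord.mono (by omega))
  | succ d ih =>
    intro W hW
    have hstep : ∀ (M : E →L[ℂ] E) (x : Fin m ⊕ Fin m), Bdd (W * ma M * gen x * Q) := by
      intro M x
      exact bdd_mul_gen_mul (i := j) (hW.mul (Word.ma M)) hQ (ih _ (by omega)) x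
    have htame : ∀ (M : E →L[ℂ] E) (x : Fin m ⊕ Fin m), Tame (W * ma M * gen x * Q) := fun M x =>
      ((hW.mul (Word.ma M)).tame.mul (Tame.of_gen x)).mul hQ.tame
    have hcu : Bdd (c • (W * (cu L * Q))) := by
      refine Bdd.smul c (bdd_of_ord ?_)
      exact ((hW.mul ((Word.cu L (4 * m)).mul hQ)).mono (by omega)).ord
    have htcu : Tame (c • (W * (cu L * Q))) :=
      (hW.mul ((Word.cu L 0).mul hQ)).tame.smul c
    have hdec : W = ∑ i, (W * ma (C i) * gen (Sum.inl i) * Q +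
        W * ma (ContinuousLinearMap.adjoint (C i)) * gen (Sum.inr i) * Q) +
          c • (W * (cu L * Q)) := by
      calc W = W * ((dir C + c • cu L) * Q) := by rw [h1, mul_one]
        _ = W * (dir C * Q) + c • (W * (cu L * Q)) := by
          rw [add_mul, mul_add, smul_mul_assoc, mul_smul_comm]
        _ = _ := by
          rw [dir, Finset.sum_mul, Finset.mul_sum]
          congr 1
          refine Finset.sum_congr rfl fun i _ => ?_
          rw [add_mul, mul_add]
          simp only [mul_assoc]
          rfl
    rw [hdec]
    refine Bdd.add (Tame.sum _ fun i _ => (htame _ _).add (htame _ _)) htcu ?_ hcu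
    exact Bdd.sum _ (fun i _ => (htame _ _).add (htame _ _)) fun i _ =>
      Bdd.add (htame _ _) (htame _ _) (hstep _ _) (hstep _ _)

lemma tau_one {s : ℝ} (hs : 0 < s) (hs1 : s < 1) :
    tau s (1 : Op m E) = (1 + s : ℂ)⁻¹ ^ m * Module.finrank ℂ E := by
  have h : ∀ α, tr (1 : Op m E) α = Module.finrank ℂ E := by
    intro α
    have : blk (1 : Op m E) α α = 1 := LinearMap.ext fun e => by
      change (Pi.single α e : (Fin m → ℕ) → E) α = e
      rw [Pi.single_eq_same]
    rw [tr, this, LinearMap.trace_one]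
  have hn : ‖(-s : ℂ)‖ < 1 := by
    rwa [norm_neg, Complex.norm_real, Real.norm_of_nonneg hs.le]
  have h1 : Summable fun k : ℕ => ‖(-s : ℂ) ^ k‖ := summable_norm_geometric_of_norm_lt_one hn
  have h2 : ∑' α : Fin m → ℕ, ∏ i, (-s : ℂ) ^ α i = (∑' k : ℕ, (-s : ℂ) ^ k) ^ m :=
    (summable_tsum_prod h1 m).2
  rw [tsum_geometric_of_norm_lt_one hn, sub_neg_eq_add] at h2
  rw [← h2, tau, ← tsum_mul_right]
  refine tsum_congr fun α => ?_
  rw [h, Finset.prod_pow_eq_pow_sum, deg]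

lemma tau_cu (s : ℝ) (L : ℕ) (W : Op m E) :
    tau s (cu L * W) = ∑ α ∈ (finite_deg_le L).toFinset, (-s : ℂ) ^ deg α * tr W α := by
  rw [tau, tsum_eq_sum (s := (finite_deg_le L).toFinset)]
  · refine Finset.sum_congr rfl fun α hα => ?_
    rw [tr_cu_mul, if_pos (by simpa using hα)]
  · intro α hα
    rw [tr_cu_mul, if_neg (by simpa using hα), mul_zero]

lemma tau_mul_cu (s : ℝ) (L : ℕ) (W : Op m E) : tau s (W * cu L) = tau s (cu L * W) :=
  tsum_congr fun α => by rw [tr_mul_cu, tr_cu_mul]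

/-- The index formula. -/
lemma index_formula {C : Fin m → E →L[ℂ] E} {L : ℕ} {c : ℂ} {Q : Op m E} (hQ : Word 1 Q)
    (h1 : (dir C + c • cu L) * Q = 1) (h2 : Q * (dir C + c • cu L) = 1) :
    (Module.finrank ℂ E : ℂ) =
      2 ^ m * (c * ∑ α ∈ (finite_deg_le L).toFinset, (-1 : ℂ) ^ deg α * tr Q α) := by
  have hb : ∀ W : Op m E, Word 0 W → Bdd W := bdd_word hQ h1 (2 * m) 0 (by omega)
  have tQ := hQ.tame
  have hA : ∀ i, Word 0 (ma (C i) : Op m E) := fun i => Word.ma _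
  have hA' : ∀ i, Word 0 (ma (ContinuousLinearMap.adjoint (C i)) : Op m E) := fun i => Word.ma _
  let R : Op m E := ∑ i, (ma (C i) * gen (Sum.inl i) * Q +
    Q * ma (ContinuousLinearMap.adjoint (C i)) * gen (Sum.inr i) * 1)
  have tX : ∀ i, Tame (ma (C i) * gen (Sum.inl i) * Q) := fun i =>
    ((hA i).tame.mul (Tame.of_gen _)).mul tQ
  have tY : ∀ i, Tame (Q * ma (ContinuousLinearMap.adjoint (C i)) * gen (Sum.inr i) * 1) :=
    fun i => ((tQ.mul (hA' i).tame).mul (Tame.of_gen _)).mul Word.one.tame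
  have tX' : ∀ i, Tame (Q * (ma (C i) * gen (Sum.inl i))) := fun i =>
    tQ.mul ((hA i).tame.mul (Tame.of_gen _))
  have tY' : ∀ i, Tame (ma (ContinuousLinearMap.adjoint (C i)) * gen (Sum.inr i) * Q) :=
    fun i => ((hA' i).tame.mul (Tame.of_gen _)).mul tQ
  have bR : Bdd R := by
    refine Bdd.sum _ (fun i _ => (tX i).add (tY i)) fun i _ => Bdd.add (tX i) (tY i) ?_ ?_
    · exact bdd_mul_gen_mul (hA i) hQ (fun W hW => hb W (hW.mono (Nat.zero_le _))) _
    · exact bdd_mul_gen_mul (hQ.mul (hA' i)) Word.one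
        (fun W hW => hb W (hW.mono (Nat.zero_le _))) _
  have tdir : Tame (dir C) := Tame.sum _ fun i _ =>
    ((hA i).tame.mul (Tame.of_gen (Sum.inl i))).add ((hA' i).tame.mul (Tame.of_gen (Sum.inr i)))
  have tcu : Tame (cu L : Op m E) := (Word.cu L 0).tame
  have hdir : ∀ s : ℝ, 0 < s → s < 1 →
      tau s (dir C * Q) + tau s (Q * dir C) = (1 - s) * tau s R := by
    intro s hs hs1
    have e1 : dir C * Q = ∑ i, (ma (C i) * gen (Sum.inl i) * Q +
        ma (ContinuousLinearMap.adjoint (C i)) * gen (Sum.inr i) * Q) := by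
      rw [dir, Finset.sum_mul]
      exact Finset.sum_congr rfl fun i _ => add_mul _ _ _
    have e2 : Q * dir C = ∑ i, (Q * (ma (C i) * gen (Sum.inl i)) +
        Q * ma (ContinuousLinearMap.adjoint (C i)) * gen (Sum.inr i) * 1) := by
      rw [dir, Finset.mul_sum]
      refine Finset.sum_congr rfl fun i _ => ?_
      rw [mul_add, mul_one, mul_assoc Q (ma (ContinuousLinearMap.adjoint (C i)))]
      rfl
    rw [e1, e2, tau_sum _ (fun i _ => (tX i).add (tY' i)) hs hs1,
      tau_sum _ (fun i _ => (tX' i).add (tY i)) hs hs1,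
      tau_sum _ (fun i _ => (tX i).add (tY i)) hs hs1, ← Finset.sum_add_distrib, Finset.mul_sum]
    refine Finset.sum_congr rfl fun i _ => ?_
    rw [tau_add (tX i) (tY' i) hs hs1, tau_add (tX' i) (tY i) hs hs1,
      tau_add (tX i) (tY i) hs hs1]
    have e3 : tau s (Q * (ma (C i) * gen (Sum.inl i))) =
        -s * tau s (ma (C i) * gen (Sum.inl i) * Q) := by
      rw [← mul_assoc]
      refine (tau_mul_lo s _ i).trans ?_
      rw [mul_assoc (ma (C i)), tau_ma_mul, mul_assoc]
      rfl
    have e4 : tau s (ma (ContinuousLinearMap.adjoint (C i)) * gen (Sum.inr i) * Q) =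
        -s * tau s (Q * ma (ContinuousLinearMap.adjoint (C i)) * gen (Sum.inr i) * 1) := by
      rw [mul_assoc, tau_ma_mul, mul_assoc, mul_one]
      exact tau_ra_mul s _ i
    rw [e3, e4]
    ring
  have hid : ∀ s : ℝ, 0 < s → s < 1 → 2 * ((1 + s : ℂ)⁻¹ ^ m * Module.finrank ℂ E) =
      (1 - s) * tau s R +
        2 * (c * ∑ α ∈ (finite_deg_le L).toFinset, (-s : ℂ) ^ deg α * tr Q α) := by
    intro s hs hs1
    rw [← tau_one hs hs1, ← tau_cu, ← hdir s hs hs1]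
    have e1 : tau s (1 : Op m E) = tau s (dir C * Q) + c * tau s (cu L * Q) := by
      rw [← h1, add_mul, smul_mul_assoc, tau_add (tdir.mul tQ) ((tcu.mul tQ).smul c) hs hs1,
        tau_smul]
    have e2 : tau s (1 : Op m E) = tau s (Q * dir C) + c * tau s (cu L * Q) := by
      rw [← h2, mul_add, mul_smul_comm, tau_add (tQ.mul tdir) ((tQ.mul tcu).smul c) hs hs1,
        tau_smul, tau_mul_cu]
    rw [two_mul]
    nth_rewrite 1 [e1]
    rw [e2]
    ring
  obtain ⟨b, hb'⟩ := bR
  have hev : ∀ᶠ s : ℝ in 𝓝[<] 1, 0 < s ∧ s < 1 :=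
    Ioo_mem_nhdsLT one_pos
  have l1 : Tendsto (fun s : ℝ => (1 - s : ℂ) * tau s R) (𝓝[<] 1) (𝓝 0) := by
    have l0 : Tendsto (fun s : ℝ => (1 - s) * b) (𝓝[<] 1) (𝓝 0) := by
      have : Continuous fun s : ℝ => (1 - s) * b := by fun_prop
      simpa using (this.tendsto 1).mono_left nhdsWithin_le_nhds
    refine squeeze_zero_norm' (hev.mono fun s hs => ?_) l0
    rw [norm_mul, ← Complex.ofReal_one, ← Complex.ofReal_sub, Complex.norm_real,
      Real.norm_of_nonneg (by linarith [hs.2])]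
    exact mul_le_mul_of_nonneg_left (hb' s hs.1 hs.2) (by linarith [hs.2])
  have l2 : Tendsto (fun s : ℝ => 2 * (c * ∑ α ∈ (finite_deg_le L).toFinset,
      (-s : ℂ) ^ deg α * tr Q α)) (𝓝[<] 1)
      (𝓝 (2 * (c * ∑ α ∈ (finite_deg_le L).toFinset, (-(1 : ℝ) : ℂ) ^ deg α * tr Q α))) := by
    have : Continuous fun s : ℝ => 2 * (c * ∑ α ∈ (finite_deg_le L).toFinset,
      (-s : ℂ) ^ deg α * tr Q α) := by fun_prop
    exact (this.tendsto 1).mono_left nhdsWithin_le_nhds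
  have l3 : Tendsto (fun s : ℝ => 2 * ((1 + s : ℂ)⁻¹ ^ m * Module.finrank ℂ E)) (𝓝[<] 1)
      (𝓝 (2 * ((1 + (1 : ℝ) : ℂ)⁻¹ ^ m * Module.finrank ℂ E))) := by
    have : ContinuousAt (fun s : ℝ => 2 * ((1 + s : ℂ)⁻¹ ^ m * Module.finrank ℂ E)) 1 := by
      have h0 : (1 + ((1 : ℝ) : ℂ)) ≠ 0 := by norm_num
      fun_prop (disch := assumption)
    exact this.tendsto.mono_left nhdsWithin_le_nhds
  have h3 := tendsto_nhds_unique (l3.congr' (hev.mono fun s hs => hid s hs.1 hs.2)) (l1.add l2)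
  rw [zero_add, Complex.ofReal_one, one_add_one_eq_two] at h3
  have h4 := mul_left_cancel₀ two_ne_zero h3
  rw [← h4, ← mul_assoc, ← mul_pow, mul_inv_cancel₀ two_ne_zero, one_pow, one_mul]

end

/-! ### Integrality -/

section

/-- The trace of an operator on a finite power is the sum of the traces of its diagonal entries. -/
lemma trace_pi {R M ι : Type*} [CommRing R] [AddCommGroup M] [Module R M] [Module.Free R M]
    [Module.Finite R M] [Fintype ι] [DecidableEq ι] (f : (ι → M) →ₗ[R] (ι → M)) :
    LinearMap.trace R (ι → M) f = ∑ a, LinearMap.trace R M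
      (LinearMap.proj a ∘ₗ f ∘ₗ LinearMap.single R (fun _ : ι => M) a) := by
  have h : f = ∑ a, (f ∘ₗ LinearMap.single R (fun _ : ι => M) a) ∘ₗ LinearMap.proj a := by
    refine LinearMap.ext fun v => ?_
    rw [LinearMap.sum_apply]
    conv_lhs => rw [← Finset.univ_sum_single v, map_sum]
    rfl
  conv_lhs => rw [h]
  rw [map_sum]
  exact Finset.sum_congr rfl fun a _ => LinearMap.trace_comp_comm' _ _

/-- The trace of an idempotent is a natural number. -/
lemma exists_nat_trace_eq {K V : Type*} [Field K] [AddCommGroup V] [Module K V]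
    [FiniteDimensional K V] {p : V →ₗ[K] V} (h : p ∘ₗ p = p) :
    ∃ k : ℕ, LinearMap.trace K V p = k :=
  ⟨_, (LinearMap.IsIdempotentElem.isProj_range p h).trace⟩

variable {m : ℕ} {E : Type*} [NormedAddCommGroup E] [InnerProductSpace ℂ E] [CompleteSpace E]

/-- The parity operator. -/
noncomputable def sg : Op m E :=
  onSch (mulDeg fun k => (-1) ^ k) fun p => ⟨p, 1, fun v => by
    simp [nu, mulDeg_apply, enorm_smul]⟩

lemma sg_mul_sg : (sg * sg : Op m E) = 1 := by
  refine op_ext fun v α => ?_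
  change (-1 : ℂ) ^ deg α • (-1 : ℂ) ^ deg α • v.1 α = v.1 α
  rw [smul_smul, ← mul_pow]
  simp

lemma sg_mul_cu (L : ℕ) : (sg * cu L : Op m E) = cu L * sg := by
  refine op_ext fun v α => ?_
  change (-1 : ℂ) ^ deg α • cut L v.1 α = cut L (mulDeg (fun k => (-1) ^ k) v.1) α
  rw [cut_apply, cut_apply, mulDeg_apply]
  split_ifs <;> simp

lemma sg_mul_ma (M : E →L[ℂ] E) : (sg * ma M : Op m E) = ma M * sg := by
  refine op_ext fun v α => ?_
  change (-1 : ℂ) ^ deg α • M (v.1 α) = M ((-1 : ℂ) ^ deg α • v.1 α)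
  rw [map_smul]

lemma sg_mul_lo (j : Fin m) : (sg * lo j : Op m E) = -(lo j * sg) := by
  refine op_ext fun v α => ?_
  change (-1 : ℂ) ^ deg α • lower j v.1 α = -lower j (mulDeg (fun k => (-1) ^ k) v.1) α
  rw [lower_apply, lower_apply, mulDeg_apply, deg_up, pow_succ, smul_comm]
  simp

lemma sg_mul_ra (j : Fin m) : (sg * ra j : Op m E) = -(ra j * sg) := by
  refine op_ext fun v α => ?_
  change (-1 : ℂ) ^ deg α • raise j v.1 α = -raise j (mulDeg (fun k => (-1) ^ k) v.1) α
  by_cases h : α j = 0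
  · rw [raise_zero _ h, raise_zero _ h]
    simp
  · obtain ⟨β, rfl⟩ := eq_up_of_ne_zero h
    rw [raise_up, raise_up, mulDeg_apply, deg_up, pow_succ, smul_comm]
    simp

lemma sg_mul_dir (C : Fin m → E →L[ℂ] E) : (sg * dir C : Op m E) = -(dir C * sg) := by
  rw [dir, Finset.mul_sum, Finset.sum_mul, ← Finset.sum_neg_distrib]
  refine Finset.sum_congr rfl fun j _ => ?_
  rw [mul_add, add_mul, ← mul_assoc, ← mul_assoc, sg_mul_ma, sg_mul_ma, mul_assoc, mul_assoc,
    sg_mul_lo, sg_mul_ra, mul_neg, mul_neg, neg_add, mul_assoc, mul_assoc]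

lemma tr_sg_mul (W : Op m E) (α : Fin m → ℕ) : tr (sg * W) α = (-1) ^ deg α * tr W α :=
  map_smul (LinearMap.trace ℂ E) ((-1 : ℂ) ^ deg α) (blk W α α)

/-- The truncation of an operator to degree at most `L`. -/
noncomputable def comp (L : ℕ) (W : Op m E) :
    ((finite_deg_le (m := m) L).toFinset → E) →ₗ[ℂ] ((finite_deg_le (m := m) L).toFinset → E) :=
  LinearMap.pi fun α => ∑ β : (finite_deg_le (m := m) L).toFinset, blk W α β ∘ₗ LinearMap.proj β

lemma comp_apply (L : ℕ) (W : Op m E) (v : (finite_deg_le (m := m) L).toFinset → E)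
    (α : (finite_deg_le (m := m) L).toFinset) : comp L W v α = ∑ β : (finite_deg_le (m := m) L).toFinset, blk W α β (v β) := by
  simp [comp]

lemma trace_comp [FiniteDimensional ℂ E] (L : ℕ) (W : Op m E) :
    LinearMap.trace ℂ _ (comp L W) = ∑ α ∈ (finite_deg_le (m := m) L).toFinset, tr W α := by
  classical
  rw [trace_pi, ← Finset.sum_coe_sort (finite_deg_le (m := m) L).toFinset]
  refine Finset.sum_congr rfl fun α _ => congrArg (LinearMap.trace ℂ E) (LinearMap.ext fun e => ?_)
  change comp L W (Pi.single α e) α = _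
  rw [comp_apply, Finset.sum_eq_single α]
  · rw [Pi.single_eq_same]
  · intro β _ h
    rw [Pi.single_eq_of_ne (M := fun _ => E) h, map_zero]
  · simp

lemma cu_eq_sum (L : ℕ) (v : Sch m E) :
    cu L v = ∑ γ ∈ (finite_deg_le (m := m) L).toFinset, dl γ (v.1 γ) := by
  refine Subtype.ext (funext fun α => ?_)
  rw [Submodule.coe_sum, Finset.sum_apply]
  refine (cut_apply L v.1 α).trans ?_
  change _ = ∑ γ ∈ (finite_deg_le (m := m) L).toFinset, (Pi.single γ (v.1 γ) : (Fin m → ℕ) → E) α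
  rw [Finset.sum_pi_single]
  simp

lemma comp_comp (L : ℕ) (A B : Op m E) : comp L A ∘ₗ comp L B = comp L (A * cu L * B) := by
  refine LinearMap.ext fun v => funext fun α => ?_
  rw [LinearMap.comp_apply, comp_apply, comp_apply]
  have h : ∀ β : (finite_deg_le (m := m) L).toFinset, blk (A * cu L * B) α β (v β) =
      ∑ γ : (finite_deg_le (m := m) L).toFinset, blk A α γ (blk B γ β (v β)) := fun β => by
    change (A (cu L (B (dl β (v β)))) : (Fin m → ℕ) → E) α = _
    rw [cu_eq_sum, map_sum, Submodule.coe_sum, Finset.sum_apply, ← Finset.sum_coe_sort]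
    rfl
  simp_rw [h, comp_apply, map_sum]
  exact Finset.sum_comm

/-- Compressing the inverse to low degrees yields an idempotent. -/
lemma idempotent_of_inverse {A : Type*} [Ring A] [Algebra ℂ A] {D P S Q : A} (hP : P * P = P)
    (hS : S * S = 1) (hSP : S * P = P * S) (hSD : S * D = -(D * S))
    (h1 : (D + Complex.I • P) * Q = 1) (h2 : Q * (D + Complex.I • P) = 1) :
    let p := (1 / 2 : ℂ) • P + (1 / 2 : ℂ) • (S * P) - Complex.I • (S * (P * Q * P))
    p * P * p = p := by
  intro p
  have a1 : S * (D + Complex.I • P) * S = -(D + Complex.I • P) + (2 * Complex.I) • P := by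
    rw [mul_add, add_mul, hSD, neg_mul, mul_assoc D, hS, mul_one, mul_smul_comm, smul_mul_assoc,
      hSP, mul_assoc P, hS, mul_one]
    module
  have a2 : S * Q * S * (S * (D + Complex.I • P) * S) = 1 := by
    rw [mul_assoc S (D + _), mul_assoc (S * Q), ← mul_assoc S S, hS, one_mul, ← mul_assoc,
      mul_assoc S Q, h2, mul_one, hS]
  rw [a1, mul_add, mul_neg, mul_smul_comm] at a2
  have a3 : S * Q * S = -Q + (2 * Complex.I) • (S * Q * S * P * Q) := by
    have := congrArg (· * Q) a2
    simp only [add_mul, neg_mul, one_mul, smul_mul_assoc] at this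
    rw [mul_assoc (S * Q * S), h1, mul_one] at this
    rw [eq_neg_add_iff_add_eq, add_comm, ← eq_neg_add_iff_add_eq]
    exact this.symm
  obtain ⟨X, hX⟩ : ∃ X, X = P * Q * P := ⟨_, rfl⟩
  have hPX : P * X = X := by rw [hX, mul_assoc, ← mul_assoc P P, hP]
  have hXP : X * P = X := by rw [hX, mul_assoc, hP]
  have a4 : X + S * X * S = (2 * Complex.I) • (S * X * (S * X)) := by
    have b1 : S * X * S = P * (S * Q * S) * P := by
      rw [hX, ← mul_assoc, ← mul_assoc, hSP]
      simp only [mul_assoc]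
      rw [hSP]
    have b2 : S * X * (S * X) = P * (S * Q * S * P * Q) * P := by
      rw [hX]
      simp only [mul_assoc]
      rw [← mul_assoc P S, ← hSP, mul_assoc S P, ← mul_assoc P P, hP, ← mul_assoc P S, ← hSP,
        mul_assoc S P]
    rw [b1, b2]
    nth_rewrite 1 [a3]
    rw [mul_add, add_mul, mul_neg, neg_mul, ← hX, mul_smul_comm, smul_mul_assoc]
    abel
  obtain ⟨T, hT⟩ : ∃ T, T = S * P - (2 * Complex.I) • (S * X) := ⟨_, rfl⟩
  have hTP : T * P = T := by
    rw [hT, sub_mul, smul_mul_assoc, mul_assoc, mul_assoc, hP, hXP]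
  have hPT : P * T = T := by
    rw [hT, mul_sub, mul_smul_comm, ← mul_assoc, ← mul_assoc, ← hSP, mul_assoc, mul_assoc, hP, hPX]
  have hTT : T * T = P := by
    have c1 : S * P * (S * P) = P := by
      rw [mul_assoc, ← mul_assoc P, ← hSP, mul_assoc S P, hP, ← mul_assoc, hS, one_mul]
    have c2 : S * P * (S * X) = X := by
      rw [mul_assoc, ← mul_assoc P, ← hSP, mul_assoc S P, hPX, ← mul_assoc, hS, one_mul]
    have c3 : S * X * (S * P) = S * X * S := by
      rw [hSP, ← mul_assoc, mul_assoc S X, hXP]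
    have hI : Complex.I * Complex.I = -1 := Complex.I_mul_I
    have c4 : ((2 * Complex.I) * (2 * Complex.I) : ℂ) = -4 := by linear_combination 4 * hI
    rw [hT, sub_mul, mul_sub, mul_sub, c1, mul_smul_comm, c2, smul_mul_assoc, c3, smul_mul_assoc,
      mul_smul_comm]
    have c5 := congrArg ((2 * Complex.I) • ·) a4
    simp only [smul_add] at c5
    rw [← c5]
    abel
  have hp : p = (1 / 2 : ℂ) • (P + T) := by
    rw [hT, hX]
    change _ + _ - _ = _
    module
  have hpP : p * P = p := by rw [hp, smul_mul_assoc, add_mul, hP, hTP]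
  rw [hpP, hp, smul_mul_smul_comm, add_mul, mul_add, mul_add, hP, hPT, hTP, hTT]
  module

/-- The pairing of the index formula is an integer. -/
lemma exists_int_eq [FiniteDimensional ℂ E] {C : Fin m → E →L[ℂ] E} {L : ℕ} {Q : Op m E}
    (h1 : (dir C + Complex.I • cu L) * Q = 1) (h2 : Q * (dir C + Complex.I • cu L) = 1) :
    ∃ k : ℤ, Complex.I * ∑ α ∈ (finite_deg_le L).toFinset, (-1 : ℂ) ^ deg α * tr Q α = k := by
  obtain ⟨k, hk⟩ := exists_nat_trace_eq ((comp_comp L _ _).trans (congrArg (comp L)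
    (idempotent_of_inverse (cu_mul_cu le_rfl) sg_mul_sg (sg_mul_cu L) (sg_mul_dir C) h1 h2)))
  have h1' : ∀ α ∈ (finite_deg_le (m := m) L).toFinset, tr (cu L : Op m E) α =
      Module.finrank ℂ E := fun α hα => by
    have : blk (cu L : Op m E) α α = LinearMap.id := LinearMap.ext fun e => by
      change (cu L (dl α e) : (Fin m → ℕ) → E) α = e
      rw [cu_dl, if_pos (by simpa using hα)]
      exact Pi.single_eq_same (M := fun _ => E) α e
    rw [tr, this, LinearMap.trace_id]
  rw [trace_comp] at hk
  refine ⟨(∑ α ∈ (finite_deg_le (m := m) L).toFinset,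
    if Even (deg α) then (Module.finrank ℂ E : ℤ) else 0) - k, ?_⟩
  push_cast
  rw [← hk, Finset.mul_sum, ← Finset.sum_sub_distrib]
  refine Finset.sum_congr rfl fun α hα => ?_
  rw [sub_eq_add_neg (_ + _), ← neg_smul, tr_add, tr_add, tr_smul, tr_smul, tr_smul, tr_sg_mul,
    tr_sg_mul, h1' α hα, tr_mul_cu, tr_cu_mul, if_pos (by simpa using hα : deg α ≤ L),
    if_pos (by simpa using hα : deg α ≤ L)]
  split_ifs with he
  · rw [he.neg_one_pow]
    ring
  · rw [(Nat.not_even_iff_odd.1 he).neg_one_pow]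
    ring

/-- The power of two divides the rank of an elliptic family. -/
lemma two_pow_dvd_finrank [FiniteDimensional ℂ E] {C : Fin m → E →L[ℂ] E} {c : ℝ} (hc : 0 < c)
    (hC : Elliptic C c) (hm : 1 ≤ m) : 2 ^ m ∣ Module.finrank ℂ E := by
  obtain ⟨L, hL⟩ := exists_apriori hc hC hm
  obtain ⟨Q, hQ, h1, h2⟩ := exists_inverse hm (hL Complex.I (.inl rfl))
    (hL _ (.inr Complex.conj_I))
  obtain ⟨k, hk⟩ := exists_int_eq h1 h2
  have h := index_formula (word_inverse hQ h1 h2) h1 h2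
  rw [hk] at h
  have h3 : (2 : ℤ) ^ m ∣ (Module.finrank ℂ E : ℤ) := ⟨k, by exact_mod_cast h⟩
  exact_mod_cast h3

end

/-! ### Families of invertible matrices -/

section

variable {m : ℕ} {E : Type*} [NormedAddCommGroup E] [InnerProductSpace ℂ E]

/-- Pointwise injectivity of the symbol gives a uniform lower bound. -/
lemma exists_elliptic [FiniteDimensional ℂ E] {C : Fin m → E →L[ℂ] E}
    (h : ∀ z : Fin m → ℂ, z ≠ 0 → ∀ v : E,
      ∑ j, (conj (z j) • C j v + z j • ContinuousLinearMap.adjoint (C j) v) = 0 → v = 0) :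
    ∃ c, 0 < c ∧ Elliptic C c := by
  let g : EuclideanSpace ℂ (Fin m) × E → E := fun w =>
    ∑ j, (conj (w.1 j) • C j w.2 + w.1 j • ContinuousLinearMap.adjoint (C j) w.2)
  have hg : Continuous fun w => ‖g w‖ ^ 2 := by fun_prop
  have : ProperSpace E := FiniteDimensional.proper ℂ E
  have hK : IsCompact (Metric.sphere (0 : EuclideanSpace ℂ (Fin m)) 1 ×ˢ
      Metric.sphere (0 : E) 1) := (isCompact_sphere _ _).prod (isCompact_sphere _ _)
  obtain ⟨c, hc, hmin⟩ := hK.exists_forall_le' hg.continuousOn (a := 0) fun w hw => by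
    obtain ⟨h1, h2⟩ := hw
    rw [mem_sphere_zero_iff_norm] at h1 h2
    have h3 : g w ≠ 0 := fun h0 => by
      have : w.2 = 0 := h (fun j => w.1 j) (fun hz => by
        have : w.1 = 0 := by ext j; exact congrFun hz j
        rw [this, norm_zero] at h1
        exact zero_ne_one h1) w.2 h0
      rw [this, norm_zero] at h2
      exact zero_ne_one h2
    positivity
  refine ⟨c, hc, fun z v => ?_⟩
  rcases eq_or_ne v 0 with rfl | hv
  · simp
  rcases eq_or_ne z 0 with rfl | hz
  · simp
  let y : EuclideanSpace ℂ (Fin m) := WithLp.toLp 2 z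
  have hy : y ≠ 0 := fun h0 => hz (funext fun j => congrArg (fun y => y.ofLp j) h0)
  have hny : ‖y‖ ^ 2 = ∑ j, ‖z j‖ ^ 2 := EuclideanSpace.norm_sq_eq y
  have h1 := hmin (((‖y‖⁻¹ : ℝ) : ℂ) • y, ((‖v‖⁻¹ : ℝ) : ℂ) • v)
    ⟨by simp [norm_smul, hy], by simp [norm_smul, hv]⟩
  have h2 : g (((‖y‖⁻¹ : ℝ) : ℂ) • y, ((‖v‖⁻¹ : ℝ) : ℂ) • v) =
      ((‖y‖⁻¹ * ‖v‖⁻¹ : ℝ) : ℂ) • g (y, v) := by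
    simp only [g, Finset.smul_sum]
    refine Finset.sum_congr rfl fun j _ => ?_
    simp only [PiLp.smul_apply, smul_eq_mul, map_mul, Complex.conj_ofReal, map_smul, smul_smul,
      smul_add, Complex.ofReal_mul]
    congr 2 <;> ring
  rw [h2, norm_smul, mul_pow, Complex.norm_real, Real.norm_of_nonneg (by positivity)] at h1
  rw [← hny]
  have hy' := norm_pos_iff.2 hy
  have hv' := norm_pos_iff.2 hv
  change c * ‖y‖ ^ 2 * ‖v‖ ^ 2 ≤ ‖g (y, v)‖ ^ 2
  calc c * ‖y‖ ^ 2 * ‖v‖ ^ 2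
      ≤ (‖y‖⁻¹ * ‖v‖⁻¹) ^ 2 * ‖g (y, v)‖ ^ 2 * ‖y‖ ^ 2 * ‖v‖ ^ 2 := by gcongr
    _ = ‖g (y, v)‖ ^ 2 := by field_simp

/-- The Hermitian double of a complexified pair of real matrices. -/
noncomputable def double {ι : Type*} (A B : Matrix ι ι ℝ) : Matrix (ι ⊕ ι) (ι ⊕ ι) ℂ :=
  .fromBlocks 0 (Matrix.of fun i j => (A j i + Complex.I * B j i : ℂ))
    (Matrix.of fun i j => (A i j + Complex.I * B i j : ℂ)) 0

/-- A linear family of real matrices of dimension `2 * m` which is invertible away from zero lives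
in size divisible by `2 ^ m / 2`. -/
lemma two_pow_dvd_of_det_ne_zero {ι : Type*} [Fintype ι] [DecidableEq ι] (hm : 1 ≤ m)
    (M : Fin m ⊕ Fin m → Matrix ι ι ℝ)
    (h : ∀ l : Fin m ⊕ Fin m → ℝ, l ≠ 0 → (∑ i, l i • M i).det ≠ 0) :
    2 ^ m ∣ 2 * Fintype.card ι := by
  let N (j : Fin m) := double (M (.inl j)) (M (.inr j))
  let C (j : Fin m) := Matrix.toEuclideanCLM (𝕜 := ℂ) (N j)
  obtain ⟨c, hc, hC⟩ := exists_elliptic (C := C) fun z hz v hv => by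
    let l : Fin m ⊕ Fin m → ℝ := Sum.elim (fun j => (z j).re) fun j => (z j).im
    have hl : l ≠ 0 := fun h0 => hz (funext fun j =>
      Complex.ext (congrFun h0 (.inl j)) (congrFun h0 (.inr j)))
    let S := (∑ i, l i • M i).map Complex.ofRealHom
    have hS : S.det ≠ 0 := by
      rw [show S.det = Complex.ofRealHom (∑ i, l i • M i).det from
        (RingHom.map_det Complex.ofRealHom _).symm]
      simpa using h l hl
    have h1 : ∑ j, (conj (z j) • N j + z j • (N j).conjTranspose) =
        Matrix.fromBlocks 0 ((2 : ℂ) • S.transpose) ((2 : ℂ) • S) 0 := by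
      have hz' : ∀ j, ((z j).re + (z j).im * Complex.I : ℂ) = z j := fun j =>
        Complex.re_add_im (z j)
      have key : ∀ i k, ∑ j, (conj (z j) * (M (.inl j) i k + Complex.I * M (.inr j) i k) +
          z j * conj (M (.inl j) i k + Complex.I * M (.inr j) i k : ℂ)) = 2 * S i k := by
        intro i k
        simp only [S, Matrix.map_apply, Matrix.sum_apply, Fintype.sum_sum_type, Matrix.add_apply,
          Matrix.smul_apply, l, Sum.elim_inl, Sum.elim_inr, smul_eq_mul]
        rw [← Finset.sum_add_distrib, map_sum, Finset.mul_sum]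
        refine Finset.sum_congr rfl fun j _ => ?_
        apply Complex.ext <;> simp <;> ring
      ext (i | i) (k | k)
      · simp [N, double, Matrix.sum_apply]
      · simpa [N, double, Matrix.sum_apply] using key k i
      · simpa [N, double, Matrix.sum_apply] using key i k
      · simp [N, double, Matrix.sum_apply]
    have h2 : (∑ j, (conj (z j) • N j + z j • (N j).conjTranspose)).mulVec v.ofLp = 0 := by
      rw [← Matrix.ofLp_toEuclideanCLM, ← WithLp.ofLp_zero 2]
      congr 1
      rw [← hv, map_sum, sum_apply]
      refine Finset.sum_congr rfl fun j _ => ?_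
      rw [map_add, map_smul, map_smul, ← Matrix.star_eq_conjTranspose, map_star]
      rfl
    rw [h1, Matrix.fromBlocks_mulVec] at h2
    have h3 : S.mulVec (v.ofLp ∘ Sum.inl) = 0 := by
      funext i
      simpa [Matrix.smul_mulVec] using congrFun h2 (.inr i)
    have h4 : S.transpose.mulVec (v.ofLp ∘ Sum.inr) = 0 := by
      funext i
      simpa [Matrix.smul_mulVec] using congrFun h2 (.inl i)
    have h5 := Matrix.eq_zero_of_mulVec_eq_zero hS h3
    have h6 := Matrix.eq_zero_of_mulVec_eq_zero (by rwa [Matrix.det_transpose]) h4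
    ext (i | i)
    · exact congrFun h5 i
    · exact congrFun h6 i
  have := two_pow_dvd_finrank hc hC hm
  rwa [finrank_euclideanSpace, Fintype.card_sum, ← two_mul] at this

/-- A linear family of matrices of odd size and at least two parameters is somewhere singular. -/
lemma exists_det_eq_zero_of_odd {ι κ : Type*} [Fintype ι] [Fintype κ] [DecidableEq κ]
    [DecidableEq ι] [Nontrivial ι] (hκ : Odd (Fintype.card κ)) (M : ι → Matrix κ κ ℝ) :
    ∃ l : ι → ℝ, l ≠ 0 ∧ (∑ i, l i • M i).det = 0 := by
  obtain ⟨a, b, hab⟩ := exists_pair_ne ι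
  let l (t : ℝ) : ι → ℝ := Real.cos t • Pi.single a 1 + Real.sin t • Pi.single b 1
  have hl : ∀ t, l t ≠ 0 := fun t h => by
    have h1 : Real.cos t = 0 := by simpa [l, hab] using congrFun h a
    have h2 : Real.sin t = 0 := by simpa [l, hab.symm] using congrFun h b
    simpa [h1, h2] using Real.sin_sq_add_cos_sq t
  let f (t : ℝ) : ℝ := (∑ i, l t i • M i).det
  have hf : Continuous f := by
    refine Continuous.matrix_det (continuous_finsetSum _ fun i _ => ?_)
    refine (?_ : Continuous fun t => l t i).smul continuous_const
    simp only [l, Pi.add_apply, Pi.smul_apply]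
    fun_prop
  have hpi : f Real.pi = -f 0 := by
    have h1 : l Real.pi = -l 0 := by simp [l]
    have h2 : ∑ i, l Real.pi i • M i = -∑ i, l 0 i • M i := by
      rw [h1, ← Finset.sum_neg_distrib]
      exact Finset.sum_congr rfl fun i _ => neg_smul _ _
    simp only [f]
    rw [h2, Matrix.det_neg, hκ.neg_one_pow, neg_one_mul]
  obtain ⟨t, -, ht⟩ := intermediate_value_uIcc (a := 0) (b := Real.pi) hf.continuousOn
    (show (0 : ℝ) ∈ Set.uIcc (f 0) (f Real.pi) by
      rw [hpi, Set.mem_uIcc]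
      rcases le_total 0 (f 0) with h | h
      · right; constructor <;> linarith
      · left; constructor <;> linarith)
  exact ⟨l t, hl t, ht⟩

lemma four_mul_lt_two_pow {m : ℕ} (h : 5 ≤ m) : 4 * m < 2 ^ m := by
  induction m, h using Nat.le_induction with
  | base => norm_num
  | succ k hk ih => rw [pow_succ]; omega

end

end FockIndex

/-- if `n ∉ {1,2,4,8}`, then for every bilinear `Q : ℝⁿ × ℝⁿ → ℝⁿ` there is a
nonzero `λ` such that the matrix with `(j,k)` entry `Σ_i λ_i Q_{ijk}` is singular; i.e. no
operator `T_Q` has nonvanishing rotational curvature. -/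
theorem no_rotational_curvature_outside_1248 (n : ℕ) (hn : 1 ≤ n)
    (h : n ∉ ({1, 2, 4, 8} : Set ℕ))
    (Q : (Fin n → ℝ) →ₗ[ℝ] (Fin n → ℝ) →ₗ[ℝ] (Fin n → ℝ)) :
    ∃ l : Fin n → ℝ, l ≠ 0 ∧
      (Matrix.of fun j k : Fin n => ∑ i, l i * Q (Pi.single j 1) (Pi.single k 1) i).det = 0 := by
  simp only [Set.mem_insert_iff, Set.mem_singleton_iff, not_or] at h
  let M (i : Fin n) : Matrix (Fin n) (Fin n) ℝ :=
    .of fun j k => Q (Pi.single j 1) (Pi.single k 1) i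
  suffices H : ∃ l : Fin n → ℝ, l ≠ 0 ∧ (∑ i, l i • M i).det = 0 by
    obtain ⟨l, hl, hdet⟩ := H
    refine ⟨l, hl, ?_⟩
    rw [← hdet]
    congr 1
    ext j k
    simp [M, Matrix.sum_apply]
  rcases Nat.even_or_odd n with ⟨m, rfl⟩ | hodd
  · by_contra! H
    have hdvd := FockIndex.two_pow_dvd_of_det_ne_zero (m := m) (by omega)
      (fun i => M (finSumFinEquiv i)) fun l hl => by
        have := H (l ∘ finSumFinEquiv.symm) fun h0 => hl (funext fun i => by
          simpa using congrFun h0 (finSumFinEquiv i))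
        rwa [← finSumFinEquiv.sum_comp, Finset.sum_congr rfl fun i _ => by
          rw [Function.comp_apply, Equiv.symm_apply_apply]] at this
    rw [Fintype.card_fin] at hdvd
    rcases lt_or_ge m 5 with h5 | h5
    · interval_cases m <;> simp_all
    · have := Nat.le_of_dvd (by omega) hdvd
      have := FockIndex.four_mul_lt_two_pow h5
      omega
  · have : Nontrivial (Fin n) := Fin.nontrivial_iff_two_le.2 (by omega)
    exact FockIndex.exists_det_eq_zero_of_odd (by simpa using hodd) M
end

section
/- Suppose F : [0,∞) → [0,∞] is nonincreasing, and φ : ℝ^n → ℝ is smooth with ∂²φ/∂u_j²(u) = 0 for every j = 1,…,n and every u ∈ ℝ^n. Then for any box B = [-c_1,c_1] × ⋯ × [-c_n,c_n] (a product of intervals centered at the origin), ∫_B F(|φ(u)|) du ≤ ∫_B F(| u_1 ⋯ u_n · ∂ⁿφ/∂u_1⋯∂u_n (0) |) du. -/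
open MeasureTheory
open scoped ENNReal

/-- The composite of a function antitone on `[0, ∞)` with the absolute value of a
measurable function is measurable. -/
theorem measurable_comp_abs_of_antitoneOn {α : Type*} [MeasurableSpace α] {F : ℝ → ℝ≥0∞}
    (hF : AntitoneOn F (Set.Ici 0)) {f : α → ℝ} (hf : Measurable f) :
    Measurable fun x => F |f x| := by
  have hanti : Antitone fun x => F (max x 0) := fun x y hxy =>
    hF (le_max_right x 0) (le_max_right y 0) (max_le_max_right 0 hxy)
  simpa [Function.comp_def] using hanti.measurable.comp (measurable_abs.comp hf)

/-- Translating a function that is antitone in `|x|` decreases its integral over a centered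
interval. -/
theorem setLIntegral_Icc_comp_abs_add_le {G : ℝ → ℝ≥0∞} (hG : AntitoneOn G (Set.Ici 0))
    {c : ℝ} (hc : 0 ≤ c) (s : ℝ) :
    ∫⁻ t in Set.Icc (-c) c, G |t + s| ≤ ∫⁻ t in Set.Icc (-c) c, G |t| := by
  have hshift : ∫⁻ t in Set.Icc (-c) c, G |t + s|
      = ∫⁻ t in Set.Icc (-c + s) (c + s), G |t| := by
    have h := (measurePreserving_add_right volume s).setLIntegral_comp_preimage
      (measurableSet_Icc (a := -c + s) (b := c + s))
      (measurable_comp_abs_of_antitoneOn hG measurable_id)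
    simpa using h
  rw [hshift]
  set I := Set.Icc (-c + s) (c + s)
  set J := Set.Icc (-c) c
  have hI : MeasurableSet I := measurableSet_Icc
  have hJ : MeasurableSet J := measurableSet_Icc
  have hvol : volume (I \ J) = volume (J \ I) := by
    have h₁ := measure_inter_add_sdiff (μ := volume) I hJ
    have h₂ := measure_inter_add_sdiff (μ := volume) J hI
    have h₃ : volume I = volume J := by simp [I, J]
    rw [Set.inter_comm, ← h₃, ← h₁] at h₂
    have hfin : volume (I ∩ J) ≠ ∞ :=
      measure_ne_top_of_subset Set.inter_subset_left (by simp [I])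
    exact ((ENNReal.add_right_inj hfin).1 h₂).symm
  calc ∫⁻ t in I, G |t|
      = (∫⁻ t in I ∩ J, G |t|) + ∫⁻ t in I \ J, G |t| :=
        (lintegral_inter_add_sdiff _ I hJ).symm
    _ ≤ (∫⁻ t in I ∩ J, G |t|) + ∫⁻ t in I \ J, G c := by
        refine add_le_add_right ?_ _
        refine setLIntegral_mono' (hI.diff hJ) fun t ht => hG hc (abs_nonneg t) ?_
        by_contra! h
        exact ht.2 (abs_le.1 h.le)
    _ = (∫⁻ t in J ∩ I, G |t|) + ∫⁻ t in J \ I, G c := by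
        rw [setLIntegral_const, setLIntegral_const, hvol, Set.inter_comm]
    _ ≤ (∫⁻ t in J ∩ I, G |t|) + ∫⁻ t in J \ I, G |t| := by
        refine add_le_add_right ?_ _
        exact setLIntegral_mono' (hJ.diff hI) fun t ht => hG (abs_nonneg t) hc (abs_le.2 ht.1)
    _ = ∫⁻ t in J, G |t| := lintegral_inter_add_sdiff _ J hI

/-- Dilating the argument by a nonnegative factor preserves antitonicity on `[0, ∞)`. -/
theorem antitoneOn_comp_mul_left {F : ℝ → ℝ≥0∞} (hF : AntitoneOn F (Set.Ici 0)) {r : ℝ}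
    (hr : 0 ≤ r) : AntitoneOn (fun x => F (r * x)) (Set.Ici 0) := fun _ hx _ hy hxy =>
  hF (mul_nonneg hr hx) (mul_nonneg hr hy) (mul_le_mul_of_nonneg_left hxy hr)

/-- The one-dimensional case of the rearrangement inequality. -/
theorem setLIntegral_Icc_comp_abs_affine_le {F : ℝ → ℝ≥0∞} (hF : AntitoneOn F (Set.Ici 0))
    {c : ℝ} (hc : 0 ≤ c) (a b : ℝ) :
    ∫⁻ t in Set.Icc (-c) c, F |b + t * a| ≤ ∫⁻ t in Set.Icc (-c) c, F |t * a| := by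
  rcases eq_or_ne a 0 with rfl | ha
  · exact lintegral_mono fun t => hF (by simp) (by simp) (by simp)
  · have h := setLIntegral_Icc_comp_abs_add_le (antitoneOn_comp_mul_left hF (abs_nonneg a)) hc
      (b / a)
    have hmul (t : ℝ) : a * (t + b / a) = b + t * a := by
      field_simp
      ring
    simpa only [← abs_mul, hmul, mul_comm a] using h

/-- A function is affine in each variable separately. -/
def IsMultiAffine {n : ℕ} (φ : (Fin n → ℝ) → ℝ) : Prop :=
  ∀ (j : Fin n) (u : Fin n → ℝ), ∃ b : ℝ, ∀ t : ℝ, φ (u + t • Pi.single j 1) = φ u + t * b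

theorem contDiff_fderiv_apply {n : ℕ} {φ : (Fin n → ℝ) → ℝ} (hφ : ContDiff ℝ (⊤ : ℕ∞) φ)
    (e : Fin n → ℝ) : ContDiff ℝ (⊤ : ℕ∞) fun v => fderiv ℝ φ v e :=
  (hφ.fderiv_right (by simp)).clm_apply contDiff_const

theorem isMultiAffine_of_fderiv_fderiv_eq_zero {n : ℕ} {φ : (Fin n → ℝ) → ℝ}
    (hφ : ContDiff ℝ (⊤ : ℕ∞) φ)
    (hsec : ∀ (j : Fin n) (u : Fin n → ℝ),
      fderiv ℝ (fun v => fderiv ℝ φ v (Pi.single j 1)) u (Pi.single j 1) = 0) :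
    IsMultiAffine φ := by
  intro j u
  set e : Fin n → ℝ := Pi.single j 1
  have hline (t : ℝ) : HasDerivAt (fun t : ℝ => u + t • e) e t := by
    simpa using ((hasDerivAt_id t).smul_const e).const_add u
  have hφ' : Differentiable ℝ fun v => fderiv ℝ φ v e :=
    (contDiff_fderiv_apply hφ e).differentiable (by simp)
  have hconst (t : ℝ) : fderiv ℝ φ (u + t • e) e = fderiv ℝ φ u e := by
    have hd (t : ℝ) : HasDerivAt (fun t : ℝ => fderiv ℝ φ (u + t • e) e) 0 t := by
      have h := (hφ' (u + t • e)).hasFDerivAt.comp_hasDerivAt t (hline t)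
      rwa [hsec j] at h
    simpa using is_const_of_deriv_eq_zero (fun t => (hd t).differentiableAt)
      (fun t => (hd t).deriv) t 0
  refine ⟨fderiv ℝ φ u e, fun t => ?_⟩
  have hd (t : ℝ) :
      HasDerivAt (fun t : ℝ => φ (u + t • e) - t * fderiv ℝ φ u e) 0 t := by
    have h := ((hφ.differentiable (by simp)) (u + t • e)).hasFDerivAt.comp_hasDerivAt t (hline t)
    rw [hconst] at h
    simpa [Function.comp_def] using
      h.fun_sub ((hasDerivAt_id t).mul_const (fderiv ℝ φ u e))
  have h := is_const_of_deriv_eq_zero (fun t => (hd t).differentiableAt)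
    (fun t => (hd t).deriv) t 0
  simp at h
  linarith

theorem IsMultiAffine.apply_add_smul {n : ℕ} {φ : (Fin n → ℝ) → ℝ} (h : IsMultiAffine φ)
    (hφ : Differentiable ℝ φ) (j : Fin n) (u : Fin n → ℝ) (t : ℝ) :
    φ (u + t • Pi.single j 1) = φ u + t * fderiv ℝ φ u (Pi.single j 1) := by
  obtain ⟨b, hb⟩ := h j u
  have hb' : HasLineDerivAt ℝ φ b u (Pi.single j 1) := by
    simpa [HasLineDerivAt, hb] using ((hasDerivAt_id (0 : ℝ)).mul_const b).const_add (φ u)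
  rw [hb, ← (hφ u).lineDeriv_eq_fderiv, hb'.lineDeriv]

/-- The embedding of `ℝⁿ` into `ℝⁿ⁺¹` as the hyperplane where the last coordinate vanishes. -/
noncomputable def snocZero (n : ℕ) : (Fin n → ℝ) →L[ℝ] (Fin (n + 1) → ℝ) :=
  ContinuousLinearMap.pi fun i => Fin.lastCases 0 (fun j => ContinuousLinearMap.proj j) i

@[simp]
theorem snocZero_castSucc {n : ℕ} (u : Fin n → ℝ) (j : Fin n) : snocZero n u j.castSucc = u j := by
  simp [snocZero]

@[simp]
theorem snocZero_last {n : ℕ} (u : Fin n → ℝ) : snocZero n u (Fin.last n) = 0 := by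
  simp [snocZero]

theorem snocZero_single {n : ℕ} (j : Fin n) :
    snocZero n (Pi.single j 1) = Pi.single j.castSucc 1 := by
  ext i
  induction i using Fin.lastCases with
  | last => simp
  | cast i => simp [Pi.single_apply]

theorem insertNth_last_eq_snocZero_add {n : ℕ} (t : ℝ) (u : Fin n → ℝ) :
    (Fin.last n).insertNth (α := fun _ => ℝ) t u
      = snocZero n u + t • Pi.single (Fin.last n) 1 := by
  ext i
  induction i using Fin.lastCases with
  | last => simp
  | cast i => simp

/-- The coefficient of the last variable in a multi-affine function, as a function of the other
variables. -/
noncomputable def lastCoeff {n : ℕ} (φ : (Fin (n + 1) → ℝ) → ℝ) (u : Fin n → ℝ) : ℝ :=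
  fderiv ℝ φ (snocZero n u) (Pi.single (Fin.last n) 1)

theorem contDiff_lastCoeff {n : ℕ} {φ : (Fin (n + 1) → ℝ) → ℝ} (hφ : ContDiff ℝ (⊤ : ℕ∞) φ) :
    ContDiff ℝ (⊤ : ℕ∞) (lastCoeff φ) :=
  (contDiff_fderiv_apply hφ _).comp (snocZero n).contDiff

theorem IsMultiAffine.isMultiAffine_lastCoeff {n : ℕ} {φ : (Fin (n + 1) → ℝ) → ℝ} (h : IsMultiAffine φ)
    (hφ : Differentiable ℝ φ) : IsMultiAffine (lastCoeff φ) := by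
  have hdiff (u : Fin n → ℝ) : lastCoeff φ u
      = φ (snocZero n u + Pi.single (Fin.last n) 1) - φ (snocZero n u) := by
    have := h.apply_add_smul hφ (Fin.last n) (snocZero n u) 1
    simp only [one_smul, one_mul] at this
    rw [this, lastCoeff]
    ring
  intro j u
  obtain ⟨b₁, hb₁⟩ := h j.castSucc (snocZero n u + Pi.single (Fin.last n) 1)
  obtain ⟨b₀, hb₀⟩ := h j.castSucc (snocZero n u)
  refine ⟨b₁ - b₀, fun t => ?_⟩
  rw [hdiff, hdiff, map_add, map_smul, snocZero_single, add_right_comm, hb₁, hb₀]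
  ring

theorem iteratedFDeriv_lastCoeff {n : ℕ} {φ : (Fin (n + 1) → ℝ) → ℝ}
    (hφ : ContDiff ℝ (⊤ : ℕ∞) φ) :
    iteratedFDeriv ℝ n (lastCoeff φ) 0 (fun j => Pi.single j 1)
      = iteratedFDeriv ℝ (n + 1) φ 0 (fun j => Pi.single j 1) := by
  have hn : (n : WithTop ℕ∞) ≤ (⊤ : ℕ∞) := by exact_mod_cast le_top
  have hcomp : lastCoeff φ
      = (fun v => fderiv ℝ φ v (Pi.single (Fin.last n) 1)) ∘ snocZero n := rfl
  rw [hcomp, (snocZero n).iteratedFDeriv_comp_right (contDiff_fderiv_apply hφ _) 0 hn,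
    iteratedFDeriv_succ_apply_right, map_zero]
  simp only [ContinuousMultilinearMap.compContinuousLinearMap_apply, snocZero_single]
  have hφ' : ContDiff ℝ (⊤ : ℕ∞) (fderiv ℝ φ) := hφ.fderiv_right (by simp)
  rw [iteratedFDeriv_clm_apply_const_apply hφ' hn]
  rfl

/-- Tonelli's theorem on a box in `ℝⁿ⁺¹`, separating the last coordinate. -/
theorem setLIntegral_pi_Icc_succ {n : ℕ} (c : Fin (n + 1) → ℝ) {f : (Fin (n + 1) → ℝ) → ℝ≥0∞}
    (hf : Measurable f) :
    ∫⁻ u in Set.univ.pi (fun j => Set.Icc (-(c j)) (c j)), f u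
      = ∫⁻ p, f (snocZero n p.2 + p.1 • Pi.single (Fin.last n) 1)
          ∂((volume.restrict (Set.Icc (-(c (Fin.last n))) (c (Fin.last n)))).prod
            (volume.restrict
              (Set.univ.pi fun j : Fin n => Set.Icc (-(c j.castSucc)) (c j.castSucc)))) := by
  simp_rw [volume_pi, Measure.restrict_pi_pi]
  have h := (measurePreserving_piFinSuccAbove
    (fun j => (volume : Measure ℝ).restrict (Set.Icc (-(c j)) (c j))) (Fin.last n)).symm
  rw [← h.lintegral_comp hf]
  simp only [Fin.succAbove_last, ← insertNth_last_eq_snocZero_add]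
  rfl

theorem IsMultiAffine.setLIntegral_comp_abs_le {n : ℕ} {F : ℝ → ℝ≥0∞}
    (hF : AntitoneOn F (Set.Ici 0)) {φ : (Fin n → ℝ) → ℝ} (h : IsMultiAffine φ)
    (hφ : ContDiff ℝ (⊤ : ℕ∞) φ) {c : Fin n → ℝ} (hc : ∀ j, 0 ≤ c j) :
    ∫⁻ u in Set.univ.pi (fun j => Set.Icc (-(c j)) (c j)), F |φ u|
      ≤ ∫⁻ u in Set.univ.pi (fun j => Set.Icc (-(c j)) (c j)),
          F |(∏ j, u j) * iteratedFDeriv ℝ n φ 0 (fun j => Pi.single j 1)| := by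
  induction n generalizing F with
  | zero =>
    refine le_of_eq (lintegral_congr fun u => ?_)
    simp [Subsingleton.elim u 0]
  | succ n ih =>
    have hFm {α : Type} [MeasurableSpace α] {f : α → ℝ} (hf : Measurable f) :
        Measurable fun x => F |f x| := measurable_comp_abs_of_antitoneOn hF hf
    have hd : Differentiable ℝ φ := hφ.differentiable (by simp)
    have hcoeff : Measurable (lastCoeff φ) := (contDiff_lastCoeff hφ).continuous.measurable
    rw [setLIntegral_pi_Icc_succ c (hFm hφ.continuous.measurable),
      setLIntegral_pi_Icc_succ c (hFm (by fun_prop))]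
    simp only [h.apply_add_smul hd]
    set μ := (volume : Measure ℝ).restrict (Set.Icc (-(c (Fin.last n))) (c (Fin.last n)))
    set ν := (volume : Measure (Fin n → ℝ)).restrict
      (Set.univ.pi fun j : Fin n => Set.Icc (-(c j.castSucc)) (c j.castSucc))
    have hcoeff' : Measurable fun p : ℝ × (Fin n → ℝ) => p.1 * lastCoeff φ p.2 := by
      fun_prop
    calc ∫⁻ p, F |φ (snocZero n p.2) + p.1 * lastCoeff φ p.2| ∂(μ.prod ν)
        = ∫⁻ u, ∫⁻ t, F |φ (snocZero n u) + t * lastCoeff φ u| ∂μ ∂ν := by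
          refine lintegral_prod_symm' _ (hFm (Measurable.add ?_ hcoeff'))
          exact hφ.continuous.measurable.comp (by fun_prop)
      _ ≤ ∫⁻ u, ∫⁻ t, F |t * lastCoeff φ u| ∂μ ∂ν :=
          lintegral_mono fun u => setLIntegral_Icc_comp_abs_affine_le hF (hc _) _ _
      _ = ∫⁻ t, ∫⁻ u, F |t * lastCoeff φ u| ∂ν ∂μ :=
          (lintegral_lintegral_swap (hFm hcoeff').aemeasurable).symm
      _ ≤ ∫⁻ t, ∫⁻ u, F |t * ((∏ j, u j) *
            iteratedFDeriv ℝ n (lastCoeff φ) 0 (fun j => Pi.single j 1))| ∂ν ∂μ := by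
          refine lintegral_mono fun t => ?_
          simp only [abs_mul t]
          exact ih (antitoneOn_comp_mul_left hF (abs_nonneg t)) (h.isMultiAffine_lastCoeff hd)
            (contDiff_lastCoeff hφ) fun j => hc j.castSucc
      _ = _ := by
          rw [lintegral_prod _ (hFm (by fun_prop)).aemeasurable]
          refine lintegral_congr fun t => lintegral_congr fun u => ?_
          rw [iteratedFDeriv_lastCoeff hφ, Fin.prod_univ_castSucc]
          simp
          ring_nf


/-- if `F : [0,∞) → [0,∞]` is nonincreasing and `φ : ℝⁿ → ℝ` is smooth with
`∂²φ/∂u_j² ≡ 0` for every `j`, then for every box `B = ∏_j [-c_j, c_j]` centered at the origin,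
`∫_B F(|φ(u)|) du ≤ ∫_B F(|u₁⋯uₙ · ∂ⁿφ/∂u₁⋯∂uₙ(0)|) du`. -/
theorem rearrangement_multilinear (n : ℕ) (F : ℝ → ℝ≥0∞) (hF : AntitoneOn F (Set.Ici 0))
    (φ : (Fin n → ℝ) → ℝ) (hφ : ContDiff ℝ (⊤ : ℕ∞) φ)
    (hsec : ∀ (j : Fin n) (u : Fin n → ℝ),
      fderiv ℝ (fun v => fderiv ℝ φ v (Pi.single j 1)) u (Pi.single j 1) = 0)
    (c : Fin n → ℝ) (hc : ∀ j, 0 ≤ c j) :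
    ∫⁻ u in Set.univ.pi (fun j => Set.Icc (-(c j)) (c j)), F |φ u|
      ≤ ∫⁻ u in Set.univ.pi (fun j => Set.Icc (-(c j)) (c j)),
          F |(∏ j, u j) * iteratedFDeriv ℝ n φ 0 (fun j => Pi.single j 1)| := by
  exact (isMultiAffine_of_fderiv_fderiv_eq_zero hφ hsec).setLIntegral_comp_abs_le hF hφ hc
end

section
/- Let F : [0,∞) → [0,∞] be nonincreasing, let a, b ∈ ℝ, and let c > 0. Then ∫_{-c}^{c} F(|a u + b|) du ≤ ∫_{-c}^{c} F(|a u|) du. -/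
open MeasureTheory
open scoped ENNReal NNReal

/-- Among the sets of a given finite measure, a superlevel set of `g` maximizes `∫⁻ g`. -/
theorem setLIntegral_le_of_measure_eq {α : Type*} [MeasurableSpace α] {μ : Measure α}
    {g : α → ℝ≥0∞} {s t : Set α} (hs : MeasurableSet s) (ht : MeasurableSet t)
    (hst : μ s = μ t) (hfin : μ t ≠ ∞) {m : ℝ≥0∞} (hm : ∀ x ∈ t, m ≤ g x)
    (hm' : ∀ x ∉ t, g x ≤ m) :
    ∫⁻ x in s, g x ∂μ ≤ ∫⁻ x in t, g x ∂μ := by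
  have hdiff : μ (s \ t) = μ (t \ s) := by
    have h := (measure_sdiff_add_inter s ht (μ := μ)).trans
      (hst.trans (measure_sdiff_add_inter t hs (μ := μ)).symm)
    rw [Set.inter_comm t s] at h
    exact (ENNReal.add_left_inj (measure_ne_top_of_subset Set.inter_subset_right hfin)).1 h
  rw [← lintegral_inter_add_sdiff g s ht, ← lintegral_inter_add_sdiff g t hs, Set.inter_comm t s]
  refine add_le_add le_rfl ?_
  calc ∫⁻ x in s \ t, g x ∂μ ≤ ∫⁻ _ in s \ t, m ∂μ :=
        setLIntegral_mono' (hs.diff ht) fun x hx => hm' x hx.2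
    _ = ∫⁻ _ in t \ s, m ∂μ := by rw [setLIntegral_const, setLIntegral_const, hdiff]
    _ ≤ ∫⁻ x in t \ s, g x ∂μ := setLIntegral_mono' (ht.diff hs) fun x hx => hm x hx.1

/-- If `F : [0,∞) → [0,∞]` is nonincreasing, `a b : ℝ`, `c > 0`, then
`∫_{-c}^{c} F(|a u + b|) du ≤ ∫_{-c}^{c} F(|a u|) du`. -/
theorem rearrangement_one_dim (F : ℝ → ℝ≥0∞) (hF : AntitoneOn F (Set.Ici 0))
    (a b c : ℝ) (hc : 0 < c) :
    ∫⁻ u in Set.Icc (-c) c, F |a * u + b| ≤ ∫⁻ u in Set.Icc (-c) c, F |a * u| := by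
  rcases eq_or_ne a 0 with rfl | ha
  · refine lintegral_mono fun u => ?_
    simpa using hF (Set.mem_Ici.2 le_rfl) (abs_nonneg b) (abs_nonneg b)
  have hshift : ∫⁻ u in Set.Icc (-c) c, F |a * u + b| =
      ∫⁻ u in Set.Icc (-c + b / a) (c + b / a), F |a * u| := by
    have h := (measurePreserving_add_right volume (b / a)).setLIntegral_comp_preimage_emb
      (measurableEmbedding_addRight (b / a)) (fun u => F |a * u|)
      (Set.Icc (-c + b / a) (c + b / a))
    simpa [mul_add, mul_div_cancel₀, ha] using h
  rw [hshift]
  refine setLIntegral_le_of_measure_eq (m := F (|a| * c)) measurableSet_Icc measurableSet_Icc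
    (by simp) measure_Icc_lt_top.ne (fun u hu => ?_) fun u hu => ?_
  · refine hF (Set.mem_Ici.2 (abs_nonneg _)) (Set.mem_Ici.2 (by positivity)) ?_
    rw [abs_mul]
    gcongr
    exact abs_le.2 hu
  · refine hF (Set.mem_Ici.2 (by positivity)) (Set.mem_Ici.2 (abs_nonneg _)) ?_
    rw [abs_mul]
    gcongr
    exact (not_le.1 fun h => hu (abs_le.1 h)).le
end

section
/- Fix integers n, n', k ≥ 1 with n = n'(k-1) and let Φ : ℝ^n × ℝ^n → ℝ^{n'} be smooth. Consider the map Ψ : ℝ^n × ℝ^{n'} × (ℝ^n)^k → (ℝ^n × ℝ^{n'})^k given by Ψ(x, x', t^{(1)}, …, t^{(k)}) := (x + t^{(1)}, x' + Φ(x,t^{(1)}), …, x + t^{(k)}, x' + Φ(x,t^{(k)})). Then the absolute value of the Jacobian determinant of Ψ at (x, x', t^{(1)}, …, t^{(k)}) equals the absolute value of the determinant of the kn' × kn' matrix whose i-th block row (i = 1,…,k) is [ (∂/∂x − ∂/∂t)Φ(x, t^{(i)}) , I_{n'×n'} ], where (∂/∂x − ∂/∂t)Φ(x,t^{(i)}) is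 the n'×n matrix of the difference of the Jacobians of Φ in its first and second arguments at (x, t^{(i)}). -/
noncomputable section

/-- The domain `ℝⁿ × ℝ^{n'} × (ℝⁿ)^k` of the inflated map. -/
abbrev Pdom (n n' k : ℕ) := (Fin n → ℝ) × (Fin n' → ℝ) × (Fin k → Fin n → ℝ)

/-- The inflated map `Ψ(x, x', t⁽¹⁾, …, t⁽ᵏ⁾) = (x + t⁽ⁱ⁾, x' + Φ(x, t⁽ⁱ⁾))_{i=1}^k`. -/
def Psi {n n' k : ℕ} (Φ : (Fin n → ℝ) → (Fin n → ℝ) → Fin n' → ℝ) (p : Pdom n n' k) :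
    Fin k → (Fin n → ℝ) × (Fin n' → ℝ) :=
  fun i => (p.1 + p.2.2 i, p.2.1 + Φ p.1 (p.2.2 i))

/-- The standard basis vector of `Pdom n n' k` indexed by a coordinate. -/
def eDom {n n' k : ℕ} (c : Fin n ⊕ (Fin n' ⊕ Fin k × Fin n)) : Pdom n n' k :=
  match c with
  | Sum.inl j => (Pi.single j 1, 0, 0)
  | Sum.inr (Sum.inl j) => (0, Pi.single j 1, 0)
  | Sum.inr (Sum.inr (i, j)) => (0, 0, Pi.single i (Pi.single j 1))

/-- The Jacobian matrix of `Ψ` at `p`, in the standard coordinates of domain and codomain. -/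
def jacMat {n n' k : ℕ} (Φ : (Fin n → ℝ) → (Fin n → ℝ) → Fin n' → ℝ) (p : Pdom n n' k) :
    Matrix (Fin k × (Fin n ⊕ Fin n')) (Fin n ⊕ (Fin n' ⊕ Fin k × Fin n)) ℝ :=
  Matrix.of fun r c =>
    match r with
    | (i, Sum.inl a) => ((fderiv ℝ (Psi Φ) p (eDom c)) i).1 a
    | (i, Sum.inr a) => ((fderiv ℝ (Psi Φ) p (eDom c)) i).2 a

/-- The Jacobian matrix of `Ψ`, reindexed as a square `(k(n+n')) × (k(n+n'))` matrix using the
standard identifications (which only permute the rows and columns). -/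
def jacSq {n n' k : ℕ} (Φ : (Fin n → ℝ) → (Fin n → ℝ) → Fin n' → ℝ) (p : Pdom n n' k)
    (h : k * (n + n') = n + (n' + k * n)) :
    Matrix (Fin (k * (n + n'))) (Fin (k * (n + n'))) ℝ :=
  (jacMat Φ p).submatrix
    (fun a => (Equiv.prodCongr (Equiv.refl (Fin k)) finSumFinEquiv.symm)
      (finProdFinEquiv.symm a))
    (fun b => (Equiv.sumCongr (Equiv.refl (Fin n))
        ((finSumFinEquiv.symm).trans
          (Equiv.sumCongr (Equiv.refl (Fin n')) finProdFinEquiv.symm)))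
      (finSumFinEquiv.symm (finCongr h b)))

/-- The `kn' × (n + n')` matrix whose `i`-th block row is `[(∂/∂x − ∂/∂t)Φ(x,t⁽ⁱ⁾), I_{n'×n'}]`. -/
def smallMat {n n' k : ℕ} (Φ : (Fin n → ℝ) → (Fin n → ℝ) → Fin n' → ℝ)
    (x : Fin n → ℝ) (t : Fin k → Fin n → ℝ) :
    Matrix (Fin k × Fin n') (Fin n ⊕ Fin n') ℝ :=
  Matrix.of fun r c =>
    match c with
    | Sum.inl b =>
        (fderiv ℝ (fun y => Φ y (t r.1)) x - fderiv ℝ (fun s => Φ x s) (t r.1))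
          (Pi.single b 1) r.2
    | Sum.inr b => if r.2 = b then 1 else 0

/-- The matrix `smallMat`, reindexed as a square `(kn') × (kn')` matrix using the standard
identifications. -/
def smallSq {n n' k : ℕ} (Φ : (Fin n → ℝ) → (Fin n → ℝ) → Fin n' → ℝ)
    (x : Fin n → ℝ) (t : Fin k → Fin n → ℝ) (h : k * n' = n + n') :
    Matrix (Fin (k * n')) (Fin (k * n')) ℝ :=
  (smallMat Φ x t).submatrix
    (fun a => finProdFinEquiv.symm a)
    (fun b => finSumFinEquiv.symm (finCongr h b))

theorem dim_aux {n n' k : ℕ} (hk : 1 ≤ k) (hdim : n = n' * (k - 1)) :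
    k * n' = n + n' := by
  rcases Nat.exists_eq_add_of_le hk with ⟨k', rfl⟩
  subst hdim
  simp [Nat.add_sub_cancel_left]
  ring

theorem dim_aux' {n n' k : ℕ} (hk : 1 ≤ k) (hdim : n = n' * (k - 1)) :
    k * (n + n') = n + (n' + k * n) := by
  have h2 := dim_aux hk hdim
  rw [Nat.mul_add, h2]
  omega

theorem fderiv_Psi_apply {n n' k : ℕ} {Φ : (Fin n → ℝ) → (Fin n → ℝ) → Fin n' → ℝ}
    (hΦ : Differentiable ℝ fun z : (Fin n → ℝ) × (Fin n → ℝ) => Φ z.1 z.2)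
    (p v : Pdom n n' k) (i : Fin k) :
    fderiv ℝ (Psi Φ) p v i =
      (v.1 + v.2.2 i,
        v.2.1 + fderiv ℝ (fun z : (Fin n → ℝ) × (Fin n → ℝ) => Φ z.1 z.2) (p.1, p.2.2 i)
          (v.1, v.2.2 i)) := by
  have hx : HasFDerivAt (fun q : Pdom n n' k => q.1) (ContinuousLinearMap.fst ℝ _ _) p :=
    hasFDerivAt_fst
  have hx' : HasFDerivAt (fun q : Pdom n n' k => q.2.1)
      ((ContinuousLinearMap.fst ℝ _ _).comp (ContinuousLinearMap.snd ℝ _ _)) p :=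
    hasFDerivAt_snd.fst
  have ht (j : Fin k) : HasFDerivAt (fun q : Pdom n n' k => q.2.2 j)
      ((ContinuousLinearMap.proj j).comp
        ((ContinuousLinearMap.snd ℝ _ _).comp (ContinuousLinearMap.snd ℝ _ _))) p :=
    hasFDerivAt_pi'.1 hasFDerivAt_snd.snd j
  have hcomp (j : Fin k) :=
    HasFDerivAt.comp p (hΦ (p.1, p.2.2 j)).hasFDerivAt (hx.prodMk (ht j))
  have key : HasFDerivAt (Psi Φ) (ContinuousLinearMap.pi _) p :=
    hasFDerivAt_pi.2 fun j => (hx.add (ht j)).prodMk (hx'.add (hcomp j))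
  rw [key.fderiv]
  rfl

theorem fderiv_sub_fderiv_apply {n n' : ℕ} {Φ : (Fin n → ℝ) → (Fin n → ℝ) → Fin n' → ℝ}
    (hΦ : Differentiable ℝ fun z : (Fin n → ℝ) × (Fin n → ℝ) => Φ z.1 z.2)
    (x t w : Fin n → ℝ) :
    (fderiv ℝ (fun y => Φ y t) x - fderiv ℝ (fun s => Φ x s) t) w =
      fderiv ℝ (fun z : (Fin n → ℝ) × (Fin n → ℝ) => Φ z.1 z.2) (x, t) (w, 0) -
        fderiv ℝ (fun z : (Fin n → ℝ) × (Fin n → ℝ) => Φ z.1 z.2) (x, t) (0, w) := by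
  have h₁ : HasFDerivAt (fun y => Φ y t) _ x :=
    (hΦ (x, t)).hasFDerivAt.comp (f := fun y => (y, t)) x (hasFDerivAt_prodMk_left x t)
  have h₂ : HasFDerivAt (fun s => Φ x s) _ t :=
    (hΦ (x, t)).hasFDerivAt.comp (f := fun s => (x, s)) t (hasFDerivAt_prodMk_right x t)
  rw [h₁.fderiv, h₂.fderiv]
  simp

/-- For a rectangular matrix whose row and column types are identified with a common index type,
the absolute determinant does not depend on the identifications. -/
theorem abs_det_submatrix_equiv_indep {ι κ R C : Type*} [Fintype ι] [DecidableEq ι] [Fintype κ]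
    [DecidableEq κ] (M : Matrix R C ℝ) (e : ι ≃ R) (f : ι ≃ C) (e' : κ ≃ R) (f' : κ ≃ C) :
    |(M.submatrix e f).det| = |(M.submatrix e' f').det| := by
  rw [← Matrix.abs_det_submatrix_equiv_equiv (e.trans e'.symm) (f.trans f'.symm)
    (M.submatrix e' f'), Matrix.submatrix_submatrix]
  congr 3 <;> ext <;> simp

/-- The columns of the Jacobian matrix of `Psi`, with those of the `t`-variables put first. -/
def colEquiv {n n' k : ℕ} (σ : Fin k × Fin n' ≃ Fin n ⊕ Fin n') :
    (Fin k × Fin n) ⊕ (Fin k × Fin n') ≃ Fin n ⊕ (Fin n' ⊕ Fin k × Fin n) :=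
  (Equiv.sumComm _ _).trans
    ((Equiv.sumCongr σ (Equiv.refl _)).trans (Equiv.sumAssoc _ _ _))

/-- Clearing the `x`-columns of the rows of `x + t⁽ⁱ⁾` leaves `smallMat` as a Schur complement. -/
theorem det_jacMat_submatrix {n n' k : ℕ} {Φ : (Fin n → ℝ) → (Fin n → ℝ) → Fin n' → ℝ}
    (hΦ : Differentiable ℝ fun z : (Fin n → ℝ) × (Fin n → ℝ) => Φ z.1 z.2)
    (p : Pdom n n' k) (σ : Fin k × Fin n' ≃ Fin n ⊕ Fin n') :
    ((jacMat Φ p).submatrix (Equiv.prodSumDistrib (Fin k) (Fin n) (Fin n')).symm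
      (colEquiv σ)).det = ((smallMat Φ p.1 p.2.2).submatrix (Equiv.refl _) σ).det := by
  set J := (jacMat Φ p).submatrix (Equiv.prodSumDistrib (Fin k) (Fin n) (Fin n')).symm
    (colEquiv σ) with hJ
  have h₁₁ : J.toBlocks₁₁ = 1 := by
    ext ⟨i, a⟩ ⟨i', b⟩
    simp [hJ, Matrix.toBlocks₁₁, colEquiv, jacMat, eDom, fderiv_Psi_apply hΦ, Matrix.one_apply,
      Pi.single_apply, ite_and, apply_ite (fun f : Fin n → ℝ => f a)]
  rw [← Matrix.fromBlocks_toBlocks J, h₁₁, Matrix.det_fromBlocks_one₁₁]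
  congr 1
  ext ⟨i, a⟩ r
  obtain ⟨c, rfl⟩ := σ.symm.surjective r
  have h₂₁ (q : Fin k × Fin n) : J.toBlocks₂₁ (i, a) q = if i = q.1 then
      fderiv ℝ (fun z : (Fin n → ℝ) × (Fin n → ℝ) => Φ z.1 z.2) (p.1, p.2.2 i)
        (0, Pi.single q.2 1) a else 0 := by
    by_cases h : i = q.1 <;>
      simp [hJ, Matrix.toBlocks₂₁, colEquiv, jacMat, eDom, fderiv_Psi_apply hΦ, Pi.single_apply, h,
        Prod.mk_zero_zero]
  rw [Matrix.sub_apply, Matrix.mul_apply, Fintype.sum_prod_type]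
  simp only [h₂₁]
  rcases c with b | b
  · simp [hJ, Matrix.toBlocks₂₂, Matrix.toBlocks₁₂, colEquiv, jacMat, eDom, smallMat,
      fderiv_Psi_apply hΦ, fderiv_sub_fderiv_apply hΦ,
      Pi.single_apply]
  · simp [hJ, Matrix.toBlocks₂₂, Matrix.toBlocks₁₂, colEquiv, jacMat, eDom, smallMat,
      fderiv_Psi_apply hΦ, Pi.single_apply, Prod.mk_zero_zero]

/-- the absolute Jacobian determinant of the inflated map `Ψ` equals the absolute
determinant of the `kn' × kn'` matrix whose `i`-th block row is
`[(∂/∂x − ∂/∂t)Φ(x,t⁽ⁱ⁾), I_{n'×n'}]`. -/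
theorem abs_jacobian_eq (n n' k : ℕ) (hn : 1 ≤ n) (hn' : 1 ≤ n') (hk : 1 ≤ k)
    (hdim : n = n' * (k - 1))
    (Φ : (Fin n → ℝ) → (Fin n → ℝ) → Fin n' → ℝ)
    (hΦ : ContDiff ℝ (⊤ : ℕ∞) (fun z : (Fin n → ℝ) × (Fin n → ℝ) => Φ z.1 z.2))
    (p : Pdom n n' k) :
    |(jacSq Φ p (dim_aux' hk hdim)).det| = |(smallSq Φ p.1 p.2.2 (dim_aux hk hdim)).det| := by
  let σ : Fin k × Fin n' ≃ Fin n ⊕ Fin n' :=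
    finProdFinEquiv.trans ((finCongr (dim_aux hk hdim)).trans finSumFinEquiv.symm)
  have hdiff := hΦ.differentiable (by simp)
  calc |(jacSq Φ p (dim_aux' hk hdim)).det|
      = |((jacMat Φ p).submatrix (Equiv.prodSumDistrib (Fin k) (Fin n) (Fin n')).symm
          (colEquiv σ)).det| :=
        abs_det_submatrix_equiv_indep (jacMat Φ p)
          (finProdFinEquiv.symm.trans
            (Equiv.prodCongr (Equiv.refl (Fin k)) finSumFinEquiv.symm))
          ((finCongr (dim_aux' hk hdim)).trans (finSumFinEquiv.symm.trans
            (Equiv.sumCongr (Equiv.refl (Fin n)) (finSumFinEquiv.symm.trans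
              (Equiv.sumCongr (Equiv.refl (Fin n')) finProdFinEquiv.symm))))) _ _
    _ = |((smallMat Φ p.1 p.2.2).submatrix (Equiv.refl _) σ).det| := by
        rw [det_jacMat_submatrix hdiff]
    _ = |(smallSq Φ p.1 p.2.2 (dim_aux hk hdim)).det| :=
        abs_det_submatrix_equiv_indep _ _ _ finProdFinEquiv.symm
          ((finCongr (dim_aux hk hdim)).trans finSumFinEquiv.symm)

end
end
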